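/- As T → ∞, 𝒥_+(T) ≫ T (log T)^{−1/2}; that is, there is a constant c > 0 such that the measure of the set of t ∈ (T,2T] with Z(t) > 0 is at least c · T (log T)^{−1/2} for all sufficiently large T. -/

import Mathlib

open MeasureTheory

/-- The phase factor `e^{iθ(t)} = π^{-it/2} Γ(1/4+it/2)/|Γ(1/4+it/2)|`. -/
noncomputable def eTheta (t : ℝ) : ℂ :=
  (Real.pi : ℂ) ^ (-(Complex.I * (t : ℂ)) / 2) *
    (Complex.Gamma (1 / 4 + Complex.I * (t : ℂ) / 2) /
      ‖Complex.Gamma (1 / 4 + Complex.I * (t : ℂ) / 2)‖)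

/-- Hardy's function `Z(t) = e^{iθ(t)} ζ(1/2+it)` (a real number for real `t`). -/
noncomputable def HardyZ (t : ℝ) : ℝ :=
  (eTheta t * riemannZeta (1 / 2 + Complex.I * (t : ℂ))).re

/-- `𝒥₊(T)`: Lebesgue measure of `{T < t ≤ 2T : Z(t) > 0}`. -/
noncomputable def Jmeasplus (T : ℝ) : ℝ :=
  (volume {t : ℝ | t ∈ Set.Ioc T (2 * T) ∧ 0 < HardyZ t}).toReal

open Complex in
lemma norm_sin_le_exp_abs_im (z : ℂ) : ‖Complex.sin z‖ ≤ Real.exp |z.im| := by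
  rw [Complex.sin, norm_div, norm_mul, Complex.norm_I, mul_one]
  have h1 : ‖cexp (-z * I)‖ ≤ Real.exp |z.im| := by
    rw [Complex.norm_exp]; apply Real.exp_le_exp.2; simp [le_abs_self]
  have h2 : ‖cexp (z * I)‖ ≤ Real.exp |z.im| := by
    rw [Complex.norm_exp]; apply Real.exp_le_exp.2; simp [neg_le_abs]
  have h3 := norm_sub_le (cexp (-z * I)) (cexp (z * I))
  rw [Complex.norm_ofNat, div_le_iff₀ (by norm_num)]
  linarith

lemma normSq_gamma_half {v : ℝ} :
    Real.pi * Real.exp (-(Real.pi * |v|)) ≤ ‖Complex.Gamma (1 / 2 + Complex.I * v)‖ ^ 2 := by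
  have h := Complex.Gamma_mul_Gamma_one_sub (1 / 2 + Complex.I * v)
  have e : (1 : ℂ) - (1 / 2 + Complex.I * v) = (starRingEnd ℂ) (1 / 2 + Complex.I * v) := by
    simp [Complex.ext_iff]; norm_num
  rw [e, Complex.Gamma_conj] at h
  have h2 := congrArg norm h
  rw [norm_mul, RCLike.norm_conj, ← sq, norm_div, Complex.norm_real, Real.norm_of_nonneg Real.pi_pos.le] at h2
  rw [h2]
  have h3 := norm_sin_le_exp_abs_im (Real.pi * (1 / 2 + Complex.I * v))
  have h4 : ((Real.pi : ℂ) * (1 / 2 + Complex.I * v)).im = Real.pi * v := by simp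
  rw [h4, abs_mul, abs_of_pos Real.pi_pos] at h3
  have h5 : 0 < ‖Complex.sin (Real.pi * (1 / 2 + Complex.I * v))‖ := by
    rcases eq_or_lt_of_le (norm_nonneg (Complex.sin (Real.pi * (1 / 2 + Complex.I * v)))) with h0 | h0
    · rw [← h0, div_zero] at h2
      have : Complex.Gamma (1 / 2 + Complex.I * v) ≠ 0 :=
        Complex.Gamma_ne_zero_of_re_pos (by simp)
      have := norm_ne_zero_iff.2 this
      exact absurd h2 (pow_ne_zero 2 this)
    · exact h0
  rw [Real.exp_neg, ← div_eq_mul_inv]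
  gcongr

lemma normSq_gamma_imag {v : ℝ} (hv : 0 < v) :
    Real.pi * Real.exp (-(Real.pi * v)) / v ≤ ‖Complex.Gamma (Complex.I * v)‖ ^ 2 := by
  have hv0 : (Complex.I * v : ℂ) ≠ 0 := by simp [hv.ne']
  have h := Complex.Gamma_mul_Gamma_one_sub (Complex.I * v)
  have e : (1 : ℂ) - (Complex.I * v) = (starRingEnd ℂ) (Complex.I * v) + 1 := by
    simp [Complex.ext_iff]
  rw [e, Complex.Gamma_add_one _ (by simp [hv.ne']), Complex.Gamma_conj] at h
  have h2 := congrArg norm h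
  rw [norm_mul, norm_mul, RCLike.norm_conj, RCLike.norm_conj, norm_div, Complex.norm_real,
    Real.norm_of_nonneg Real.pi_pos.le] at h2
  have e2 : ‖(Complex.I * v : ℂ)‖ = v := by simp [abs_of_pos hv]
  rw [e2] at h2
  have h3 := norm_sin_le_exp_abs_im (Real.pi * (Complex.I * v))
  have h4 : ((Real.pi : ℂ) * (Complex.I * v)).im = Real.pi * v := by simp
  rw [h4, abs_mul, abs_of_pos Real.pi_pos, abs_of_pos hv] at h3
  have h5 : 0 < ‖Complex.sin (Real.pi * (Complex.I * v))‖ := by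
    rcases eq_or_lt_of_le (norm_nonneg (Complex.sin (Real.pi * (Complex.I * v)))) with h0 | h0
    · rw [← h0, div_zero] at h2
      have : Complex.Gamma (Complex.I * v) ≠ 0 := by
        apply Complex.Gamma_ne_zero
        intro m hm
        have := congrArg Complex.im hm
        simp at this
        exact hv.ne' this
      have := norm_ne_zero_iff.2 this
      exact absurd h2 (by positivity)
    · exact h0
  have h6 : ‖Complex.Gamma (Complex.I * v)‖ ^ 2 =
      Real.pi / ‖Complex.sin (Real.pi * (Complex.I * v))‖ / v := by
    rw [← h2]; field_simp
  rw [h6, Real.exp_neg, ← div_eq_mul_inv]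
  gcongr

lemma prod_gamma_ratio_lower {v : ℝ} (hv : 1 ≤ v) (m : ℕ) :
    (1 / 2 + 1 / (2 * (m + 1)) : ℝ) * ∏ j ∈ Finset.range m, ((1 / 4 + j : ℝ) ^ 2 + v ^ 2) ^ 2 ≤
    ∏ j ∈ Finset.range m, (((1 / 2 + j : ℝ) ^ 2 + v ^ 2) * ((j : ℝ) ^ 2 + v ^ 2)) := by
  induction m with
  | zero => norm_num
  | succ m ih =>
    rw [Finset.prod_range_succ, Finset.prod_range_succ]
    have hP : 0 ≤ ∏ j ∈ Finset.range m, ((1 / 4 + j : ℝ) ^ 2 + v ^ 2) ^ 2 :=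
      Finset.prod_nonneg fun _ _ => by positivity
    have hm : (0 : ℝ) ≤ m := Nat.cast_nonneg m
    have key : (1 / 2 + 1 / (2 * ((m + 1 : ℕ) + 1)) : ℝ) * ((1 / 4 + m : ℝ) ^ 2 + v ^ 2) ^ 2 ≤
        (1 / 2 + 1 / (2 * (m + 1)) : ℝ) * (((1 / 2 + m : ℝ) ^ 2 + v ^ 2) * ((m : ℝ) ^ 2 + v ^ 2)) := by
      have hv2 : 1 ≤ v ^ 2 := by nlinarith
      set V := v ^ 2
      set a : ℝ := 1 / 4 + m with ha
      have e1 : (((1 / 2 + m : ℝ) ^ 2 + V) * ((m : ℝ) ^ 2 + V)) =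
        (a ^ 2 + V) ^ 2 + (a ^ 2 + V) / 8 + 1 / 256 - a ^ 2 / 4 := by rw [ha]; ring
      have e2 : (a ^ 2 + V) ^ 2 * (1 - 1 / (8 * (a ^ 2 + 1))) ≤
        (a ^ 2 + V) ^ 2 + (a ^ 2 + V) / 8 + 1 / 256 - a ^ 2 / 4 := by
        have : a ^ 2 / 8 - V / 8  ≤ (a ^ 2 + V) ^ 2 * (1 / (8 * (a ^ 2 + 1))) := by
          rw [mul_one_div, le_div_iff₀ (by positivity)]
          nlinarith [sq_nonneg a, mul_nonneg (sq_nonneg a) (sub_nonneg.2 hv2)]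
        linarith
      have e3 : (1 / 2 + 1 / (2 * ((m + 1 : ℕ) + 1)) : ℝ) ≤
          (1 / 2 + 1 / (2 * (m + 1)) : ℝ) * (1 - 1 / (8 * (a ^ 2 + 1))) := by
        have h1 : 1 / (8 * (a ^ 2 + 1)) ≤ 1 / ((m : ℝ) + 2) ^ 2 := by
          apply one_div_le_one_div_of_le (by positivity)
          rw [ha]; nlinarith
        have h2 : (1 / 2 + 1 / (2 * ((m + 1 : ℕ) + 1)) : ℝ) =
          (1 / 2 + 1 / (2 * (m + 1)) : ℝ) * (1 - 1 / ((m : ℝ) + 2) ^ 2) := by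
          push_cast; field_simp; ring
        rw [h2]; gcongr
      rw [e1]
      calc _ ≤ (1 / 2 + 1 / (2 * (m + 1)) : ℝ) * (1 - 1 / (8 * (a ^ 2 + 1))) * (a ^ 2 + V) ^ 2 := by
            gcongr
        _ = (1 / 2 + 1 / (2 * (m + 1)) : ℝ) * ((a ^ 2 + V) ^ 2 * (1 - 1 / (8 * (a ^ 2 + 1)))) := by ring
        _ ≤ _ := by gcongr
    calc _ = (∏ j ∈ Finset.range m, ((1 / 4 + j : ℝ) ^ 2 + v ^ 2) ^ 2) * 
          ((1 / 2 + 1 / (2 * ((m + 1 : ℕ) + 1)) : ℝ) * ((1 / 4 + m : ℝ) ^ 2 + v ^ 2) ^ 2) := by ring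
      _ ≤ (∏ j ∈ Finset.range m, ((1 / 4 + j : ℝ) ^ 2 + v ^ 2) ^ 2) * ((1 / 2 + 1 / (2 * (m + 1)) : ℝ) * (((1 / 2 + m : ℝ) ^ 2 + v ^ 2) * ((m : ℝ) ^ 2 + v ^ 2))) := by
          gcongr
      _ = ((1 / 2 + 1 / (2 * (m + 1)) : ℝ) * ∏ j ∈ Finset.range m, ((1 / 4 + j : ℝ) ^ 2 + v ^ 2) ^ 2) * (((1 / 2 + m : ℝ) ^ 2 + v ^ 2) * ((m : ℝ) ^ 2 + v ^ 2)) := by ring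
      _ ≤ _ := by gcongr

lemma normSq_GammaSeq (σ v : ℝ) {n : ℕ} (hn : n ≠ 0) :
    ‖Complex.GammaSeq (σ + Complex.I * v) n‖ ^ 2 =
      ((n : ℝ) ^ σ * (n.factorial : ℝ)) ^ 2 /
        ∏ j ∈ Finset.range (n + 1), ((σ + j) ^ 2 + v ^ 2) := by
  rw [Complex.GammaSeq, norm_div, norm_mul, norm_prod, div_pow, ← Finset.prod_pow]
  congr 2
  · congr 1
    · rw [Complex.norm_natCast_cpow_of_pos (Nat.pos_of_ne_zero hn)]; simp
    · simp
  · funext j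
    rw [← Complex.normSq_eq_norm_sq, Complex.normSq_apply]; simp; ring

lemma gamma_quarter_lower {v : ℝ} (hv : 1 ≤ v) :
    Real.exp (-(2 * Real.pi * v)) / v ≤ ‖Complex.Gamma (1 / 4 + Complex.I * v)‖ ^ 4 := by
  have hv0 : 0 < v := by linarith
  have key : 1 / 2 * (‖Complex.Gamma (1 / 2 + Complex.I * v)‖ ^ 2 * ‖Complex.Gamma (Complex.I * v)‖ ^ 2)
      ≤ ‖Complex.Gamma (1 / 4 + Complex.I * v)‖ ^ 4 := by
    have t1 := ((Complex.GammaSeq_tendsto_Gamma (1 / 2 + Complex.I * v)).norm.pow 2)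
    have t2 := ((Complex.GammaSeq_tendsto_Gamma (Complex.I * v)).norm.pow 2)
    have t3 := ((Complex.GammaSeq_tendsto_Gamma (1 / 4 + Complex.I * v)).norm.pow 4)
    refine le_of_tendsto_of_tendsto ((t1.mul t2).const_mul (1 / 2)) t3 ?_
    filter_upwards [Filter.eventually_ne_atTop 0] with n hn
    have a1 := normSq_GammaSeq (1 / 2) v hn
    have a2 := normSq_GammaSeq 0 v hn
    have a3 := normSq_GammaSeq (1 / 4) v hn
    push_cast at a1 a2 a3
    rw [zero_add] at a2
    rw [show ‖Complex.GammaSeq (1 / 4 + Complex.I * v) n‖ ^ 4 =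
      (‖Complex.GammaSeq (1 / 4 + Complex.I * v) n‖ ^ 2) ^ 2 by ring, a1, a2, a3]
    have hn0 : (0 : ℝ) < n := by positivity
    have h4 : ((n : ℝ) ^ (1 / 4 : ℝ)) ^ 4 = n := by
      rw [← Real.rpow_natCast, ← Real.rpow_mul hn0.le]; norm_num
    have h2 : ((n : ℝ) ^ (1 / 2 : ℝ)) ^ 2 = n := by
      rw [← Real.rpow_natCast, ← Real.rpow_mul hn0.le]; norm_num
    have hp := prod_gamma_ratio_lower hv (n + 1)
    rw [Finset.prod_mul_distrib] at hp
    simp only [Real.rpow_zero, one_mul, zero_add]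
    set A := ∏ j ∈ Finset.range (n + 1), ((1 / 2 + j : ℝ) ^ 2 + v ^ 2)
    set B := ∏ j ∈ Finset.range (n + 1), ((j : ℝ) ^ 2 + v ^ 2)
    have hA : 0 < A := Finset.prod_pos fun _ _ => by positivity
    have hB : 0 < B := Finset.prod_pos fun _ _ => by positivity
    rw [Finset.prod_pow] at hp
    set C := ∏ j ∈ Finset.range (n + 1), ((1 / 4 + j : ℝ) ^ 2 + v ^ 2)
    have hC : 0 < C := Finset.prod_pos fun _ _ => by positivity
    rw [mul_pow, mul_pow, div_pow, mul_pow, ← pow_mul, h4, h2]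
    have hp2 : 1 / 2 * C ^ 2 ≤ A * B := by
      refine le_trans ?_ hp
      have : 0 ≤ 1 / (2 * ((n + 1 : ℕ) + 1) : ℝ) := by positivity
      gcongr
      linarith
    have : 1 / 2 * (n * (n.factorial : ℝ) ^ 2 / A * ((n.factorial : ℝ) ^ 2 / B)) =
      (n * ((n.factorial : ℝ) ^ 2) ^ 2) * (1 / 2 / (A * B)) := by field_simp
    rw [this, mul_div_assoc]
    have h3 : 1 / 2 / (A * B) ≤ 1 / C ^ 2 := by
      rw [div_le_div_iff₀ (by positivity) (by positivity)]; linarith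
    calc _ ≤ (n * ((n.factorial : ℝ) ^ 2) ^ 2) * (1 / C ^ 2) := by gcongr
      _ = _ := by ring
  refine le_trans ?_ key
  have h1 := normSq_gamma_half (v := v)
  rw [abs_of_pos hv0] at h1
  have h2 := normSq_gamma_imag hv0
  have h3 : Real.exp (-(2 * Real.pi * v)) = Real.exp (-(Real.pi * v)) * Real.exp (-(Real.pi * v)) := by
    rw [← Real.exp_add]; ring_nf
  calc _ ≤ 1 / 2 * ((Real.pi * Real.exp (-(Real.pi * v))) * (Real.pi * Real.exp (-(Real.pi * v)) / v)) := by
        rw [h3]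
        have : 1 ≤ 1 / 2 * Real.pi ^ 2 := by nlinarith [Real.pi_gt_three]
        have h5 : 0 ≤ Real.exp (-(Real.pi * v)) * Real.exp (-(Real.pi * v)) / v := by positivity
        calc _ ≤ (1 / 2 * Real.pi ^ 2) * (Real.exp (-(Real.pi * v)) * Real.exp (-(Real.pi * v)) / v) := by nlinarith
          _ = _ := by ring
    _ ≤ _ := by gcongr

/-- Error between `(n+1)^{-s}` and the integral of `x^{-s}` over `[n, n+1]`. -/
noncomputable def zetaCell (s : ℂ) (n : ℕ) : ℂ :=
  ((n + 1 : ℕ) : ℂ) ^ (-s) + (((n + 1 : ℕ) : ℂ) ^ (1 - s) - (n : ℂ) ^ (1 - s)) / (s - 1)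

lemma zetaCell_eq_integral {s : ℂ} (h1 : s ≠ 1) {n : ℕ} (hn : 1 ≤ n) :
    zetaCell s n = ∫ x in (n : ℝ)..(n + 1 : ℕ), -s * ((x : ℂ) - n) * (x : ℂ) ^ (-s - 1) := by
  have hs1 : s - 1 ≠ 0 := sub_ne_zero.2 h1
  have hle : (n : ℝ) ≤ (n + 1 : ℕ) := by push_cast; linarith
  have hpos : ∀ x ∈ Set.uIcc (n : ℝ) (n + 1 : ℕ), 0 < x := by
    intro x hx
    rw [Set.uIcc_of_le hle] at hx
    have : (1 : ℝ) ≤ n := by exact_mod_cast hn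
    linarith [hx.1]
  have hd : ∀ x ∈ Set.uIcc (n : ℝ) (n + 1 : ℕ), HasDerivAt
      (fun x : ℝ => ((x : ℂ) - n) * (x : ℂ) ^ (-s) + (x : ℂ) ^ (1 - s) / (s - 1))
      (-s * ((x : ℂ) - n) * (x : ℂ) ^ (-s - 1)) x := by
    intro x hx
    have hx0 := hpos x hx
    have hsl : (x : ℂ) ∈ Complex.slitPlane := by simp [Complex.mem_slitPlane_iff, hx0]
    have hA : HasDerivAt (fun z : ℂ => (z - n) * z ^ (-s) + z ^ (1 - s) / (s - 1))
        (1 * (x : ℂ) ^ (-s) + ((x : ℂ) - n) * (-s * (x : ℂ) ^ (-s - 1) * 1) +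
          ((1 - s) * (x : ℂ) ^ (1 - s - 1) * 1) / (s - 1)) (x : ℂ) :=
      (((hasDerivAt_id _).sub_const _).mul ((hasDerivAt_id _).cpow_const hsl)).add
        (((hasDerivAt_id _).cpow_const hsl).div_const _)
    convert hA.comp_ofReal using 1
    rw [show 1 - s - 1 = -s by ring]
    field_simp
    ring
  have hc : ContinuousOn (fun x : ℝ => -s * ((x : ℂ) - n) * (x : ℂ) ^ (-s - 1))
      (Set.uIcc (n : ℝ) (n + 1 : ℕ)) := by
    intro x hx
    have hx0 := hpos x hx
    apply ContinuousAt.continuousWithinAt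
    have : ContinuousAt (fun x : ℝ => (x : ℂ) ^ (-s - 1)) x :=
      Complex.continuousAt_ofReal_cpow_const _ _ (Or.inr hx0.ne')
    fun_prop
  rw [intervalIntegral.integral_eq_sub_of_hasDerivAt hd hc.intervalIntegrable, zetaCell]
  push_cast
  ring

lemma norm_zetaCell_le_integral {s : ℂ} (h1 : s ≠ 1) {n : ℕ} (hn : 1 ≤ n) :
    ‖zetaCell s n‖ ≤ ‖s‖ * ∫ x in (n : ℝ)..(n + 1 : ℕ), x ^ (-s.re - 1) := by
  have hle : (n : ℝ) ≤ (n + 1 : ℕ) := by push_cast; linarith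
  have hn1 : (1 : ℝ) ≤ n := by exact_mod_cast hn
  rw [zetaCell_eq_integral h1 hn, ← intervalIntegral.integral_const_mul]
  apply intervalIntegral.norm_integral_le_of_norm_le hle
  · refine Filter.Eventually.of_forall fun x hx => ?_
    have hx0 : 0 < x := by linarith [hx.1]
    rw [norm_mul, norm_mul, norm_neg, Complex.norm_cpow_eq_rpow_re_of_pos hx0]
    have : ‖((x : ℂ) - n)‖ ≤ 1 := by
      rw [← Complex.ofReal_natCast, ← Complex.ofReal_sub, Complex.norm_real, Real.norm_eq_abs, abs_le]
      have := hx.2; push_cast at this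
      constructor <;> linarith [hx.1]
    simp only [Complex.sub_re, Complex.neg_re, Complex.one_re]
    calc _ ≤ ‖s‖ * 1 * x ^ (-s.re - 1) := by gcongr
      _ = _ := by ring
  · apply IntervalIntegrable.const_mul
    apply intervalIntegral.intervalIntegrable_rpow
    right
    rw [Set.uIcc_of_le hle]
    intro h; linarith [h.1]

lemma norm_zetaCell_le_telescope {s : ℂ} (h1 : s ≠ 1) (hs : 0 < s.re) {n : ℕ} (hn : 1 ≤ n) :
    ‖zetaCell s n‖ ≤ ‖s‖ / s.re * ((n : ℝ) ^ (-s.re) - ((n + 1 : ℕ) : ℝ) ^ (-s.re)) := by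
  refine (norm_zetaCell_le_integral h1 hn).trans (le_of_eq ?_)
  have hle : (n : ℝ) ≤ (n + 1 : ℕ) := by push_cast; linarith
  have hn1 : (1 : ℝ) ≤ n := by exact_mod_cast hn
  rw [integral_rpow]
  · rw [show -s.re - 1 + 1 = -s.re by ring]
    field_simp
    ring
  · right
    refine ⟨by linarith, ?_⟩
    rw [Set.uIcc_of_le hle]
    intro h; linarith [h.1]

lemma norm_zetaCell_le {s : ℂ} (h1 : s ≠ 1) {r : ℝ} (hr : 0 < r) (hs : r ≤ s.re) {n : ℕ} (hn : 1 ≤ n) :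
    ‖zetaCell s n‖ ≤ ‖s‖ * (1 / (n : ℝ) ^ (1 + r)) := by
  refine (norm_zetaCell_le_integral h1 hn).trans ?_
  have hle : (n : ℝ) ≤ (n + 1 : ℕ) := by push_cast; linarith
  have hn1 : (1 : ℝ) ≤ n := by exact_mod_cast hn
  gcongr
  have : ‖∫ x in (n : ℝ)..(n + 1 : ℕ), x ^ (-s.re - 1)‖ ≤ (1 / (n : ℝ) ^ (1 + r)) * |((n + 1 : ℕ) : ℝ) - n| := by
    apply intervalIntegral.norm_integral_le_of_norm_le_const
    intro x hx
    rw [Set.uIoc_of_le hle] at hx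
    have hx0 : 0 < x := by linarith [hx.1]
    rw [Real.norm_of_nonneg (by positivity), one_div, ← Real.rpow_neg (by positivity)]
    calc x ^ (-s.re - 1) ≤ x ^ (-(1 + r)) :=
          Real.rpow_le_rpow_of_exponent_le (by linarith [hx.1]) (by linarith)
      _ ≤ _ := Real.rpow_le_rpow_of_nonpos (by linarith) hx.1.le (by linarith)
  refine (le_abs_self _).trans (this.trans (le_of_eq ?_))
  push_cast; simp

lemma summable_zetaCell {s : ℂ} (h1 : s ≠ 1) (hs : 0 < s.re) {N : ℕ} (hN : 1 ≤ N) :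
    Summable fun n => ‖zetaCell s (n + N)‖ := by
  have h : Summable fun n : ℕ => ‖s‖ * (1 / ((n + N : ℕ) : ℝ) ^ (1 + s.re)) :=
    ((summable_nat_add_iff N).2 (Real.summable_one_div_nat_rpow.2 (by linarith))).mul_left _
  exact Summable.of_nonneg_of_le (fun _ => norm_nonneg _)
    (fun n => norm_zetaCell_le h1 hs le_rfl (by omega)) h

lemma norm_tsum_zetaCell_le {s : ℂ} (h1 : s ≠ 1) (hs : 0 < s.re) {N : ℕ} (hN : 1 ≤ N) :
    ‖∑' n, zetaCell s (n + N)‖ ≤ ‖s‖ / s.re * (N : ℝ) ^ (-s.re) := by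
  refine (norm_tsum_le_tsum_norm (summable_zetaCell h1 hs hN)).trans ?_
  refine (summable_zetaCell h1 hs hN).tsum_le_of_sum_range_le fun M => ?_
  calc ∑ n ∈ Finset.range M, ‖zetaCell s (n + N)‖ ≤
      ∑ n ∈ Finset.range M, ‖s‖ / s.re * (((n + N : ℕ) : ℝ) ^ (-s.re) - ((n + 1 + N : ℕ) : ℝ) ^ (-s.re)) := by
        apply Finset.sum_le_sum
        intro n _
        have := norm_zetaCell_le_telescope h1 hs (n := n + N) (by omega)
        rwa [show n + N + 1 = n + 1 + N by ring] at this
    _ = ‖s‖ / s.re * ((N : ℝ) ^ (-s.re) - ((M + N : ℕ) : ℝ) ^ (-s.re)) := by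
        rw [← Finset.mul_sum, Finset.sum_range_sub' (fun n => ((n + N : ℕ) : ℝ) ^ (-s.re))]
        simp
    _ ≤ _ := by
        gcongr
        have : 0 ≤ ((M + N : ℕ) : ℝ) ^ (-s.re) := by positivity
        linarith

lemma riemannZeta_eq_of_one_lt_re {s : ℂ} (hs : 1 < s.re) {N : ℕ} (hN : 1 ≤ N) :
    riemannZeta s = ∑ n ∈ Finset.Icc 1 N, (n : ℂ) ^ (-s) + (N : ℂ) ^ (1 - s) / (s - 1) +
      ∑' n, zetaCell s (n + N) := by
  have h1 : s ≠ 1 := by rintro rfl; simp at hs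
  have ht := (summable_zetaCell h1 (by linarith) hN).of_norm.hasSum.tendsto_sum_nat
  have hz := zeta_eq_tsum_one_div_nat_cpow hs
  have hsum : Summable fun n : ℕ => 1 / (n : ℂ) ^ s := Complex.summable_one_div_nat_cpow.2 hs
  have ht2 := hsum.hasSum.tendsto_sum_nat
  rw [← hz] at ht2
  have e : ∀ M, ∑ n ∈ Finset.range M, zetaCell s (n + N) =
      ∑ n ∈ Finset.range (M + (N + 1)), 1 / (n : ℂ) ^ s - ∑ n ∈ Finset.Icc 1 N, (n : ℂ) ^ (-s) +
      (((M + N : ℕ) : ℂ) ^ (1 - s) - (N : ℂ) ^ (1 - s)) / (s - 1) := by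
    intro M
    induction M with
    | zero =>
      have : ∑ n ∈ Finset.range (0 + (N + 1)), 1 / (n : ℂ) ^ s = ∑ n ∈ Finset.Icc 1 N, (n : ℂ) ^ (-s) := by
        rw [zero_add, Finset.range_eq_Ico, Finset.sum_eq_sum_Ico_succ_bot (by omega)]
        have hs0 : s ≠ 0 := by rintro rfl; simp at hs; linarith
        simp only [Nat.cast_zero, Complex.zero_cpow hs0, div_zero, zero_add]
        apply Finset.sum_congr rfl
        intro n _
        rw [Complex.cpow_neg, one_div]
      rw [this]; simp
    | succ M ih =>
      rw [Finset.sum_range_succ, ih, zetaCell, show M + 1 + (N + 1) = M + (N + 1) + 1 by ring,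
        Finset.sum_range_succ _ (M + (N + 1)), Complex.cpow_neg,
        show M + N + 1 = M + (N + 1) by ring, show M + 1 + N = M + (N + 1) by ring]
      ring
  have hlim : Filter.Tendsto (fun M : ℕ => ((M + N : ℕ) : ℂ) ^ (1 - s)) Filter.atTop (nhds 0) := by
    rw [tendsto_zero_iff_norm_tendsto_zero]
    have : ∀ M : ℕ, ‖((M + N : ℕ) : ℂ) ^ (1 - s)‖ = ((M + N : ℕ) : ℝ) ^ (-(s.re - 1)) := by
      intro M
      rw [Complex.norm_natCast_cpow_of_pos (by omega)]
      congr 1; simp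
    simp_rw [this]
    exact (tendsto_rpow_neg_atTop (by linarith)).comp
      (tendsto_natCast_atTop_atTop.comp (Filter.tendsto_add_atTop_nat N))
  have ht3 := ((((Filter.tendsto_add_atTop_iff_nat (N + 1)).2 ht2).sub_const
    (∑ n ∈ Finset.Icc 1 N, (n : ℂ) ^ (-s))).add ((hlim.sub_const ((N : ℂ) ^ (1 - s))).div_const (s - 1)))
  have := tendsto_nhds_unique (ht.congr e) ht3
  rw [this]; ring

lemma analyticOnNhd_zetaCell_tsum {N : ℕ} (hN : 1 ≤ N) :
    AnalyticOnNhd ℂ (fun s => ∑' n, (s - 1) * zetaCell s (n + N)) {s | 0 < s.re} := by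
  have hU : IsOpen {s : ℂ | 0 < s.re} := isOpen_lt continuous_const Complex.continuous_re
  apply DifferentiableOn.analyticOnNhd _ hU
  intro s hs
  apply DifferentiableAt.differentiableWithinAt
  set V := {w : ℂ | s.re / 2 < w.re} ∩ Metric.ball 0 (‖s‖ + 1) with hV
  have hVo : IsOpen V := (isOpen_lt continuous_const Complex.continuous_re).inter Metric.isOpen_ball
  have hs' : 0 < s.re := hs
  have hsV : s ∈ V := ⟨by simp only [Set.mem_ofPred_eq]; linarith, by simp⟩
  have hmul : ∀ n : ℕ, ∀ w : ℂ, w ≠ 1 → (w - 1) * zetaCell w (n + N) =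
      (w - 1) * ((n + N + 1 : ℕ) : ℂ) ^ (-w) + (((n + N + 1 : ℕ) : ℂ) ^ (1 - w) - ((n + N : ℕ) : ℂ) ^ (1 - w)) := by
    intro n w hw
    have : w - 1 ≠ 0 := sub_ne_zero.2 hw
    rw [zetaCell]; field_simp
  have hmul' : ∀ n : ℕ, ∀ w : ℂ, (w - 1) * zetaCell w (n + N) =
      (w - 1) * ((n + N + 1 : ℕ) : ℂ) ^ (-w) + (((n + N + 1 : ℕ) : ℂ) ^ (1 - w) - ((n + N : ℕ) : ℂ) ^ (1 - w)) := by
    intro n w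
    rcases eq_or_ne w 1 with rfl | hw
    · simp
    · exact hmul n w hw
  have hdiff : DifferentiableOn ℂ (fun s => ∑' n, (s - 1) * zetaCell s (n + N)) V := by
    refine Complex.differentiableOn_tsum_of_summable_norm
      (u := fun n : ℕ => (‖s‖ + 2) * ((‖s‖ + 1) * (1 / ((n + N : ℕ) : ℝ) ^ (1 + s.re / 2)))) ?_ ?_ hVo ?_
    · exact (((summable_nat_add_iff N).2 (Real.summable_one_div_nat_rpow.2 (by linarith))).mul_left _).mul_left _
    · intro n
      simp_rw [hmul' n]
      have a : ∀ m : ℕ, 1 ≤ m → ∀ w : ℂ, DifferentiableAt ℂ (fun w : ℂ => (m : ℂ) ^ (-w)) w := by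
        intro m hm w
        exact (differentiableAt_id.neg).const_cpow (Or.inl (by exact_mod_cast (by omega : m ≠ 0)))
      have b : ∀ m : ℕ, 1 ≤ m → ∀ w : ℂ, DifferentiableAt ℂ (fun w : ℂ => (m : ℂ) ^ (1 - w)) w := by
        intro m hm w
        exact (differentiableAt_id.const_sub 1).const_cpow (Or.inl (by exact_mod_cast (by omega : m ≠ 0)))
      intro w _
      apply DifferentiableAt.differentiableWithinAt
      exact ((differentiableAt_id.sub_const 1).mul (a _ (by omega) w)).add
        ((b _ (by omega) w).sub (b _ (by omega) w))
    · intro n w hw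
      have hw2 : ‖w‖ < ‖s‖ + 1 := by simpa using hw.2
      rcases eq_or_ne w 1 with rfl | hw1
      · simp; positivity
      · rw [norm_mul]
        have h1 := norm_zetaCell_le hw1 (r := s.re / 2) (by linarith) (le_of_lt hw.1) (n := n + N) (by omega)
        have h2 : ‖w - 1‖ ≤ ‖s‖ + 2 := by
          have := norm_sub_le w 1
          simp at this; linarith
        calc _ ≤ (‖s‖ + 2) * (‖w‖ * (1 / ((n + N : ℕ) : ℝ) ^ (1 + s.re / 2))) := by gcongr
          _ ≤ _ := by gcongr
  exact hdiff.differentiableAt (hVo.mem_nhds hsV)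

lemma riemannZeta_eq_of_re_pos {s : ℂ} (hs : 0 < s.re) (h1 : s ≠ 1) {N : ℕ} (hN : 1 ≤ N) :
    riemannZeta s = ∑ n ∈ Finset.Icc 1 N, (n : ℂ) ^ (-s) + (N : ℂ) ^ (1 - s) / (s - 1) +
      ∑' n, zetaCell s (n + N) := by
  have hU : IsPreconnected {s : ℂ | 0 < s.re} := (convex_halfSpace_re_gt 0).isPreconnected
  have hd : ∀ m : ℕ, 1 ≤ m → Differentiable ℂ (fun w : ℂ => (m : ℂ) ^ (-w)) := by
    intro m hm w
    exact (differentiableAt_id.neg).const_cpow (Or.inl (by exact_mod_cast (by omega : m ≠ 0)))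
  have hd' : Differentiable ℂ (fun w : ℂ => (N : ℂ) ^ (1 - w)) := by
    intro w
    exact (differentiableAt_id.const_sub 1).const_cpow (Or.inl (by exact_mod_cast (by omega : N ≠ 0)))
  have hA : AnalyticOnNhd ℂ (fun s => riemannZeta₁ s - (s - 1) * ∑ n ∈ Finset.Icc 1 N, (n : ℂ) ^ (-s) -
      (N : ℂ) ^ (1 - s)) {s | 0 < s.re} := by
    apply DifferentiableOn.analyticOnNhd _ (isOpen_lt continuous_const Complex.continuous_re)
    apply Differentiable.differentiableOn
    refine (differentiable_riemannZeta₁.sub (Differentiable.mul (differentiable_id.sub_const 1) ?_)).sub hd'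
    exact Differentiable.fun_sum fun n hn => hd n (Finset.mem_Icc.1 hn).1
  have hz : (2 : ℂ) ∈ {s : ℂ | 0 < s.re} := by simp
  have key := hA.eqOn_of_preconnected_of_eventuallyEq (analyticOnNhd_zetaCell_tsum hN) hU hz (by
    have : {s : ℂ | 1 < s.re} ∈ nhds (2 : ℂ) :=
      (isOpen_lt continuous_const Complex.continuous_re).mem_nhds (by simp)
    filter_upwards [this] with w hw
    have hw1 : w ≠ 1 := by rintro rfl; simp at hw
    have hw2 : w - 1 ≠ 0 := sub_ne_zero.2 hw1
    have e := riemannZeta_eq_of_one_lt_re hw hN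
    rw [riemannZeta_eq_inv_sub_mul hw1] at e
    rw [tsum_mul_left]
    field_simp at e
    rw [e]; ring)
  have hs1 : s - 1 ≠ 0 := sub_ne_zero.2 h1
  have := key hs
  simp only [tsum_mul_left] at this
  rw [riemannZeta_eq_inv_sub_mul h1]
  field_simp
  linear_combination this

lemma norm_zeta_sub_partial_le {s : ℂ} (hs : 0 < s.re) (h1 : s ≠ 1) {N : ℕ} (hN : 1 ≤ N) :
    ‖riemannZeta s - (∑ n ∈ Finset.Icc 1 N, (n : ℂ) ^ (-s) + (N : ℂ) ^ (1 - s) / (s - 1))‖ ≤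
      ‖s‖ / s.re * (N : ℝ) ^ (-s.re) := by
  rw [riemannZeta_eq_of_re_pos hs h1 hN, add_sub_cancel_left]
  exact norm_tsum_zetaCell_le h1 hs hN

lemma norm_integral_mul_exp_le {a b l M : ℝ} (hab : a ≤ b) (hl : l ≠ 0) {g g' g'' : ℝ → ℂ}
    (hg : ∀ t, HasDerivAt g (g' t) t) (hg' : ∀ t, HasDerivAt g' (g'' t) t)
    (hc : Continuous g'') (ha : g a = 0) (hb : g b = 0) (ha' : g' a = 0) (hb' : g' b = 0)
    (hM : ∀ t ∈ Set.Icc a b, ‖g'' t‖ ≤ M) :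
    ‖∫ t in a..b, g t * Complex.exp (Complex.I * (l * t))‖ ≤ M * (b - a) / l ^ 2 := by
  have hl' : (l : ℂ) ≠ 0 := by exact_mod_cast hl
  have hE : ∀ t : ℝ, HasDerivAt (fun t : ℝ => Complex.exp (Complex.I * (l * t)) / (Complex.I * l))
      (Complex.exp (Complex.I * (l * t))) t := by
    intro t
    have h1 : HasDerivAt (fun z : ℂ => Complex.exp (Complex.I * (l * z)) / (Complex.I * l))
        (Complex.exp (Complex.I * (l * t)) * (Complex.I * (l * 1)) / (Complex.I * l)) (t : ℂ) :=
      ((((hasDerivAt_id (t : ℂ)).const_mul (l : ℂ)).const_mul Complex.I).cexp).div_const _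
    convert h1.comp_ofReal using 1
    field_simp
  have hEc : Continuous fun t : ℝ => Complex.exp (Complex.I * (l * t)) := by fun_prop
  have hgc : Continuous g' := continuous_iff_continuousAt.2 fun t => (hg' t).continuousAt
  have key : ∀ h h' : ℝ → ℂ, (∀ t, HasDerivAt h (h' t) t) → Continuous h' → h a = 0 → h b = 0 →
      ∫ t in a..b, h t * Complex.exp (Complex.I * (l * t)) =
        -(Complex.I * l)⁻¹ * ∫ t in a..b, h' t * Complex.exp (Complex.I * (l * t)) := by
    intro h h' hd hcont h0 h1
    rw [intervalIntegral.integral_mul_deriv_eq_deriv_mul (fun t _ => hd t) (fun t _ => hE t)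
      (hcont.intervalIntegrable _ _) (hEc.intervalIntegrable _ _), h0, h1,
      ← intervalIntegral.integral_const_mul, zero_mul, zero_mul, sub_zero, zero_sub,
      ← intervalIntegral.integral_neg]
    congr 1
    ext t
    field_simp
  rw [key g g' hg hgc ha hb, key g' g'' hg' hc ha' hb', norm_mul, norm_mul]
  have hI : ‖∫ t in a..b, g'' t * Complex.exp (Complex.I * (l * t))‖ ≤ M * |b - a| := by
    apply intervalIntegral.norm_integral_le_of_norm_le_const
    intro t ht
    rw [Set.uIoc_of_le hab] at ht
    have : ‖Complex.exp (Complex.I * (l * t))‖ = 1 := by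
      rw [mul_comm]; exact_mod_cast Complex.norm_exp_ofReal_mul_I (l * t)
    rw [norm_mul, this, mul_one]
    exact hM t ⟨ht.1.le, ht.2⟩
  rw [abs_of_nonneg (by linarith)] at hI
  have hn : ‖-(Complex.I * (l : ℂ))⁻¹‖ = |l|⁻¹ := by simp
  rw [hn]
  have : M * (b - a) / l ^ 2 = |l|⁻¹ * (|l|⁻¹ * (M * (b - a))) := by
    rw [← sq_abs]
    have : |l| ≠ 0 := abs_ne_zero.2 hl
    field_simp
  rw [this]
  gcongr

/-- A polynomial bump on `[T, 2T]`. -/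
noncomputable def bump (T t : ℝ) : ℝ := 16 * ((t - T) * (2 * T - t)) ^ 2 / T ^ 4

noncomputable def bumpDeriv (T t : ℝ) : ℝ :=
  32 * ((t - T) * (2 * T - t)) * (3 * T - 2 * t) / T ^ 4

noncomputable def bumpDerivTwo (T t : ℝ) : ℝ :=
  32 * ((3 * T - 2 * t) ^ 2 - 2 * ((t - T) * (2 * T - t))) / T ^ 4

lemma hasDerivAt_bump (T t : ℝ) : HasDerivAt (bump T) (bumpDeriv T t) t := by
  have h : HasDerivAt (fun t : ℝ => (t - T) * (2 * T - t)) (1 * (2 * T - t) + (t - T) * (-1)) t :=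
    ((hasDerivAt_id t).sub_const T).mul ((hasDerivAt_id t).const_sub (2 * T))
  refine (((h.pow 2).const_mul 16).div_const (T ^ 4)).congr_deriv ?_
  rw [bumpDeriv]; push_cast; ring

lemma hasDerivAt_bumpDeriv (T t : ℝ) : HasDerivAt (bumpDeriv T) (bumpDerivTwo T t) t := by
  have h : HasDerivAt (fun t : ℝ => (t - T) * (2 * T - t)) (1 * (2 * T - t) + (t - T) * (-1)) t :=
    ((hasDerivAt_id t).sub_const T).mul ((hasDerivAt_id t).const_sub (2 * T))
  have h2 : HasDerivAt (fun t : ℝ => 3 * T - 2 * t) (-(2 * 1)) t :=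
    ((hasDerivAt_id t).const_mul 2).const_sub (3 * T)
  refine (((h.const_mul 32).mul h2).div_const (T ^ 4)).congr_deriv ?_
  rw [bumpDerivTwo]; ring

lemma bump_nonneg (T t : ℝ) : 0 ≤ bump T t := by unfold bump; positivity

lemma bump_le_one {T t : ℝ} (hT : 0 < T) (ht : t ∈ Set.Icc T (2 * T)) : bump T t ≤ 1 := by
  unfold bump
  have h0 : 0 ≤ (t - T) * (2 * T - t) := mul_nonneg (by linarith [ht.1]) (by linarith [ht.2])
  have h1 : (t - T) * (2 * T - t) ≤ T ^ 2 / 4 := by nlinarith [sq_nonneg (2 * t - 3 * T)]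
  rw [div_le_one (by positivity)]
  have := pow_le_pow_left₀ h0 h1 2
  nlinarith

lemma abs_bumpDeriv_le {T t : ℝ} (hT : 0 < T) (ht : t ∈ Set.Icc T (2 * T)) :
    |bumpDeriv T t| ≤ 8 / T := by
  unfold bumpDeriv
  have h0 : 0 ≤ (t - T) * (2 * T - t) := mul_nonneg (by linarith [ht.1]) (by linarith [ht.2])
  have h1 : (t - T) * (2 * T - t) ≤ T ^ 2 / 4 := by nlinarith [sq_nonneg (2 * t - 3 * T)]
  have h2 : |3 * T - 2 * t| ≤ T := abs_le.2 ⟨by linarith [ht.2], by linarith [ht.1]⟩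
  rw [abs_div, abs_mul, abs_mul, abs_of_nonneg h0, abs_of_pos (by positivity : (0:ℝ) < T ^ 4),
    div_le_div_iff₀ (by positivity) hT, abs_of_pos (by norm_num : (0:ℝ) < 32)]
  have h3 := mul_le_mul h1 h2 (abs_nonneg _) (by positivity)
  nlinarith

lemma abs_bumpDerivTwo_le {T t : ℝ} (hT : 0 < T) (ht : t ∈ Set.Icc T (2 * T)) :
    |bumpDerivTwo T t| ≤ 32 / T ^ 2 := by
  unfold bumpDerivTwo
  have h0 : 0 ≤ (t - T) * (2 * T - t) := mul_nonneg (by linarith [ht.1]) (by linarith [ht.2])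
  have h1 : (t - T) * (2 * T - t) ≤ T ^ 2 / 4 := by nlinarith [sq_nonneg (2 * t - 3 * T)]
  have h2 : (3 * T - 2 * t) ^ 2 = T ^ 2 - 4 * ((t - T) * (2 * T - t)) := by ring
  have h3 : |32 * ((3 * T - 2 * t) ^ 2 - 2 * ((t - T) * (2 * T - t)))| ≤ 32 * T ^ 2 := by
    rw [abs_le]; constructor <;> nlinarith
  rw [abs_div, abs_of_pos (by positivity : (0:ℝ) < T ^ 4), div_le_div_iff₀ (by positivity)
    (by positivity)]
  nlinarith [sq_nonneg T]

lemma integral_bump {T : ℝ} (hT : 0 < T) : ∫ t in T..(2 * T), bump T t = 8 / 15 * T := by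
  have hd : ∀ t ∈ Set.uIcc T (2 * T), HasDerivAt
      (fun t : ℝ => 16 / T ^ 4 * ((t - T) ^ 3 * T ^ 2 / 3 - (t - T) ^ 4 * T / 2 + (t - T) ^ 5 / 5))
      (bump T t) t := by
    intro t _
    have h : HasDerivAt (fun t : ℝ => t - T) 1 t := (hasDerivAt_id t).sub_const T
    refine ((((((h.pow 3).mul_const (T ^ 2)).div_const 3).sub
      (((h.pow 4).mul_const T).div_const 2)).add ((h.pow 5).div_const 5)).const_mul (16 / T ^ 4)).congr_deriv ?_
    rw [bump]; push_cast; field_simp; ring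
  have hc : Continuous (bump T) := by unfold bump; fun_prop
  rw [intervalIntegral.integral_eq_sub_of_hasDerivAt hd (hc.intervalIntegrable _ _)]
  field_simp
  ring

lemma continuous_bump (T : ℝ) : Continuous (bump T) := by unfold bump; fun_prop

lemma bump_left (T : ℝ) : bump T T = 0 := by simp [bump]
lemma bump_right (T : ℝ) : bump T (2 * T) = 0 := by simp [bump]
lemma bumpDeriv_left (T : ℝ) : bumpDeriv T T = 0 := by simp [bumpDeriv]
lemma bumpDeriv_right (T : ℝ) : bumpDeriv T (2 * T) = 0 := by simp [bumpDeriv]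

lemma norm_integral_bump_mul_exp_le {T l : ℝ} (hT : 0 < T) (hl : l ≠ 0) :
    ‖∫ t in T..(2 * T), (bump T t : ℂ) * Complex.exp (Complex.I * (l * t))‖ ≤
      32 / (T * l ^ 2) := by
  have hc : Continuous fun t => ((bumpDerivTwo T t : ℝ) : ℂ) := by
    unfold bumpDerivTwo; fun_prop
  refine (norm_integral_mul_exp_le (M := 32 / T ^ 2) (by linarith) hl
    (fun t => (hasDerivAt_bump T t).ofReal_comp) (fun t => (hasDerivAt_bumpDeriv T t).ofReal_comp)
    hc (by simp [bump_left]) (by simp [bump_right]) (by simp [bumpDeriv_left])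
    (by simp [bumpDeriv_right]) ?_).trans (le_of_eq ?_)
  · intro t ht
    rw [Complex.norm_real]
    exact abs_bumpDerivTwo_le hT ht
  · field_simp; ring

lemma norm_integral_bump_div_mul_exp_le {T l : ℝ} (hT : 0 < T) (hl : l ≠ 0) :
    ‖∫ t in T..(2 * T), (bump T t : ℂ) / (-1 / 2 + Complex.I * t) *
      Complex.exp (Complex.I * (l * t))‖ ≤ 50 / (T ^ 2 * l ^ 2) := by
  have hz : ∀ t : ℝ, (-1 / 2 + Complex.I * t : ℂ) ≠ 0 := by
    intro t h
    have := congrArg Complex.re h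
    norm_num at this
  have hinv : ∀ t : ℝ, HasDerivAt (fun t : ℝ => (-1 / 2 + Complex.I * t : ℂ)) Complex.I t := by
    intro t
    have : HasDerivAt (fun z : ℂ => (-1 / 2 + Complex.I * z : ℂ)) (Complex.I * 1) (t : ℂ) :=
      ((hasDerivAt_id _).const_mul _).const_add _
    simpa using this.comp_ofReal
  have hb := fun t => (hasDerivAt_bump T t).ofReal_comp
  have hb' := fun t => (hasDerivAt_bumpDeriv T t).ofReal_comp
  set S : ℝ → ℂ := fun t => -1 / 2 + Complex.I * t with hS
  have hc1 : Continuous fun t => ((bumpDerivTwo T t : ℝ) : ℂ) := by unfold bumpDerivTwo; fun_prop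
  have hc2 : Continuous fun t => ((bumpDeriv T t : ℝ) : ℂ) := by unfold bumpDeriv; fun_prop
  have hc3 : Continuous fun t => ((bump T t : ℝ) : ℂ) := by unfold bump; fun_prop
  have hSc : Continuous S := by rw [hS]; fun_prop
  have hg : ∀ t : ℝ, HasDerivAt (fun t => (bump T t : ℂ) / S t)
      ((bumpDeriv T t : ℂ) / S t - Complex.I * (bump T t : ℂ) / S t ^ 2) t := by
    intro t
    refine ((hb t).div (hinv t) (hz t)).congr_deriv ?_
    have : S t ≠ 0 := hz t
    field_simp
  have hg' : ∀ t : ℝ, HasDerivAt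
      (fun t => (bumpDeriv T t : ℂ) / S t - Complex.I * (bump T t : ℂ) / S t ^ 2)
      ((bumpDerivTwo T t : ℂ) / S t - 2 * Complex.I * (bumpDeriv T t : ℂ) / S t ^ 2 -
        2 * (bump T t : ℂ) / S t ^ 3) t := by
    intro t
    refine (((hb' t).div (hinv t) (hz t)).sub
      (((hb t).const_mul Complex.I).div ((hinv t).pow 2) (pow_ne_zero 2 (hz t)))).congr_deriv ?_
    have : S t ≠ 0 := hz t
    simp only [Pi.pow_apply]
    field_simp
    ring_nf
    simp only [Complex.I_sq]
    ring
  have hcc : Continuous fun t => (bumpDerivTwo T t : ℂ) / S t -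
      2 * Complex.I * (bumpDeriv T t : ℂ) / S t ^ 2 - 2 * (bump T t : ℂ) / S t ^ 3 :=
    ((hc1.div hSc hz).sub ((hc2.const_mul _).div (hSc.pow 2) fun t => pow_ne_zero 2 (hz t))).sub
      ((hc3.const_mul _).div (hSc.pow 3) fun t => pow_ne_zero 3 (hz t))
  refine (norm_integral_mul_exp_le (M := 50 / T ^ 3) (by linarith) hl hg hg' hcc
    (by simp [bump_left]) (by simp [bump_right]) (by simp [bump_left, bumpDeriv_left])
    (by simp [bump_right, bumpDeriv_right]) ?_).trans (le_of_eq ?_)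
  · intro t ht
    have hSn : T ≤ ‖S t‖ := by
      have := Complex.abs_im_le_norm (S t)
      simp only [hS] at this ⊢
      refine le_trans ?_ this
      simp only [Complex.add_im, Complex.mul_im, Complex.I_re, Complex.I_im, Complex.ofReal_im,
        Complex.ofReal_re]
      norm_num
      exact ht.1.trans (le_abs_self t)
    have e1 : ‖(bumpDerivTwo T t : ℂ) / S t‖ ≤ 32 / T ^ 2 / T := by
      rw [norm_div, Complex.norm_real]
      gcongr
      exact abs_bumpDerivTwo_le hT ht
    have e2 : ‖2 * Complex.I * (bumpDeriv T t : ℂ) / S t ^ 2‖ ≤ 2 * (8 / T) / T ^ 2 := by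
      rw [norm_div, norm_mul, norm_mul, Complex.norm_real, norm_pow, Complex.norm_I]
      norm_num
      gcongr
      exact abs_bumpDeriv_le hT ht
    have e3 : ‖2 * (bump T t : ℂ) / S t ^ 3‖ ≤ 2 * 1 / T ^ 3 := by
      rw [norm_div, norm_mul, Complex.norm_real, norm_pow]
      norm_num
      rw [abs_of_nonneg (bump_nonneg T t)]
      gcongr
      have := bump_le_one hT ht
      linarith
    refine (norm_sub_le _ _).trans ((add_le_add (norm_sub_le _ _) le_rfl).trans
      ((add_le_add (add_le_add e1 e2) e3).trans (le_of_eq ?_)))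
    field_simp
    ring
  · field_simp
    ring

/-- The Dirichlet polynomial with coefficients `β` supported on `B`, on the critical line. -/
noncomputable def dirPoly (B : Finset ℕ) (β : ℕ → ℝ) (t : ℝ) : ℂ :=
  ∑ n ∈ B, (β n : ℂ) * (n : ℂ) ^ (-(1 / 2 + Complex.I * t))

lemma natCast_cpow_critical {m : ℕ} (hm : 1 ≤ m) (t : ℝ) :
    (m : ℂ) ^ (-(1 / 2 + Complex.I * t)) =
      ((√m)⁻¹ : ℝ) * Complex.exp (Complex.I * ((-Real.log m : ℝ) * t)) := by
  have hm0 : (0 : ℝ) < m := by exact_mod_cast hm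
  have hmc : (m : ℂ) ≠ 0 := by exact_mod_cast hm0.ne'
  rw [Complex.cpow_def_of_ne_zero hmc, show (√m)⁻¹ = Real.exp (-(1 / 2) * Real.log m) by
    rw [Real.sqrt_eq_rpow, Real.rpow_def_of_pos hm0, ← Real.exp_neg]; ring_nf]
  rw [Complex.ofReal_exp, ← Complex.exp_add, ← Complex.natCast_log]
  congr 1
  push_cast
  ring

lemma norm_natCast_cpow_critical {m : ℕ} (hm : 1 ≤ m) (t : ℝ) :
    ‖(m : ℂ) ^ (-(1 / 2 + Complex.I * t))‖ = (√m)⁻¹ := by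
  rw [natCast_cpow_critical hm, norm_mul, Complex.norm_real, Real.norm_of_nonneg (by positivity),
    mul_comm Complex.I, ← Complex.ofReal_mul, Complex.norm_exp_ofReal_mul_I, mul_one]

lemma continuous_natCast_cpow_critical {m : ℕ} (hm : 1 ≤ m) :
    Continuous fun t : ℝ => (m : ℂ) ^ (-(1 / 2 + Complex.I * t)) := by
  simp_rw [natCast_cpow_critical hm]
  fun_prop

lemma continuous_dirPoly {B : Finset ℕ} {β : ℕ → ℝ} (hB : ∀ n ∈ B, 1 ≤ n) :
    Continuous (dirPoly B β) := by
  unfold dirPoly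
  exact continuous_finsetSum _ fun n hn =>
    continuous_const.mul (continuous_natCast_cpow_critical (hB n hn))

lemma norm_dirPoly_le {B : Finset ℕ} {β : ℕ → ℝ} {Y : ℝ} (hB : ∀ n ∈ B, 1 ≤ n)
    (hβ : ∀ n, |β n| ≤ 1) (hY : (B.card : ℝ) ≤ Y) (t : ℝ) : ‖dirPoly B β t‖ ≤ Y := by
  refine (norm_sum_le _ _).trans (le_trans ?_ hY)
  rw [Finset.card_eq_sum_ones, Nat.cast_sum]
  refine Finset.sum_le_sum fun n hn => ?_
  have h1 : (1 : ℝ) ≤ √n := Real.one_le_sqrt.2 (by exact_mod_cast hB n hn)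
  rw [norm_mul, Complex.norm_real, norm_natCast_cpow_critical (hB n hn)]
  push_cast
  exact mul_le_one₀ (hβ n) (by positivity) (inv_le_one_of_one_le₀ h1)

lemma sum_inv_sqrt_le (N : ℕ) : ∑ n ∈ Finset.Icc 1 N, (√(n : ℝ))⁻¹ ≤ 2 * √N := by
  induction N with
  | zero => simp
  | succ N ih =>
    rw [Finset.sum_Icc_succ_top (by omega)]
    have h1 : (√((N + 1 : ℕ) : ℝ)) ^ 2 = N + 1 := by
      rw [Real.sq_sqrt (by positivity)]; push_cast; ring
    have h2 : (√(N : ℝ)) ^ 2 = N := Real.sq_sqrt (by positivity)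
    have h3 : 0 < √((N + 1 : ℕ) : ℝ) := Real.sqrt_pos.2 (by positivity)
    set x := √((N + 1 : ℕ) : ℝ)
    set y := √(N : ℝ)
    have : x⁻¹ ≤ 2 * x - 2 * y := by
      rw [inv_le_iff_one_le_mul₀ h3]
      nlinarith [sq_nonneg (x - y)]
    linarith

lemma log_sq_ge {m : ℕ} (hm : 2 ≤ m) : (1 / 4 : ℝ) ≤ (-Real.log m) ^ 2 := by
  have h : Real.log 2 ≤ Real.log m := Real.log_le_log (by norm_num) (by exact_mod_cast hm)
  nlinarith [Real.log_two_gt_d9]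

lemma norm_integral_bump_cpow_le {T : ℝ} (hT : 0 < T) {m : ℕ} (hm : 2 ≤ m) :
    ‖∫ t in T..(2 * T), (bump T t : ℂ) * (m : ℂ) ^ (-(1 / 2 + Complex.I * t))‖ ≤
      (√m)⁻¹ * (128 / T) := by
  have hl := log_sq_ge hm
  have hl0 : -Real.log m ≠ 0 := fun h => by rw [h] at hl; norm_num at hl
  simp_rw [natCast_cpow_critical (show 1 ≤ m by omega), mul_left_comm _ (((√m)⁻¹ : ℝ) : ℂ)]
  rw [intervalIntegral.integral_const_mul, norm_mul, Complex.norm_real,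
    Real.norm_of_nonneg (by positivity)]
  gcongr
  refine (norm_integral_bump_mul_exp_le hT hl0).trans ?_
  rw [div_le_div_iff₀ (by positivity) hT]
  nlinarith

lemma norm_integral_bump_div_cpow_le {T : ℝ} (hT : 0 < T) {m : ℕ} (hm : 2 ≤ m) :
    ‖∫ t in T..(2 * T), (bump T t : ℂ) / (-1 / 2 + Complex.I * t) *
      (m : ℂ) ^ (-(1 / 2 + Complex.I * t))‖ ≤ (√m)⁻¹ * (200 / T ^ 2) := by
  have hl := log_sq_ge hm
  have hl0 : -Real.log m ≠ 0 := fun h => by rw [h] at hl; norm_num at hl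
  simp_rw [natCast_cpow_critical (show 1 ≤ m by omega), mul_left_comm _ (((√m)⁻¹ : ℝ) : ℂ)]
  rw [intervalIntegral.integral_const_mul, norm_mul, Complex.norm_real,
    Real.norm_of_nonneg (by positivity)]
  gcongr
  refine (norm_integral_bump_div_mul_exp_le hT hl0).trans ?_
  rw [div_le_div_iff₀ (by positivity) (by positivity)]
  have := sq_nonneg T
  nlinarith [mul_le_mul_of_nonneg_left hl this]

lemma norm_sum_sub_le {ι E : Type*} [NormedAddCommGroup E] {X : Finset ι}
    {f : ι → E} {g : ι → ℝ} {x₀ : ι} (hx : x₀ ∈ X) (h0 : 0 ≤ g x₀)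
    (h : ∀ x ∈ X, x ≠ x₀ → ‖f x‖ ≤ g x) : ‖∑ x ∈ X, f x - f x₀‖ ≤ ∑ x ∈ X, g x := by
  classical
  rw [← Finset.add_sum_erase X f hx, ← Finset.add_sum_erase X g hx, add_sub_cancel_left]
  refine (norm_sum_le _ _).trans ?_
  have := Finset.sum_le_sum fun x (hx : x ∈ X.erase x₀) =>
    h x (Finset.mem_of_mem_erase hx) (Finset.ne_of_mem_erase hx)
  linarith

lemma natCast_cpow_mul (a b : ℕ) (s : ℂ) : ((a * b : ℕ) : ℂ) ^ s = (a : ℂ) ^ s * (b : ℂ) ^ s := by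
  rw [Nat.cast_mul, Complex.natCast_mul_natCast_cpow]

lemma dirPoly_sq (B : Finset ℕ) (β : ℕ → ℝ) (t : ℝ) :
    dirPoly B β t ^ 2 = ∑ p ∈ B ×ˢ B, ((β p.1 * β p.2 : ℝ) : ℂ) *
      ((p.1 * p.2 : ℕ) : ℂ) ^ (-(1 / 2 + Complex.I * t)) := by
  rw [sq, dirPoly, Finset.sum_mul_sum, ← Finset.sum_product']
  refine Finset.sum_congr rfl fun p _ => ?_
  rw [natCast_cpow_mul]
  push_cast
  ring

lemma first_moment_main {B : Finset ℕ} {β : ℕ → ℝ} {Y T : ℝ} (hB : ∀ n ∈ B, 1 ≤ n)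
    (hβ : ∀ n, |β n| ≤ 1) (hY : (B.card : ℝ) ≤ Y) (h1 : 1 ∈ B) (hβ1 : β 1 = 1) (hT : 0 < T)
    {N : ℕ} (hN : 1 ≤ N) :
    ‖(∫ t in T..(2 * T), (bump T t : ℂ) * ((∑ n ∈ Finset.Icc 1 N,
      (n : ℂ) ^ (-(1 / 2 + Complex.I * t))) * dirPoly B β t ^ 2)) -
        ∫ t in T..(2 * T), (bump T t : ℂ)‖ ≤ Y ^ 2 * (256 * √N / T) := by
  set X := (B ×ˢ B) ×ˢ Finset.Icc 1 N with hX
  set f : (ℕ × ℕ) × ℕ → ℂ := fun x => ((β x.1.1 * β x.1.2 : ℝ) : ℂ) *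
    ∫ t in T..(2 * T), (bump T t : ℂ) *
      ((x.2 * (x.1.1 * x.1.2) : ℕ) : ℂ) ^ (-(1 / 2 + Complex.I * t)) with hf
  have hpos : ∀ x ∈ X, 1 ≤ x.1.1 ∧ 1 ≤ x.1.2 ∧ 1 ≤ x.2 := by
    intro x hx
    simp only [hX, Finset.mem_product, Finset.mem_Icc] at hx
    exact ⟨hB _ hx.1.1, hB _ hx.1.2, hx.2.1⟩
  have hpos' : ∀ x ∈ X, 1 ≤ x.2 * (x.1.1 * x.1.2) := fun x hx => by
    obtain ⟨h1, h2, h3⟩ := hpos x hx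
    exact Nat.one_le_iff_ne_zero.2 (by positivity)
  have hbc : Continuous fun t => (bump T t : ℂ) :=
    Complex.continuous_ofReal.comp (continuous_bump T)
  have e1 : (∫ t in T..(2 * T), (bump T t : ℂ) * ((∑ n ∈ Finset.Icc 1 N,
      (n : ℂ) ^ (-(1 / 2 + Complex.I * t))) * dirPoly B β t ^ 2)) = ∑ x ∈ X, f x := by
    simp only [hf, ← intervalIntegral.integral_const_mul]
    rw [← intervalIntegral.integral_finsetSum]
    · congr 1
      ext t
      rw [dirPoly_sq, mul_comm (∑ n ∈ Finset.Icc 1 N, _), Finset.sum_mul_sum,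
        ← Finset.sum_product', Finset.mul_sum]
      refine Finset.sum_congr rfl fun x _ => ?_
      rw [natCast_cpow_mul x.2]
      ring
    · intro x hx
      exact (continuous_const.mul (hbc.mul
        (continuous_natCast_cpow_critical (hpos' x hx)))).intervalIntegrable _ _
  have e2 : ∫ t in T..(2 * T), (bump T t : ℂ) = f ((1, 1), 1) := by
    simp [hf, hβ1]
  rw [e1, e2]
  refine (norm_sum_sub_le (g := fun x => (√x.2)⁻¹ * (128 / T)) ?_ (by positivity) ?_).trans ?_
  · simp [hX, h1, hN]
  · intro x hx hne
    obtain ⟨p1, p2, p3⟩ := hpos x hx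
    have hge : x.2 ≤ x.2 * (x.1.1 * x.1.2) :=
      Nat.le_mul_of_pos_right _ (by positivity)
    have h2 : 2 ≤ x.2 * (x.1.1 * x.1.2) := by
      rcases (hpos' x hx).lt_or_eq with h | h
      · exact h
      · exfalso
        apply hne
        have := h.symm
        simp only [mul_eq_one] at this
        ext <;> simp [this]
    have hx0 : (0 : ℝ) < x.2 := by exact_mod_cast p3
    rw [hf, norm_mul, Complex.norm_real, Real.norm_eq_abs, abs_mul]
    refine (mul_le_of_le_one_left (norm_nonneg _)
      (mul_le_one₀ (hβ _) (abs_nonneg _) (hβ _))).trans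
      ((norm_integral_bump_cpow_le hT h2).trans ?_)
    have : (x.2 : ℝ) ≤ ((x.2 * (x.1.1 * x.1.2) : ℕ) : ℝ) := by exact_mod_cast hge
    gcongr
  · rw [hX, Finset.sum_product]
    simp only [Finset.sum_const, ← Finset.sum_mul, Finset.card_product, nsmul_eq_mul]
    push_cast
    have := sum_inv_sqrt_le N
    calc (B.card * B.card : ℝ) * ((∑ n ∈ Finset.Icc 1 N, (√(n : ℝ))⁻¹) * (128 / T))
        ≤ (Y * Y) * ((2 * √N) * (128 / T)) := by
          have hY0 : 0 ≤ Y := (Nat.cast_nonneg _).trans hY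
          gcongr
      _ = Y ^ 2 * (256 * √N / T) := by ring

lemma first_moment_tail {B : Finset ℕ} {β : ℕ → ℝ} {Y T : ℝ} (hB : ∀ n ∈ B, 1 ≤ n)
    (hβ : ∀ n, |β n| ≤ 1) (hY : (B.card : ℝ) ≤ Y) (hT : 0 < T) {N : ℕ} (hN : 2 ≤ N) :
    ‖∫ t in T..(2 * T), (bump T t : ℂ) * ((N : ℂ) ^ (1 - (1 / 2 + Complex.I * t)) /
      ((1 / 2 + Complex.I * t) - 1) * dirPoly B β t ^ 2)‖ ≤ Y ^ 2 * (200 * √N / T ^ 2) := by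
  have hbc : Continuous fun t => (bump T t : ℂ) :=
    Complex.continuous_ofReal.comp (continuous_bump T)
  have hz : ∀ t : ℝ, (-1 / 2 + Complex.I * t : ℂ) ≠ 0 := by
    intro t h
    have := congrArg Complex.re h
    norm_num at this
  have hN0 : (0 : ℝ) < N := by exact_mod_cast (by omega : 0 < N)
  have hNc : (N : ℂ) ≠ 0 := by exact_mod_cast hN0.ne'
  have hpos : ∀ p ∈ B ×ˢ B, 1 ≤ p.1 * p.2 := fun p hp => by
    rw [Finset.mem_product] at hp
    exact Nat.one_le_iff_ne_zero.2
      (mul_ne_zero (by have := hB _ hp.1; omega) (by have := hB _ hp.2; omega))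
  have hpos' : ∀ p ∈ B ×ˢ B, N ≤ N * (p.1 * p.2) := fun p hp =>
    Nat.le_mul_of_pos_right _ (hpos p hp)
  have e1 : (∫ t in T..(2 * T), (bump T t : ℂ) * ((N : ℂ) ^ (1 - (1 / 2 + Complex.I * t)) /
      ((1 / 2 + Complex.I * t) - 1) * dirPoly B β t ^ 2)) =
      ∑ p ∈ B ×ˢ B, ((β p.1 * β p.2 : ℝ) : ℂ) * ((N : ℂ) *
        ∫ t in T..(2 * T), (bump T t : ℂ) / (-1 / 2 + Complex.I * t) *
          ((N * (p.1 * p.2) : ℕ) : ℂ) ^ (-(1 / 2 + Complex.I * t))) := by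
    simp only [← intervalIntegral.integral_const_mul]
    rw [← intervalIntegral.integral_finsetSum]
    · congr 1
      ext t
      rw [dirPoly_sq, Finset.mul_sum, Finset.mul_sum]
      refine Finset.sum_congr rfl fun p _ => ?_
      rw [natCast_cpow_mul N, sub_eq_add_neg, Complex.cpow_add _ _ hNc, Complex.cpow_one,
        show (1 / 2 + Complex.I * t - 1 : ℂ) = -1 / 2 + Complex.I * t by ring]
      ring
    · intro p hp
      exact (continuous_const.mul (continuous_const.mul ((hbc.div (by fun_prop) hz).mul
        (continuous_natCast_cpow_critical (by have := hpos' p hp; omega))))).intervalIntegrable _ _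
  rw [e1]
  refine (norm_sum_le_of_le (n := fun _ => 200 * √N / T ^ 2) _ fun p hp => ?_).trans ?_
  · have h2 : 2 ≤ N * (p.1 * p.2) := hN.trans (hpos' p hp)
    have hle : (N : ℝ) ≤ ((N * (p.1 * p.2) : ℕ) : ℝ) := by exact_mod_cast hpos' p hp
    rw [norm_mul, Complex.norm_real, Real.norm_eq_abs, abs_mul]
    refine (mul_le_of_le_one_left (norm_nonneg _)
      (mul_le_one₀ (hβ _) (abs_nonneg _) (hβ _))).trans ?_
    rw [norm_mul, Complex.norm_natCast]
    calc (N : ℝ) * _ ≤ N * ((√N)⁻¹ * (200 / T ^ 2)) := by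
          refine mul_le_mul_of_nonneg_left ((norm_integral_bump_div_cpow_le hT h2).trans ?_) hN0.le
          gcongr
      _ = 200 * √N / T ^ 2 := by
          have h3 : √(N : ℝ) * √N = N := Real.mul_self_sqrt hN0.le
          have h4 : √(N : ℝ) ≠ 0 := (Real.sqrt_pos.2 hN0).ne'
          field_simp
          linarith
  · rw [Finset.sum_const, Finset.card_product, nsmul_eq_mul]
    push_cast
    rw [sq Y]
    gcongr
    exact (Nat.cast_nonneg _).trans hY

lemma continuous_zeta_critical : Continuous fun t : ℝ => riemannZeta (1 / 2 + Complex.I * t) := by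
  refine continuous_iff_continuousAt.2 fun t => ?_
  have h : (1 / 2 + Complex.I * t : ℂ) ≠ 1 := by
    intro h
    have := congrArg Complex.re h
    norm_num at this
  exact ContinuousAt.comp (f := fun t : ℝ => (1 / 2 + Complex.I * t : ℂ))
    (differentiableAt_riemannZeta h).continuousAt (by fun_prop)

lemma first_moment {B : Finset ℕ} {β : ℕ → ℝ} {Y T : ℝ} (hB : ∀ n ∈ B, 1 ≤ n)
    (hβ : ∀ n, |β n| ≤ 1) (hY : (B.card : ℝ) ≤ Y) (h1 : 1 ∈ B) (hβ1 : β 1 = 1) (hT : 2 ≤ T) :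
    ‖(∫ t in T..(2 * T), (bump T t : ℂ) * (riemannZeta (1 / 2 + Complex.I * t) *
      dirPoly B β t ^ 2)) - ∫ t in T..(2 * T), (bump T t : ℂ)‖ ≤ 1000 * Y ^ 2 * √T := by
  have hT0 : 0 < T := by linarith
  set N := ⌈T ^ 3⌉₊ with hN
  have hNl : T ^ 3 ≤ N := Nat.le_ceil _
  have hNu : (N : ℝ) ≤ 2 * T ^ 3 := by
    have := (Nat.ceil_lt_add_one (by positivity : 0 ≤ T ^ 3)).le
    nlinarith [pow_le_pow_left₀ (by norm_num) hT 3]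
  have hN2 : 2 ≤ N := by
    have : (2 : ℝ) ≤ N := by nlinarith [pow_le_pow_left₀ (by norm_num) hT 3]
    exact_mod_cast this
  have hN0 : (0 : ℝ) < N := by exact_mod_cast (by omega : 0 < N)
  have hNc : (N : ℂ) ≠ 0 := by exact_mod_cast hN0.ne'
  have hz : ∀ t : ℝ, (1 / 2 + Complex.I * t - 1 : ℂ) ≠ 0 := by
    intro t h
    have := congrArg Complex.re h
    norm_num at this
  have hbc : Continuous fun t => (bump T t : ℂ) :=
    Complex.continuous_ofReal.comp (continuous_bump T)
  have hφ := continuous_dirPoly (β := β) hB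
  set P : ℝ → ℂ := fun t => ∑ n ∈ Finset.Icc 1 N, (n : ℂ) ^ (-(1 / 2 + Complex.I * t))
  set Q : ℝ → ℂ := fun t => (N : ℂ) ^ (1 - (1 / 2 + Complex.I * t)) / (1 / 2 + Complex.I * t - 1)
  set E : ℝ → ℂ := fun t => riemannZeta (1 / 2 + Complex.I * t) - (P t + Q t)
  have hPc : Continuous P := continuous_finsetSum _ fun n hn =>
    continuous_natCast_cpow_critical (Finset.mem_Icc.1 hn).1
  have hQc : Continuous Q := by
    refine Continuous.div ?_ (by fun_prop) hz
    have : ∀ t : ℝ, (N : ℂ) ^ (1 - (1 / 2 + Complex.I * t)) =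
        N * (N : ℂ) ^ (-(1 / 2 + Complex.I * t)) := fun t => by
      rw [sub_eq_add_neg, Complex.cpow_add _ _ hNc, Complex.cpow_one]
    simp_rw [this]
    exact continuous_const.mul (continuous_natCast_cpow_critical (by omega))
  have hEc : Continuous E := continuous_zeta_critical.sub (hPc.add hQc)
  have hI : ∀ {f : ℝ → ℂ}, Continuous f →
      IntervalIntegrable (fun t => (bump T t : ℂ) * (f t * dirPoly B β t ^ 2)) volume T (2 * T) :=
    fun hf => (hbc.mul (hf.mul (hφ.pow 2))).intervalIntegrable _ _
  have hsplit : ∫ t in T..(2 * T), (bump T t : ℂ) * (riemannZeta (1 / 2 + Complex.I * t) *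
      dirPoly B β t ^ 2) = (∫ t in T..(2 * T), (bump T t : ℂ) * (P t * dirPoly B β t ^ 2)) +
      (∫ t in T..(2 * T), (bump T t : ℂ) * (Q t * dirPoly B β t ^ 2)) +
      ∫ t in T..(2 * T), (bump T t : ℂ) * (E t * dirPoly B β t ^ 2) := by
    rw [← intervalIntegral.integral_add (hI hPc) (hI hQc),
      ← intervalIntegral.integral_add ((hI hPc).add (hI hQc)) (hI hEc)]
    congr 1
    ext t
    simp only [E]
    ring
  have hsT : √T * √T = T := Real.mul_self_sqrt hT0.le
  have hsT1 : 1 ≤ √T := Real.one_le_sqrt.2 (by linarith)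
  have hsN : √(N : ℝ) ≤ 2 * (T * √T) := by
    rw [Real.sqrt_le_left (by positivity)]
    nlinarith [pow_pos hT0 3]
  have hsN' : T * √T ≤ √(N : ℝ) := by
    apply Real.le_sqrt_of_sq_le
    nlinarith
  have hE : ‖∫ t in T..(2 * T), (bump T t : ℂ) * (E t * dirPoly B β t ^ 2)‖ ≤
      (6 / √T * Y ^ 2) * |2 * T - T| := by
    apply intervalIntegral.norm_integral_le_of_norm_le_const
    intro t ht
    rw [Set.uIoc_of_le (by linarith)] at ht
    have hb := bump_le_one hT0 ⟨ht.1.le, ht.2⟩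
    have hEt : ‖E t‖ ≤ 6 / √T := by
      have hre : (1 / 2 + Complex.I * t : ℂ).re = 1 / 2 := by norm_num
      have hb := norm_zeta_sub_partial_le (s := 1 / 2 + Complex.I * t) (by rw [hre]; norm_num)
        (sub_ne_zero.1 (hz t)) (show 1 ≤ N by omega)
      refine hb.trans ?_
      rw [hre, Real.rpow_neg hN0.le, ← Real.sqrt_eq_rpow]
      have hs : ‖(1 / 2 + Complex.I * t : ℂ)‖ ≤ 3 * T := by
        refine (norm_add_le _ _).trans ?_
        rw [norm_mul, Complex.norm_I, Complex.norm_real, Real.norm_of_nonneg (by linarith [ht.1])]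
        norm_num
        linarith [ht.2]
      calc _ ≤ 3 * T / (1 / 2) * (T * √T)⁻¹ := by gcongr
        _ = 6 / √T := by field_simp; norm_num
    rw [norm_mul, norm_mul, norm_pow, Complex.norm_real, Real.norm_of_nonneg (bump_nonneg _ _)]
    have := norm_dirPoly_le hB hβ hY t
    calc _ ≤ 1 * (6 / √T * Y ^ 2) := by gcongr
      _ = _ := one_mul _
  have hM := first_moment_main hB hβ hY h1 hβ1 hT0 (show 1 ≤ N by omega)
  have hQ := first_moment_tail hB hβ hY hT0 hN2
  rw [hsplit]
  have hM' : Y ^ 2 * (256 * √N / T) ≤ Y ^ 2 * (512 * √T) := by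
    gcongr
    rw [div_le_iff₀ hT0]; nlinarith
  have hQ' : Y ^ 2 * (200 * √N / T ^ 2) ≤ Y ^ 2 * (400 * √T) := by
    gcongr
    rw [div_le_iff₀ (by positivity)]
    have : T * √T ≤ T ^ 2 * √T := by
      apply mul_le_mul_of_nonneg_right _ (Real.sqrt_nonneg _); nlinarith
    nlinarith
  have hE' : (6 / √T * Y ^ 2) * |2 * T - T| = Y ^ 2 * (6 * √T) := by
    rw [abs_of_nonneg (by linarith), show 2 * T - T = √T * √T by linarith]
    field_simp
  rw [hE'] at hE
  have : ∀ a b c d : ℂ, ‖a + b + c - d‖ ≤ ‖a - d‖ + ‖b‖ + ‖c‖ := fun a b c d => by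
    rw [show a + b + c - d = (a - d) + b + c by ring]
    exact norm_add₃_le
  have hYT : 0 ≤ Y ^ 2 * √T := by positivity
  refine (this _ _ _ _).trans ?_
  linarith

/-- The theta function along the ray of argument `π / 2 + α`. -/
noncomputable def rotTheta (α x : ℝ) : ℂ := jacobiTheta (Complex.I * (x * Complex.exp (Complex.I * α)))

lemma rotTheta_arg_im (α x : ℝ) :
    (Complex.I * (x * Complex.exp (Complex.I * α))).im = x * Real.cos α := by
  rw [mul_comm Complex.I (α : ℂ), Complex.exp_mul_I]
  simp [Complex.cos_ofReal_re]

lemma log_exp_I_mul {α : ℝ} (h : |α| < Real.pi / 2) :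
    Complex.log (Complex.exp (Complex.I * α)) = Complex.I * α := by
  rw [abs_lt] at h
  apply Complex.log_exp <;> simp <;> linarith [Real.pi_pos, h.1, h.2]

lemma cos_pos_of_abs_lt {α : ℝ} (h : |α| < Real.pi / 2) : 0 < Real.cos α :=
  Real.cos_pos_of_mem_Ioo (abs_lt.1 h)

lemma rotTheta_one_div {α : ℝ} (h : |α| < Real.pi / 2) {x : ℝ} (hx : 0 < x) :
    rotTheta α (1 / x) =
      (Complex.exp (-(Complex.I * α / 2)) * ((x ^ (1 / 2 : ℝ) : ℝ) : ℂ)) • rotTheta (-α) x := by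
  have him : 0 < (Complex.I * (x * Complex.exp (Complex.I * (-α : ℝ)))).im := by
    rw [rotTheta_arg_im, Real.cos_neg]
    exact mul_pos hx (cos_pos_of_abs_lt h)
  have key := jacobiTheta_S_smul ⟨_, him⟩
  have hα : |-α| < Real.pi / 2 := by rwa [abs_neg]
  have hxc : (x : ℂ) ≠ 0 := by exact_mod_cast hx.ne'
  rw [rotTheta, rotTheta, smul_eq_mul]
  convert key using 2
  · rw [UpperHalfPlane.modular_S_smul]
    simp only [one_div]
    push_cast
    rw [mul_neg, Complex.exp_neg]
    have := Complex.exp_ne_zero (Complex.I * α)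
    field_simp
    simp
  · simp only
    rw [show -Complex.I * (Complex.I * (x * Complex.exp (Complex.I * (-α : ℝ)))) =
      (x : ℂ) * Complex.exp (Complex.I * (-α : ℝ)) by
        linear_combination -(x * Complex.exp (Complex.I * (-α : ℝ))) * Complex.I_mul_I,
      Complex.cpow_def_of_ne_zero (mul_ne_zero hxc (Complex.exp_ne_zero _)),
      Complex.log_ofReal_mul hx (Complex.exp_ne_zero _), log_exp_I_mul hα,
      Real.rpow_def_of_pos hx, Complex.ofReal_exp, ← Complex.exp_add]
    congr 1
    push_cast
    ring

lemma rotTheta_neg {α x : ℝ} : rotTheta (-α) x = (starRingEnd ℂ) (rotTheta α x) := by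
  rw [rotTheta, rotTheta, jacobiTheta, jacobiTheta, Complex.conj_tsum]
  refine tsum_congr fun n => ?_
  rw [← Complex.exp_conj]
  congr 1
  simp only [map_mul, Complex.conj_ofReal, Complex.conj_I, map_pow, ← Complex.exp_conj]
  push_cast
  simp only [map_intCast, mul_neg, neg_mul]
  ring

lemma continuousOn_rotTheta {α : ℝ} (h : |α| < Real.pi / 2) :
    ContinuousOn (rotTheta α) (Set.Ioi 0) := by
  intro x hx
  refine ContinuousAt.continuousWithinAt ?_
  refine ContinuousAt.comp (f := fun x : ℝ => Complex.I * (x * Complex.exp (Complex.I * α)))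
    (g := jacobiTheta) (continuousAt_jacobiTheta ?_) (by fun_prop)
  rw [rotTheta_arg_im]
  exact mul_pos hx (cos_pos_of_abs_lt h)

open Asymptotics Filter in
lemma isBigO_rotTheta_sub_one {α : ℝ} (h : |α| < Real.pi / 2) (r : ℝ) :
    (fun x => rotTheta α x - 1) =O[atTop] fun x : ℝ => x ^ r := by
  have hc := cos_pos_of_abs_lt h
  have h1 : (fun x : ℝ => rotTheta α x - 1) =O[atTop]
      fun x : ℝ => Real.exp (-Real.pi * (x * Real.cos α)) := by
    have ht : Tendsto (fun x : ℝ => Complex.I * (x * Complex.exp (Complex.I * α))) atTop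
        (comap Complex.im atTop) := by
      rw [tendsto_comap_iff]
      have : (Complex.im ∘ fun x : ℝ => Complex.I * (x * Complex.exp (Complex.I * α))) =
          fun x => x * Real.cos α := by ext x; exact rotTheta_arg_im α x
      rw [this]
      exact tendsto_id.atTop_mul_const hc
    refine (isBigO_at_im_infty_jacobiTheta_sub_one.comp_tendsto ht).trans (isBigO_of_le _ ?_)
    intro x
    simp only [Function.comp, rotTheta_arg_im, le_refl]
  refine h1.trans ?_
  have := (isLittleO_exp_neg_mul_rpow_atTop (a := Real.pi * Real.cos α) (by positivity) r).isBigO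
  refine this.congr_left fun x => ?_
  congr 1; ring

/-- The functional equation pair given by the theta function on a rotated ray. -/
noncomputable def rotThetaPair (α : ℝ) (h : |α| < Real.pi / 2) : WeakFEPair ℂ where
  f := rotTheta α
  g := rotTheta (-α)
  k := 1 / 2
  ε := Complex.exp (-(Complex.I * α / 2))
  f₀ := 1
  g₀ := 1
  hf_int := (continuousOn_rotTheta h).locallyIntegrableOn measurableSet_Ioi
  hg_int := (continuousOn_rotTheta (by rwa [abs_neg])).locallyIntegrableOn measurableSet_Ioi
  hk := by norm_num
  hε := Complex.exp_ne_zero _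
  h_feq := fun x hx => rotTheta_one_div h hx
  hf_top := isBigO_rotTheta_sub_one h
  hg_top := isBigO_rotTheta_sub_one (by rwa [abs_neg])

lemma hasSum_rotTheta {α x : ℝ} (h : |α| < Real.pi / 2) (hx : 0 < x) :
    HasSum (fun n : ℕ => 2 * Complex.exp (-(((Real.pi * ((n : ℝ) + 1) ^ 2 : ℝ) : ℂ) *
      Complex.exp (Complex.I * α) * x))) (rotTheta α x - 1) := by
  have him : 0 < (Complex.I * (x * Complex.exp (Complex.I * α))).im := by
    rw [rotTheta_arg_im]
    exact mul_pos hx (cos_pos_of_abs_lt h)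
  have := (hasSum_nat_jacobiTheta him).mul_left 2
  rw [mul_div_cancel₀ _ (two_ne_zero' ℂ)] at this
  refine this.congr_fun fun n => ?_
  congr 2
  push_cast
  linear_combination -(Real.pi * ((n : ℂ) + 1) ^ 2 * Complex.exp (Complex.I * α) * x) *
    Complex.I_mul_I

lemma exp_I_mul_ofReal_re (α : ℝ) : (Complex.exp (Complex.I * α)).re = Real.cos α := by
  rw [mul_comm, Complex.exp_ofReal_mul_I_re]

lemma norm_cpow_mul_exp {t : ℝ} (ht : 0 < t) (s r : ℂ) :
    ‖(t : ℂ) ^ (s - 1) * Complex.exp (-(r * t))‖ = t ^ (s.re - 1) * Real.exp (-(r.re * t)) := by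
  rw [norm_mul, Complex.norm_cpow_eq_rpow_re_of_pos ht, Complex.norm_exp]
  congr 2
  rw [Complex.neg_re, Complex.re_mul_ofReal]

lemma aestronglyMeasurable_cpow_mul_exp (s r : ℂ) : AEStronglyMeasurable (fun t : ℝ =>
    (t : ℂ) ^ (s - 1) * Complex.exp (-(r * t))) (volume.restrict (Set.Ioi 0)) := by
  refine ContinuousOn.aestronglyMeasurable ?_ measurableSet_Ioi
  refine ContinuousOn.mul (fun t ht => ?_) (by fun_prop)
  exact (Complex.continuousAt_ofReal_cpow_const _ _ (Or.inr (ne_of_gt ht))).continuousWithinAt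

lemma integrableOn_rpow_mul_exp_neg_mul {b c : ℝ} (hc : 0 < c) (hb : -1 < b) :
    IntegrableOn (fun t : ℝ => t ^ b * Real.exp (-(c * t))) (Set.Ioi 0) := by
  have := integrableOn_rpow_mul_exp_neg_mul_rpow (p := 1) (s := b) (b := c) hb one_pos hc
  simpa [IntegrableOn] using this

lemma integrableOn_cpow_mul_exp {s r : ℂ} (hr : 0 < r.re) (hs : 0 < s.re) :
    IntegrableOn (fun t : ℝ => (t : ℂ) ^ (s - 1) * Complex.exp (-(r * t))) (Set.Ioi 0) := by
  refine Integrable.mono' (integrableOn_rpow_mul_exp_neg_mul (b := s.re - 1) hr (by linarith))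
    (aestronglyMeasurable_cpow_mul_exp s r) ?_
  filter_upwards [ae_restrict_mem measurableSet_Ioi] with t ht
  exact (norm_cpow_mul_exp ht s r).le

lemma differentiableAt_integral_cpow_mul_exp {s r : ℂ} (hr : 0 < r.re) (hs : 0 < s.re) :
    DifferentiableAt ℂ (fun r : ℂ => ∫ t in Set.Ioi (0 : ℝ),
      (t : ℂ) ^ (s - 1) * Complex.exp (-(r * t))) r := by
  have hball : ∀ x ∈ Metric.ball r (r.re / 2), r.re / 2 < x.re := by
    intro x hx
    have h1 := (Complex.abs_re_le_norm (x - r)).trans_lt (mem_ball_iff_norm.1 hx)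
    rw [Complex.sub_re, abs_lt] at h1
    linarith [h1.1]
  refine (hasDerivAt_integral_of_dominated_loc_of_deriv_le
    (μ := volume.restrict (Set.Ioi (0 : ℝ)))
    (F := fun r (t : ℝ) => (t : ℂ) ^ (s - 1) * Complex.exp (-(r * t)))
    (bound := fun t : ℝ => t ^ s.re * Real.exp (-(r.re / 2 * t)))
    (F' := fun r (t : ℝ) => (t : ℂ) ^ (s - 1) * (Complex.exp (-(r * t)) * (-(t : ℂ))))
    (Metric.ball_mem_nhds r (half_pos hr)) ?_ (integrableOn_cpow_mul_exp hr hs) ?_ ?_ ?_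
    ?_).2.differentiableAt
  · exact Filter.Eventually.of_forall fun x => aestronglyMeasurable_cpow_mul_exp s x
  · have := (aestronglyMeasurable_cpow_mul_exp s r).mul
      (g := fun t : ℝ => -(t : ℂ)) (by fun_prop)
    refine this.congr (Filter.Eventually.of_forall fun t => ?_)
    simp only [Pi.mul_apply]
    ring
  · filter_upwards [ae_restrict_mem measurableSet_Ioi] with t ht x hx
    have ht : 0 < t := ht
    rw [← mul_assoc, norm_mul, norm_cpow_mul_exp ht, norm_neg, Complex.norm_real,
      Real.norm_of_nonneg ht.le]
    have : t ^ s.re = t ^ (s.re - 1) * t := by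
      rw [Real.rpow_sub ht, Real.rpow_one]; field_simp
    rw [this, mul_right_comm]
    have := hball x hx
    gcongr
  · exact integrableOn_rpow_mul_exp_neg_mul (half_pos hr) (by linarith)
  · refine Filter.Eventually.of_forall fun t x _ => ?_
    refine (HasDerivAt.cexp ?_).const_mul _
    exact ((hasDerivAt_mul_const (t : ℂ)).neg).congr_deriv rfl

/-- The Gamma integral along a ray of the right half plane. -/
lemma integral_cpow_mul_exp_neg_mul_of_re_pos {s r : ℂ} (hr : 0 < r.re) (hs : 0 < s.re) :
    ∫ t in Set.Ioi (0 : ℝ), (t : ℂ) ^ (s - 1) * Complex.exp (-(r * t)) =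
      (1 / r) ^ s * Complex.Gamma s := by
  have hopen : IsOpen {z : ℂ | 0 < z.re} := isOpen_lt continuous_const Complex.continuous_re
  have hconn : IsPreconnected {z : ℂ | 0 < z.re} := (convex_halfSpace_re_gt 0).isPreconnected
  have hf : AnalyticOnNhd ℂ (fun r : ℂ => ∫ t in Set.Ioi (0 : ℝ),
      (t : ℂ) ^ (s - 1) * Complex.exp (-(r * t))) {z : ℂ | 0 < z.re} :=
    DifferentiableOn.analyticOnNhd (fun z hz =>
      (differentiableAt_integral_cpow_mul_exp hz hs).differentiableWithinAt) hopen
  have hg : AnalyticOnNhd ℂ (fun r : ℂ => (1 / r) ^ s * Complex.Gamma s) {z : ℂ | 0 < z.re} := by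
    refine DifferentiableOn.analyticOnNhd (fun z hz => ?_) hopen
    have hz0 : z ≠ 0 := fun h => by rw [h] at hz; simp at hz
    have hz' : 0 < (1 / z).re := by
      rw [one_div, Complex.inv_re]
      exact div_pos hz (Complex.normSq_pos.2 hz0)
    refine DifferentiableAt.differentiableWithinAt ?_
    refine DifferentiableAt.mul_const ?_ _
    exact DifferentiableAt.cpow_const (by fun_prop (disch := assumption)) (Or.inl hz')
  refine hf.eqOn_of_preconnected_of_frequently_eq hg hconn (z₀ := 1) (by simp) ?_ hr
  have ht : Filter.Tendsto (fun n : ℕ => ((1 + 1 / ((n : ℝ) + 1) : ℝ) : ℂ)) Filter.atTop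
      (nhdsWithin 1 {1}ᶜ) := by
    refine tendsto_nhdsWithin_iff.2 ⟨?_, Filter.Eventually.of_forall fun n => ?_⟩
    · have := (tendsto_one_div_add_atTop_nhds_zero_nat (𝕜 := ℝ)).const_add 1
      rw [add_zero] at this
      have h2 := (Complex.continuous_ofReal.tendsto 1).comp this
      rw [Complex.ofReal_one] at h2
      exact h2
    · simp only [Set.mem_compl_iff, Set.mem_singleton_iff]
      have : (1 + 1 / ((n : ℝ) + 1) : ℝ) ≠ 1 := by
        have : (0 : ℝ) < 1 / ((n : ℝ) + 1) := by positivity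
        linarith
      exact_mod_cast this
  refine ht.frequently (Filter.Frequently.of_forall fun n => ?_)
  exact Complex.integral_cpow_mul_exp_neg_mul_Ioi hs (by positivity)

lemma rotThetaPair_Λ_of_half_lt {α : ℝ} (h : |α| < Real.pi / 2) {s : ℂ} (hs : 1 / 2 < s.re) :
    (rotThetaPair α h).Λ s =
      2 * Complex.exp (-(Complex.I * α * s)) * completedRiemannZeta (2 * s) := by
  have hc := cos_pos_of_abs_lt h
  have hs0 : 0 < s.re := by linarith
  have hk : (rotThetaPair α h).k < s.re := hs
  have hp : ∀ n : ℕ, 0 < Real.pi * ((n : ℝ) + 1) ^ 2 := fun n => by positivity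
  have hre' : ∀ n : ℕ, (((Real.pi * ((n : ℝ) + 1) ^ 2 : ℝ) : ℂ) *
      Complex.exp (Complex.I * α)).re = Real.pi * ((n : ℝ) + 1) ^ 2 * Real.cos α := fun n => by
    rw [Complex.re_ofReal_mul, exp_I_mul_ofReal_re]
  have hre : ∀ n : ℕ, 0 < (((Real.pi * ((n : ℝ) + 1) ^ 2 : ℝ) : ℂ) *
      Complex.exp (Complex.I * α)).re := fun n => by
    rw [hre']
    exact mul_pos (hp n) hc
  rw [← ((rotThetaPair α h).hasMellin hk).2, mellin]
  set F : ℕ → ℝ → ℂ := fun n t => 2 * ((t : ℂ) ^ (s - 1) * Complex.exp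
    (-(((Real.pi * ((n : ℝ) + 1) ^ 2 : ℝ) : ℂ) * Complex.exp (Complex.I * α) * t))) with hF
  have hintg : ∀ n, Integrable (F n) (volume.restrict (Set.Ioi 0)) := fun n =>
    (integrableOn_cpow_mul_exp (hre n) hs0).const_mul 2
  have hnorm : ∀ n, ∫ t in Set.Ioi (0 : ℝ), ‖F n t‖ =
      2 * ((1 / (Real.pi * Real.cos α)) ^ s.re * Real.Gamma s.re) *
        (1 / ((n + 1 : ℕ) : ℝ) ^ (2 * s.re)) := by
    intro n
    have : ∀ t ∈ Set.Ioi (0 : ℝ), ‖F n t‖ = 2 * (t ^ (s.re - 1) *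
        Real.exp (-((Real.pi * ((n : ℝ) + 1) ^ 2 * Real.cos α) * t))) := by
      intro t ht
      rw [hF, norm_mul, norm_cpow_mul_exp ht, hre']
      norm_num
    rw [setIntegral_congr_fun measurableSet_Ioi this, integral_const_mul,
      Real.integral_rpow_mul_exp_neg_mul_Ioi hs0 (mul_pos (hp n) hc),
      show 1 / (Real.pi * ((n : ℝ) + 1) ^ 2 * Real.cos α) =
        (1 / (Real.pi * Real.cos α)) * (1 / ((n + 1 : ℕ) : ℝ) ^ 2) by push_cast; field_simp,
      Real.mul_rpow (by positivity) (by positivity), Real.div_rpow (by norm_num) (by positivity),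
      Real.one_rpow, Real.rpow_mul (by positivity), Real.div_rpow (by norm_num) (by positivity),
      Real.one_rpow, Real.rpow_two]
    ring
  have hsumm : Summable fun n => ∫ t in Set.Ioi (0 : ℝ), ‖F n t‖ := by
    simp_rw [hnorm]
    refine Summable.mul_left _ ?_
    exact (summable_nat_add_iff 1).2
      (Real.summable_one_div_nat_rpow.2 (by linarith : 1 < 2 * s.re))
  have H := hasSum_integral_of_summable_integral_norm hintg hsumm
  have e1 : ∫ t in Set.Ioi (0 : ℝ), ∑' n, F n t = ∫ t in Set.Ioi (0 : ℝ),
      (t : ℂ) ^ (s - 1) • ((rotThetaPair α h).f t - (rotThetaPair α h).f₀) := by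
    refine setIntegral_congr_fun measurableSet_Ioi fun t ht => ?_
    have := (hasSum_rotTheta h ht).mul_left ((t : ℂ) ^ (s - 1))
    simp only [smul_eq_mul]
    refine Eq.trans (tsum_congr fun n => ?_) this.tsum_eq
    rw [hF]
    ring
  have e2 : ∀ n, ∫ t in Set.Ioi (0 : ℝ), F n t = 2 * Complex.exp (-(Complex.I * α * s)) *
      (Complex.Gammaℝ (2 * s) * (1 / ((n : ℂ) + 1) ^ (2 * s))) := by
    intro n
    rw [hF, integral_const_mul, integral_cpow_mul_exp_neg_mul_of_re_pos (hre n) hs0]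
    have hn0 : (0 : ℝ) < (n : ℝ) + 1 := by positivity
    have hnc : ((n : ℂ) + 1) ≠ 0 := by exact_mod_cast hn0.ne'
    have hpi : (Real.pi : ℂ) ≠ 0 := by exact_mod_cast Real.pi_ne_zero
    have hlog : Complex.log ((n : ℂ) + 1) = (Real.log ((n : ℝ) + 1) : ℝ) := by
      rw [Complex.ofReal_log hn0.le]; push_cast; rfl
    have h1 : (1 / (((Real.pi * ((n : ℝ) + 1) ^ 2 : ℝ) : ℂ) * Complex.exp (Complex.I * α))) ^ s =
        Complex.exp (-(Complex.I * α * s)) * ((Real.pi : ℂ) ^ (-s) *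
          (1 / ((n : ℂ) + 1) ^ (2 * s))) := by
      have : (1 / (((Real.pi * ((n : ℝ) + 1) ^ 2 : ℝ) : ℂ) * Complex.exp (Complex.I * α))) =
          ((1 / (Real.pi * ((n : ℝ) + 1) ^ 2) : ℝ) : ℂ) * Complex.exp (Complex.I * (-α : ℝ)) := by
        push_cast
        rw [mul_neg, Complex.exp_neg]
        have := Complex.exp_ne_zero (Complex.I * α)
        field_simp
      have h1p : 0 < 1 / (Real.pi * ((n : ℝ) + 1) ^ 2) := by have := hp n; positivity
      have h1pc : ((1 / (Real.pi * ((n : ℝ) + 1) ^ 2) : ℝ) : ℂ) ≠ 0 := by exact_mod_cast h1p.ne'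
      rw [this, Complex.cpow_def_of_ne_zero (mul_ne_zero h1pc (Complex.exp_ne_zero _)),
        Complex.log_ofReal_mul h1p (Complex.exp_ne_zero _), log_exp_I_mul (by rwa [abs_neg]),
        Complex.cpow_def_of_ne_zero hpi, Complex.cpow_def_of_ne_zero hnc, one_div (Complex.exp _),
        ← Complex.exp_neg, ← Complex.exp_add, ← Complex.exp_add, hlog,
        ← Complex.ofReal_log Real.pi_pos.le, one_div, Real.log_inv,
        Real.log_mul Real.pi_ne_zero (by positivity), Real.log_pow]
      congr 1
      push_cast
      ring
    rw [h1, Complex.Gammaℝ_def]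
    rw [show -(2 * s) / 2 = -s by ring, show 2 * s / 2 = s by ring]
    ring
  have h2s : 1 < (2 * s).re := by simp; linarith
  have hs2 : 2 * s ≠ 0 := fun h => by rw [h] at h2s; norm_num at h2s
  rw [← e1, ← H.tsum_eq, tsum_congr e2, tsum_mul_left, tsum_mul_left,
    ← zeta_eq_tsum_one_div_nat_add_one_cpow h2s, riemannZeta_def_of_ne_zero hs2,
    mul_div_cancel₀ _ (Complex.Gammaℝ_ne_zero_of_re_pos (by linarith))]

lemma rotThetaPair_Λ_eq {α : ℝ} (h : |α| < Real.pi / 2) {s : ℂ} (h0 : s ≠ 0) (h1 : s ≠ 1 / 2) :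
    (rotThetaPair α h).Λ s =
      2 * Complex.exp (-(Complex.I * α * s)) * completedRiemannZeta (2 * s) := by
  set U : Set ℂ := ({0, 1 / 2} : Set ℂ)ᶜ with hU
  have hfin : ({0, 1 / 2} : Set ℂ).Finite := Set.toFinite _
  have hopen : IsOpen U := hfin.isClosed.isOpen_compl
  have hconn : IsPreconnected U := by
    refine (Set.Countable.isPathConnected_compl_of_one_lt_rank ?_
      hfin.countable).isConnected.isPreconnected
    rw [Complex.rank_real_complex]
    exact Cardinal.one_lt_two
  have hmem : ∀ z ∈ U, z ≠ 0 ∧ z ≠ 1 / 2 := by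
    intro z hz
    simpa [hU, not_or] using hz
  have hf : AnalyticOnNhd ℂ (rotThetaPair α h).Λ U :=
    DifferentiableOn.analyticOnNhd (fun z hz => by
      obtain ⟨a, b⟩ := hmem z hz
      refine ((rotThetaPair α h).differentiableAt_Λ (Or.inl a) (Or.inl ?_)).differentiableWithinAt
      simpa [rotThetaPair] using b) hopen
  have hg : AnalyticOnNhd ℂ (fun s : ℂ => 2 * Complex.exp (-(Complex.I * α * s)) *
      completedRiemannZeta (2 * s)) U :=
    DifferentiableOn.analyticOnNhd (fun z hz => by
      obtain ⟨a, b⟩ := hmem z hz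
      have h1 : DifferentiableAt ℂ (fun s : ℂ => completedRiemannZeta (2 * s)) z := by
        refine DifferentiableAt.comp z (g := completedRiemannZeta) (f := fun s : ℂ => 2 * s)
          (differentiableAt_completedZeta (by simpa using a) ?_) (by fun_prop)
        intro hz1
        exact b (by linear_combination hz1 / 2)
      exact (DifferentiableAt.mul (by fun_prop) h1).differentiableWithinAt) hopen
  refine hf.eqOn_of_preconnected_of_eventuallyEq hg hconn (z₀ := 1) (by simp [hU]) ?_
    (by simp [hU, h0]; simpa using h1)
  have : {z : ℂ | 1 / 2 < z.re} ∈ nhds (1 : ℂ) :=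
    (isOpen_lt continuous_const Complex.continuous_re).mem_nhds (by norm_num)
  filter_upwards [this] with z hz
  exact rotThetaPair_Λ_of_half_lt h hz

lemma hasMellin_cpow_Ioi {s a : ℂ} (hs : s.re + a.re < 0) :
    HasMellin (Set.indicator (Set.Ioi 1) (fun t : ℝ => (t : ℂ) ^ a)) s (-1 / (s + a)) := by
  have hlt : (s - 1 + a).re < -1 := by simp; linarith
  have hset : ∀ t ∈ Set.Ioi (1 : ℝ), (t : ℂ) ^ (s - 1) • (t : ℂ) ^ a = (t : ℂ) ^ (s - 1 + a) := by
    intro t ht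
    rw [smul_eq_mul, Complex.cpow_add]
    exact_mod_cast (zero_lt_one.trans ht).ne'
  have hsub : Set.Ioi (1 : ℝ) ⊆ Set.Ioi 0 := Set.Ioi_subset_Ioi zero_le_one
  simp_rw [HasMellin, mellin, MellinConvergent, ← Set.indicator_smul, IntegrableOn,
    integrable_indicator_iff measurableSet_Ioi, integral_indicator measurableSet_Ioi, IntegrableOn,
    Measure.restrict_restrict_of_subset hsub]
  rw [setIntegral_congr_fun measurableSet_Ioi hset, integral_Ioi_cpow_of_lt hlt one_pos]
  refine ⟨(integrableOn_Ioi_cpow_of_lt hlt one_pos).congr_fun (fun t ht => (hset t ht).symm)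
    measurableSet_Ioi, ?_⟩
  simp
  congr 1
  ring

/-- The rotated theta function with both of its polar terms removed. -/
noncomputable def thetaTail (α x : ℝ) : ℂ :=
  rotTheta α x - 1 - Complex.exp (-(Complex.I * α / 2)) * ((x ^ (-(1 / 2) : ℝ) : ℝ) : ℂ)

lemma mellin_thetaTail {α : ℝ} (h : |α| < Real.pi / 2) {s : ℂ} (h0 : 0 < s.re)
    (h1 : s.re < 1 / 2) :
    mellin (thetaTail α) s =
      2 * Complex.exp (-(Complex.I * α * s)) * completedRiemannZeta (2 * s) := by
  have hs0 : s ≠ 0 := fun h => by rw [h] at h0; simp at h0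
  have hs1 : s ≠ 1 / 2 := fun h => by rw [h] at h1; norm_num at h1
  set P := rotThetaPair α h with hP
  rw [← rotThetaPair_Λ_eq h hs0 hs1, ← hP, WeakFEPair.Λ]
  have m1 : HasMellin P.f_modif s (P.Λ₀ s) :=
    ⟨(P.isStrongFEPair_toStrongFEPair.hasMellin s).1, rfl⟩
  have m2 := hasMellin_one_Ioc h0
  have hneg : s.re + ((-(1 / 2) : ℝ) : ℂ).re < 0 := by rw [Complex.ofReal_re]; linarith
  have m3 := hasMellin_cpow_Ioi hneg
  have m4 := hasMellin_const_smul m3.1 P.ε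
  have m12 := hasMellin_sub m1.1 m2.1
  have m := hasMellin_sub m12.1 m4.1
  have e : mellin (thetaTail α) s = mellin (fun t => (P.f_modif t -
      (Set.Ioc 0 1).indicator (fun _ => (1 : ℂ)) t) - P.ε • (Set.Ioi 1).indicator
        (fun t : ℝ => (t : ℂ) ^ ((-(1 / 2) : ℝ) : ℂ)) t) s := by
    rw [mellin, mellin]
    refine integral_congr_ae ?_
    have h1 : ∀ᵐ t ∂(volume.restrict (Set.Ioi (0 : ℝ))), t ≠ 1 :=
      ae_restrict_of_ae (Measure.ae_ne volume 1)
    filter_upwards [ae_restrict_mem measurableSet_Ioi, h1] with t ht ht1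
    have ht : 0 < t := ht
    congr 1
    have hfε : P.ε = Complex.exp (-(Complex.I * α / 2)) := rfl
    have hff : P.f = rotTheta α := rfl
    have hf0 : P.f₀ = 1 := rfl
    have hg0 : P.g₀ = 1 := rfl
    have hk : P.k = 1 / 2 := rfl
    rw [WeakFEPair.f_modif, hfε, hff, hf0, hg0, hk, Pi.add_apply, thetaTail]
    rcases lt_or_gt_of_ne ht1 with h | h
    · rw [Set.indicator_of_notMem (by simp; exact h.le), Set.indicator_of_mem (by exact ⟨ht, h⟩),
        Set.indicator_of_mem (by exact ⟨ht, h.le⟩), Set.indicator_of_notMem (by simp; exact h.le)]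
      simp only [smul_eq_mul]
      ring
    · rw [Set.indicator_of_mem (by exact h), Set.indicator_of_notMem (by simp; intro _; exact h.le),
        Set.indicator_of_notMem (by simp; intro _; exact h), Set.indicator_of_mem (by exact h),
        Complex.ofReal_cpow ht.le]
      simp only [smul_eq_mul]
      ring
  rw [e, m.2, m12.2, m1.2, m2.2, m4.2, m3.2]
  have hk : P.k = 1 / 2 := rfl
  have hf0 : P.f₀ = 1 := rfl
  have hg0 : P.g₀ = 1 := rfl
  rw [hf0, hg0, hk]
  simp only [smul_eq_mul, mul_one]
  have h2 : s + ((-(1 / 2) : ℝ) : ℂ) ≠ 0 := by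
    intro h; apply hs1; push_cast at h; linear_combination h
  have h3 : ((1 / 2 : ℝ) : ℂ) - s ≠ 0 := by
    intro h; apply hs1; push_cast at h; linear_combination -h
  have : (-1 : ℂ) / (s + ((-(1 / 2) : ℝ) : ℂ)) = 1 / (((1 / 2 : ℝ) : ℂ) - s) := by
    rw [div_eq_div_iff h2 h3]; push_cast; ring
  rw [this]
  ring

/-- The Fourier kernel representing the completed zeta function on the critical line. -/
noncomputable def thetaKer (α v : ℝ) : ℂ :=
  (1 / 2) * Complex.exp (Complex.I * α / 4) * (Real.exp (v / 4) : ℝ) * thetaTail α (Real.exp v)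

lemma completedZeta_eq_integral_thetaKer {α : ℝ} (h : |α| < Real.pi / 2) (t : ℝ) :
    completedRiemannZeta (1 / 2 + Complex.I * t) * (Real.exp (α * t / 2) : ℝ) =
      ∫ v : ℝ, thetaKer α v * Complex.exp (Complex.I * (v * t / 2)) := by
  have hs : ((1 / 4 + Complex.I * t / 2 : ℂ)).re = 1 / 4 := by simp
  have hi : ((1 / 4 + Complex.I * t / 2 : ℂ)).im = t / 2 := by simp
  have key := mellin_thetaTail h (s := 1 / 4 + Complex.I * t / 2) (by rw [hs]; norm_num)
    (by rw [hs]; norm_num)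
  rw [mellin_eq_fourier, hs, hi, Real.fourier_eq'] at key
  rw [show (2 : ℂ) * (1 / 4 + Complex.I * t / 2) = 1 / 2 + Complex.I * t by ring] at key
  rw [← integral_neg_eq_self]
  have e : ∀ v : ℝ, thetaKer α (-v) * Complex.exp (Complex.I * ((-v : ℝ) * t / 2)) =
      (1 / 2) * Complex.exp (Complex.I * α / 4) *
        (Complex.exp (((-2 * Real.pi * inner ℝ v (t / 2 / (2 * Real.pi)) : ℝ) : ℂ) * Complex.I) •
        (Real.exp (-(1 / 4) * v) • thetaTail α (Real.exp (-v)))) := by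
    intro v
    have : -2 * Real.pi * inner ℝ v (t / 2 / (2 * Real.pi)) = -(v * t / 2) := by
      simp only [RCLike.inner_apply, conj_trivial]
      have := Real.pi_ne_zero
      field_simp
    rw [this, thetaKer, smul_eq_mul, Complex.real_smul, show -v / 4 = -(1 / 4) * v by ring,
      show Complex.I * (((-v : ℝ) : ℂ) * t / 2) = ((-(v * t / 2) : ℝ) : ℂ) * Complex.I by
        push_cast; ring]
    ring
  simp_rw [e]
  rw [integral_const_mul, key]
  have : Complex.exp (Complex.I * α / 4) * Complex.exp (-(Complex.I * α * (1 / 4 + Complex.I * t / 2)))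
      = ((Real.exp (α * t / 2) : ℝ) : ℂ) := by
    rw [← Complex.exp_add, Complex.ofReal_exp]
    congr 1
    push_cast
    linear_combination -(α * t / 2 : ℂ) * Complex.I_mul_I
  rw [← this]
  ring

lemma thetaKer_neg {α : ℝ} (h : |α| < Real.pi / 2) (v : ℝ) :
    thetaKer α (-v) = (starRingEnd ℂ) (thetaKer α v) := by
  have hx := Real.exp_pos v
  have h1 := rotTheta_one_div h hx
  rw [one_div, ← Real.exp_neg, rotTheta_neg, smul_eq_mul] at h1
  rw [thetaKer, thetaKer, thetaTail, thetaTail, h1, ← Real.exp_mul, ← Real.exp_mul, ← Real.exp_mul]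
  simp only [map_mul, map_sub, map_one, Complex.conj_ofReal, ← Complex.exp_conj, map_neg, map_div₀,
    Complex.conj_I, Complex.ofReal_exp]
  simp only [mul_sub, mul_one, ← mul_assoc, map_ofNat]
  have A : ∀ a b c : ℂ, (1 / 2 : ℂ) * Complex.exp a * Complex.exp b * Complex.exp c =
      1 / 2 * Complex.exp (a + b + c) := fun a b c => by
    rw [Complex.exp_add, Complex.exp_add]; ring
  have A2 : ∀ a b : ℂ, (1 / 2 : ℂ) * Complex.exp a * Complex.exp b =
      1 / 2 * Complex.exp (a + b) := fun a b => by
    rw [Complex.exp_add]; ring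
  simp only [A2]
  push_cast
  ring_nf

lemma exp_neg_le_rpow_neg {x a : ℝ} (hx : 0 < x) (h0 : 0 ≤ a) (h1 : a ≤ 1) :
    Real.exp (-x) ≤ x ^ (-a) := by
  rw [Real.exp_neg, Real.rpow_neg hx.le]
  refine inv_anti₀ (by positivity) ?_
  rcases le_total x 1 with h | h
  · exact (Real.rpow_le_one hx.le h h0).trans (Real.one_le_exp hx.le)
  · calc x ^ a ≤ x ^ (1 : ℝ) := Real.rpow_le_rpow_of_exponent_le h h1
      _ = x := Real.rpow_one x
      _ ≤ Real.exp x := by linarith [Real.add_one_le_exp x]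

lemma exists_norm_rotTheta_sub_one_le : ∃ C > (0 : ℝ), ∀ α x : ℝ, |α| < Real.pi / 2 → 0 < x →
    ‖rotTheta α x - 1‖ ≤ C * (Real.cos α * x) ^ (-(3 / 5) : ℝ) := by
  have hs : Summable fun n : ℕ => (1 : ℝ) / ((n + 1 : ℕ) : ℝ) ^ (6 / 5 : ℝ) :=
    (summable_nat_add_iff 1).2 (Real.summable_one_div_nat_rpow.2 (by norm_num : (1 : ℝ) < 6 / 5))
  have hp : 0 < ∑' n : ℕ, (1 : ℝ) / ((n + 1 : ℕ) : ℝ) ^ (6 / 5 : ℝ) :=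
    hs.tsum_pos (fun n => by positivity) 0 (by simp)
  refine ⟨2 * ∑' n : ℕ, (1 : ℝ) / ((n + 1 : ℕ) : ℝ) ^ (6 / 5 : ℝ), by positivity, ?_⟩
  intro α x hα hx
  have hc := cos_pos_of_abs_lt hα
  rw [← (hasSum_rotTheta hα hx).tsum_eq]
  refine tsum_of_norm_bounded (g := fun n : ℕ => 2 * ((1 : ℝ) / ((n + 1 : ℕ) : ℝ) ^ (6 / 5 : ℝ)) *
    (Real.cos α * x) ^ (-(3 / 5) : ℝ)) ((hs.hasSum.mul_left 2).mul_right _) ?_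
  intro n
  rw [norm_mul, Complex.norm_exp, Complex.neg_re, Complex.re_mul_ofReal, Complex.re_ofReal_mul,
    exp_I_mul_ofReal_re]
  have hn : (0 : ℝ) < (n : ℝ) + 1 := by positivity
  have h1 : Real.exp (-(Real.pi * ((n : ℝ) + 1) ^ 2 * Real.cos α * x)) ≤
      Real.exp (-(((n : ℝ) + 1) ^ 2 * (Real.cos α * x))) := by
    apply Real.exp_le_exp.2
    have := Real.pi_gt_three
    have h2 : 0 < ((n : ℝ) + 1) ^ 2 * (Real.cos α * x) := by positivity
    nlinarith
  have h2 := exp_neg_le_rpow_neg (x := ((n : ℝ) + 1) ^ 2 * (Real.cos α * x)) (a := 3 / 5)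
    (by positivity) (by norm_num) (by norm_num)
  rw [Real.mul_rpow (by positivity) (by positivity), ← Real.rpow_natCast ((n : ℝ) + 1) 2,
    ← Real.rpow_mul hn.le] at h2
  have h3 : ((n : ℝ) + 1) ^ (((2 : ℕ) : ℝ) * -(3 / 5)) =
      1 / ((n + 1 : ℕ) : ℝ) ^ (6 / 5 : ℝ) := by
    rw [show (((2 : ℕ) : ℝ) * -(3 / 5)) = -(6 / 5 : ℝ) by norm_num, Real.rpow_neg hn.le, one_div]
    push_cast; rfl
  rw [h3, Real.rpow_natCast] at h2
  rw [show ‖(2 : ℂ)‖ = 2 by simp, mul_assoc 2 (1 / _)]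
  exact mul_le_mul_of_nonneg_left (h1.trans h2) two_pos.le

lemma exists_norm_thetaKer_le : ∃ C > (0 : ℝ), ∀ α v : ℝ, |α| < Real.pi / 2 →
    ‖thetaKer α v‖ ≤ C * Real.cos α ^ (-(3 / 5) : ℝ) * Real.exp (-|v| / 4) := by
  obtain ⟨C, hC, H⟩ := exists_norm_rotTheta_sub_one_le
  refine ⟨C + 1, by positivity, ?_⟩
  intro α
  suffices hv : ∀ v : ℝ, 0 ≤ v → |α| < Real.pi / 2 →
      ‖thetaKer α v‖ ≤ (C + 1) * Real.cos α ^ (-(3 / 5) : ℝ) * Real.exp (-v / 4) by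
    intro v hα
    rcases le_total 0 v with h | h
    · rw [abs_of_nonneg h]; exact hv v h hα
    · rw [abs_of_nonpos h]
      have := hv (-v) (by linarith) hα
      rwa [thetaKer_neg hα, Complex.norm_conj] at this
  intro v hv hα
  have hc := cos_pos_of_abs_lt hα
  have hc1 : 1 ≤ Real.cos α ^ (-(3 / 5) : ℝ) :=
    Real.one_le_rpow_of_pos_of_le_one_of_nonpos hc (Real.cos_le_one α) (by norm_num)
  have h1 := H α (Real.exp v) hα (Real.exp_pos v)
  rw [Real.mul_rpow hc.le (Real.exp_pos v).le, ← Real.exp_mul] at h1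
  have n1 : ∀ r : ℝ, ‖Complex.exp (Complex.I * α / r)‖ = 1 := fun r => by
    rw [show Complex.I * α / r = ((α / r : ℝ) : ℂ) * Complex.I by push_cast; ring,
      Complex.norm_exp_ofReal_mul_I]
  have n2 : ‖Complex.exp (-(Complex.I * α / 2))‖ = 1 := by
    rw [Complex.exp_neg, norm_inv]
    have := n1 2
    push_cast at this
    rw [this, inv_one]
  have n3 : ‖Complex.exp (Complex.I * α / 4)‖ = 1 := by exact_mod_cast n1 4
  have h2 : ‖thetaTail α (Real.exp v)‖ ≤
      C * (Real.cos α ^ (-(3 / 5) : ℝ) * Real.exp (v * -(3 / 5))) + Real.exp (v * -(1 / 2)) := by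
    rw [thetaTail]
    refine (norm_sub_le _ _).trans (add_le_add h1 ?_)
    rw [norm_mul, n2, Complex.norm_real, ← Real.exp_mul, one_mul,
      Real.norm_of_nonneg (Real.exp_pos _).le]
  rw [thetaKer, norm_mul, norm_mul, norm_mul, n3, Complex.norm_real,
    Real.norm_of_nonneg (Real.exp_pos _).le]
  have h3 : Real.exp (v * -(3 / 5)) ≤ Real.exp (v * -(1 / 2)) := Real.exp_le_exp.2 (by linarith)
  have h4 : ‖thetaTail α (Real.exp v)‖ ≤
      (C + 1) * Real.cos α ^ (-(3 / 5) : ℝ) * Real.exp (v * -(1 / 2)) := by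
    refine h2.trans ?_
    have : C * (Real.cos α ^ (-(3 / 5) : ℝ) * Real.exp (v * -(3 / 5))) ≤
        C * (Real.cos α ^ (-(3 / 5) : ℝ) * Real.exp (v * -(1 / 2))) := by gcongr
    nlinarith [mul_le_mul_of_nonneg_right hc1 (Real.exp_pos (v * -(1 / 2))).le]
  have h5 : Real.exp (-v / 4) = Real.exp (v / 4) * Real.exp (v * -(1 / 2)) := by
    rw [← Real.exp_add]; congr 1; ring
  rw [h5, show ‖(1 / 2 : ℂ)‖ = 1 / 2 by simp]
  have h6 : 0 ≤ Real.exp (v / 4) * ‖thetaTail α (Real.exp v)‖ := by positivity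
  have h7 := mul_le_mul_of_nonneg_left h4 (Real.exp_pos (v / 4)).le
  nlinarith

lemma continuous_thetaKer {α : ℝ} (h : |α| < Real.pi / 2) : Continuous (thetaKer α) := by
  have h1 : Continuous fun v : ℝ => rotTheta α (Real.exp v) :=
    (continuousOn_rotTheta h).comp_continuous Real.continuous_exp fun v => Real.exp_pos v
  unfold thetaKer thetaTail
  simp_rw [← Real.exp_mul]
  fun_prop

/-- The completed zeta function on the critical line, tilted by an exponential. -/
noncomputable def tiltedXi (α t : ℝ) : ℂ :=
  completedRiemannZeta (1 / 2 + Complex.I * t) * (Real.exp (α * t / 2) : ℝ)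

/-- The Fourier kernel of the tilted completed zeta function times a squared Dirichlet
polynomial. -/
noncomputable def mollKer (α : ℝ) (B : Finset ℕ) (β : ℕ → ℝ) (v : ℝ) : ℂ :=
  ∑ h ∈ B, ∑ k ∈ B, ((β h * β k / (√h * √k) : ℝ) : ℂ) *
    thetaKer α (v + 2 * (Real.log h - Real.log k))

lemma norm_dirPoly_sq_eq {B : Finset ℕ} (hB : ∀ n ∈ B, 1 ≤ n) (β : ℕ → ℝ) (t : ℝ) :
    ((‖dirPoly B β t‖ ^ 2 : ℝ) : ℂ) = ∑ h ∈ B, ∑ k ∈ B, ((β h * β k / (√h * √k) : ℝ) : ℂ) *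
      Complex.exp (-(Complex.I * ((Real.log h - Real.log k : ℝ) * t))) := by
  push_cast
  rw [← Complex.mul_conj', dirPoly, map_sum, Finset.sum_mul_sum]
  refine Finset.sum_congr rfl fun h hh => Finset.sum_congr rfl fun k hk => ?_
  rw [natCast_cpow_critical (hB h hh), natCast_cpow_critical (hB k hk)]
  simp only [map_mul, Complex.conj_ofReal, ← Complex.exp_conj, Complex.conj_I]
  have : Complex.exp (-(Complex.I * ((Complex.log h - Complex.log k) * t))) =
      Complex.exp (Complex.I * ((-Real.log h : ℝ) * t)) *
        Complex.exp (-Complex.I * ((-Real.log k : ℝ) * t)) := by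
    rw [← Complex.exp_add]; congr 1; push_cast; ring
  rw [this]
  push_cast
  field_simp

lemma integrable_exp_neg_abs_div_four : Integrable fun v : ℝ => Real.exp (-|v| / 4) := by
  refine Integrable.mono' (integrable_inv_one_add_sq.const_mul 32) (by fun_prop)
    (Filter.Eventually.of_forall fun v => ?_)
  rw [Real.norm_of_nonneg (Real.exp_pos _).le, neg_div, Real.exp_neg, ← div_eq_mul_inv,
    ← one_div, div_le_div_iff₀ (Real.exp_pos _) (by positivity)]
  have := Real.quadratic_le_exp_of_nonneg (x := |v| / 4) (by positivity)
  have h2 := sq_abs v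
  have h3 := abs_nonneg v
  nlinarith

lemma integrable_thetaKer {α : ℝ} (h : |α| < Real.pi / 2) : Integrable (thetaKer α) := by
  obtain ⟨C, hC, H⟩ := exists_norm_thetaKer_le
  refine Integrable.mono' (g := fun v => C * Real.cos α ^ (-(3 / 5) : ℝ) * Real.exp (-|v| / 4))
    (integrable_exp_neg_abs_div_four.const_mul _) (continuous_thetaKer h).aestronglyMeasurable
    (Filter.Eventually.of_forall fun v => H α v h)

lemma continuous_mollKer {α : ℝ} (h : |α| < Real.pi / 2) (B : Finset ℕ) (β : ℕ → ℝ) :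
    Continuous (mollKer α B β) := by
  have := continuous_thetaKer h
  unfold mollKer
  fun_prop

lemma tiltedXi_mul_eq_integral {α : ℝ} (hα : |α| < Real.pi / 2) {B : Finset ℕ}
    (hB : ∀ n ∈ B, 1 ≤ n) (β : ℕ → ℝ) (t : ℝ) :
    tiltedXi α t * ((‖dirPoly B β t‖ ^ 2 : ℝ) : ℂ) =
      ∫ v : ℝ, mollKer α B β v * Complex.exp (Complex.I * (v * t / 2)) := by
  have hintg : ∀ c : ℝ, Integrable fun v : ℝ =>
      thetaKer α (v + c) * Complex.exp (Complex.I * (v * t / 2)) := by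
    intro c
    refine ((integrable_thetaKer hα).comp_add_right c).mul_bdd (c := 1) (by fun_prop) ?_
    refine Filter.Eventually.of_forall fun v => ?_
    rw [show Complex.I * ((v : ℂ) * t / 2) = ((v * t / 2 : ℝ) : ℂ) * Complex.I by push_cast; ring,
      Complex.norm_exp_ofReal_mul_I]
  have hshift : ∀ c : ℝ, ∫ v : ℝ, thetaKer α (v + c) * Complex.exp (Complex.I * (v * t / 2)) =
      tiltedXi α t * Complex.exp (-(Complex.I * (c * t / 2))) := by
    intro c
    have h1 : ∀ v : ℝ, thetaKer α (v + c) * Complex.exp (Complex.I * (v * t / 2)) =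
        (fun u : ℝ => thetaKer α u * Complex.exp (Complex.I * (u * t / 2)) *
          Complex.exp (-(Complex.I * (c * t / 2)))) (v + c) := by
      intro v
      simp only
      rw [mul_assoc, ← Complex.exp_add]
      congr 2
      push_cast
      ring
    simp_rw [h1]
    rw [integral_add_right_eq_self (μ := volume)
      (fun u : ℝ => thetaKer α u * Complex.exp (Complex.I * (u * t / 2)) *
          Complex.exp (-(Complex.I * (c * t / 2)))), integral_mul_const,
      ← completedZeta_eq_integral_thetaKer hα, tiltedXi]
  rw [norm_dirPoly_sq_eq hB]
  unfold mollKer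
  simp_rw [Finset.sum_mul, mul_assoc]
  rw [integral_finsetSum _ fun h _ => integrable_finsetSum _ fun k _ => (hintg _).const_mul _,
    Finset.mul_sum]
  refine Finset.sum_congr rfl fun h hh => ?_
  rw [integral_finsetSum _ fun k _ => (hintg _).const_mul _, Finset.mul_sum]
  refine Finset.sum_congr rfl fun k hk => ?_
  rw [integral_const_mul, hshift]
  rw [show ((2 * (Real.log h - Real.log k) : ℝ) : ℂ) * t / 2 =
    (Real.log h - Real.log k : ℝ) * t by push_cast; ring]
  ring

lemma mollKer_neg {α : ℝ} (hα : |α| < Real.pi / 2) (B : Finset ℕ) (β : ℕ → ℝ) (v : ℝ) :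
    mollKer α B β (-v) = (starRingEnd ℂ) (mollKer α B β v) := by
  simp only [mollKer, map_sum, map_mul, Complex.conj_ofReal]
  rw [Finset.sum_comm]
  refine Finset.sum_congr rfl fun h _ => Finset.sum_congr rfl fun k _ => ?_
  rw [← thetaKer_neg hα, mul_comm (β k), mul_comm (√k)]
  congr 2
  ring

lemma card_le_of_forall_le {B : Finset ℕ} {Y : ℝ} (hB : ∀ n ∈ B, 1 ≤ n)
    (hY : ∀ n ∈ B, (n : ℝ) ≤ Y) (h1 : 1 ≤ Y) : (B.card : ℝ) ≤ Y := by
  have : B ⊆ Finset.Icc 1 ⌊Y⌋₊ := fun n hn =>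
    Finset.mem_Icc.2 ⟨hB n hn, Nat.le_floor (hY n hn)⟩
  have h2 := Finset.card_le_card this
  rw [Nat.card_Icc, Nat.add_sub_cancel] at h2
  exact (Nat.cast_le.2 h2).trans (Nat.floor_le (by linarith))

lemma abs_mul_div_sqrt_le {β : ℕ → ℝ} (hβ : ∀ n, |β n| ≤ 1) {h k : ℕ} (hh : 1 ≤ h) (hk : 1 ≤ k) :
    |β h * β k / (√h * √k)| ≤ 1 := by
  have h1 : (1 : ℝ) ≤ √h := Real.one_le_sqrt.2 (by exact_mod_cast hh)
  have h2 : (1 : ℝ) ≤ √k := Real.one_le_sqrt.2 (by exact_mod_cast hk)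
  rw [abs_div, abs_mul, abs_of_pos (by positivity : 0 < √(h : ℝ) * √k)]
  refine div_le_one_of_le₀ ?_ (by positivity)
  calc |β h| * |β k| ≤ 1 * 1 := mul_le_mul (hβ h) (hβ k) (abs_nonneg _) zero_le_one
    _ ≤ √h * √k := mul_le_mul h1 h2 zero_le_one (by positivity)

lemma exists_norm_mollKer_le : ∃ C > (0 : ℝ), ∀ (α v Y : ℝ) (B : Finset ℕ) (β : ℕ → ℝ),
    |α| < Real.pi / 2 → (∀ n ∈ B, 1 ≤ n) → (∀ n ∈ B, (n : ℝ) ≤ Y) → 1 ≤ Y → (∀ n, |β n| ≤ 1) →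
    ‖mollKer α B β v‖ ≤ C * Y ^ 3 * Real.cos α ^ (-(3 / 5) : ℝ) * Real.exp (-|v| / 4) := by
  obtain ⟨C, hC, H⟩ := exists_norm_thetaKer_le
  refine ⟨C, hC, fun α v Y B β hα hB hY h1 hβ => ?_⟩
  have hc := cos_pos_of_abs_lt hα
  have hY0 : 0 < Y := by linarith
  set M := C * Real.cos α ^ (-(3 / 5) : ℝ) * Real.exp (-|v| / 4) with hM
  have hM0 : 0 < M := by positivity
  have hterm : ∀ h ∈ B, ∀ k ∈ B, ‖((β h * β k / (√h * √k) : ℝ) : ℂ) *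
      thetaKer α (v + 2 * (Real.log h - Real.log k))‖ ≤ M * Y := by
    intro h hh k hk
    rw [norm_mul, Complex.norm_real, Real.norm_eq_abs]
    have a1 := abs_mul_div_sqrt_le hβ (hB h hh) (hB k hk)
    have a2 := H α (v + 2 * (Real.log h - Real.log k)) hα
    have l1 : 0 ≤ Real.log h := Real.log_natCast_nonneg h
    have l2 : 0 ≤ Real.log k := Real.log_natCast_nonneg k
    have l3 : Real.log h ≤ Real.log Y :=
      Real.log_le_log (by exact_mod_cast hB h hh) (hY h hh)
    have l4 : Real.log k ≤ Real.log Y :=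
      Real.log_le_log (by exact_mod_cast hB k hk) (hY k hk)
    have l5 : |Real.log h - Real.log k| ≤ Real.log Y := abs_le.2 ⟨by linarith, by linarith⟩
    have l6 : |v| - 2 * Real.log Y ≤ |v + 2 * (Real.log h - Real.log k)| := by
      have := abs_sub_abs_le_abs_sub v (-(2 * (Real.log h - Real.log k)))
      rw [abs_neg, abs_mul, abs_two, sub_neg_eq_add] at this
      linarith
    have l7 : Real.exp (-|v + 2 * (Real.log h - Real.log k)| / 4) ≤
        Real.exp (-|v| / 4) * Y := by
      conv_rhs => rw [← Real.exp_log hY0, ← Real.exp_add]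
      apply Real.exp_le_exp.2
      have := Real.log_nonneg h1
      linarith
    calc _ ≤ 1 * (C * Real.cos α ^ (-(3 / 5) : ℝ) * (Real.exp (-|v| / 4) * Y)) := by
          refine mul_le_mul a1 (a2.trans ?_) (norm_nonneg _) zero_le_one
          exact mul_le_mul_of_nonneg_left l7 (by positivity)
      _ = M * Y := by rw [hM]; ring
  have hcard := card_le_of_forall_le hB hY h1
  calc ‖mollKer α B β v‖ ≤ ∑ h ∈ B, ∑ k ∈ B, M * Y :=
        (norm_sum_le _ _).trans (Finset.sum_le_sum fun h hh =>
          (norm_sum_le _ _).trans (Finset.sum_le_sum fun k hk => hterm h hh k hk))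
    _ = (B.card : ℝ) * ((B.card : ℝ) * (M * Y)) := by simp
    _ ≤ Y * (Y * (M * Y)) := by gcongr
    _ = _ := by rw [hM]; ring

lemma norm_integral_bump_exp_le {T : ℝ} (hT : 0 < T) (v : ℝ) :
    ‖∫ t in T..(2 * T), (bump T t : ℂ) * Complex.exp (Complex.I * (v * t / 2))‖ ≤
      256 * T * (1 + (T * v) ^ 2)⁻¹ := by
  rcases le_or_gt ((T * v) ^ 2) 1 with h | h
  · have h1 : ‖∫ t in T..(2 * T), (bump T t : ℂ) * Complex.exp (Complex.I * (v * t / 2))‖ ≤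
        1 * |2 * T - T| := by
      refine intervalIntegral.norm_integral_le_of_norm_le_const fun t ht => ?_
      rw [Set.uIoc_of_le (by linarith)] at ht
      rw [norm_mul, show Complex.I * ((v : ℂ) * t / 2) = ((v * t / 2 : ℝ) : ℂ) * Complex.I by
        push_cast; ring, Complex.norm_exp_ofReal_mul_I, Complex.norm_real, mul_one,
        Real.norm_of_nonneg (bump_nonneg _ _)]
      exact bump_le_one hT ⟨ht.1.le, ht.2⟩
    rw [show 2 * T - T = T by ring, abs_of_pos hT, one_mul] at h1
    refine h1.trans ?_
    rw [← div_eq_mul_inv, le_div_iff₀ (by positivity)]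
    nlinarith
  · have hv : v ≠ 0 := by
      rintro rfl
      norm_num at h
    have h1 := norm_integral_bump_mul_exp_le hT (l := v / 2) (by positivity)
    have e : ∀ t : ℝ, Complex.I * (((v / 2 : ℝ) : ℂ) * t) = Complex.I * (v * t / 2) := by
      intro t; push_cast; ring
    simp_rw [e] at h1
    refine h1.trans ?_
    rw [← div_eq_mul_inv, div_le_div_iff₀ (by positivity) (by positivity)]
    nlinarith

lemma exists_norm_integral_tiltedXi_le : ∃ C > (0 : ℝ), ∀ (α T Y : ℝ) (B : Finset ℕ)
    (β : ℕ → ℝ), |α| < Real.pi / 2 → 0 < T → (∀ n ∈ B, 1 ≤ n) → (∀ n ∈ B, (n : ℝ) ≤ Y) →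
    1 ≤ Y → (∀ n, |β n| ≤ 1) →
    ‖∫ t in T..(2 * T), (bump T t : ℂ) * (tiltedXi α t * ((‖dirPoly B β t‖ ^ 2 : ℝ) : ℂ))‖ ≤
      C * Y ^ 3 * Real.cos α ^ (-(3 / 5) : ℝ) := by
  obtain ⟨C, hC, H⟩ := exists_norm_mollKer_le
  refine ⟨C * (256 * Real.pi), by positivity, fun α T Y B β hα hT hB hY h1 hβ => ?_⟩
  have hc := cos_pos_of_abs_lt hα
  set M := C * Y ^ 3 * Real.cos α ^ (-(3 / 5) : ℝ) with hM
  have hM0 : 0 < M := by positivity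
  have hbound : ∀ v, ‖mollKer α B β v‖ ≤ M * Real.exp (-|v| / 4) := fun v =>
    H α v Y B β hα hB hY h1 hβ
  have hexp : Integrable fun v : ℝ => M * Real.exp (-|v| / 4) :=
    integrable_exp_neg_abs_div_four.const_mul _
  have hG : Integrable (mollKer α B β) := Integrable.mono' hexp
    (continuous_mollKer hα B β).aestronglyMeasurable (Filter.Eventually.of_forall hbound)
  have hw : IntegrableOn (fun t => (bump T t : ℂ)) (Set.Ioc T (2 * T)) :=
    ((Complex.continuous_ofReal.comp (continuous_bump T)).integrableOn_Icc).mono_set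
      Set.Ioc_subset_Icc_self
  have hne : ∀ v t : ℝ, ‖Complex.exp (Complex.I * (v * t / 2))‖ = 1 := fun v t => by
    rw [show Complex.I * ((v : ℂ) * t / 2) = ((v * t / 2 : ℝ) : ℂ) * Complex.I by push_cast; ring,
      Complex.norm_exp_ofReal_mul_I]
  have hprod : Integrable (Function.uncurry fun t v : ℝ => (bump T t : ℂ) *
      (mollKer α B β v * Complex.exp (Complex.I * (v * t / 2))))
      ((volume.restrict (Set.Ioc T (2 * T))).prod volume) := by
    have := (hw.mul_prod hG).mul_bdd (c := 1)
      (g := fun p : ℝ × ℝ => Complex.exp (Complex.I * (p.2 * p.1 / 2)))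
      (by fun_prop) (Filter.Eventually.of_forall fun p => (hne p.2 p.1).le)
    refine this.congr (Filter.Eventually.of_forall fun p => ?_)
    simp only [Function.uncurry]
    ring
  have hswap : ∫ t in T..(2 * T), (bump T t : ℂ) * (tiltedXi α t *
      ((‖dirPoly B β t‖ ^ 2 : ℝ) : ℂ)) = ∫ v : ℝ, mollKer α B β v *
        ∫ t in T..(2 * T), (bump T t : ℂ) * Complex.exp (Complex.I * (v * t / 2)) := by
    simp_rw [tiltedXi_mul_eq_integral hα hB β, ← integral_const_mul]
    rw [intervalIntegral.integral_of_le (by linarith), integral_integral_swap hprod]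
    refine integral_congr_ae (Filter.Eventually.of_forall fun v => ?_)
    simp only
    rw [intervalIntegral.integral_of_le (by linarith), ← integral_const_mul]
    refine integral_congr_ae (Filter.Eventually.of_forall fun t => ?_)
    simp only
    ring
  have hcauchy : Integrable fun v : ℝ => M * (256 * T * (1 + (T * v) ^ 2)⁻¹) := by
    refine Integrable.const_mul (Integrable.const_mul ?_ _) _
    exact integrable_inv_one_add_sq.comp_mul_left' hT.ne'
  rw [hswap]
  calc _ ≤ ∫ v : ℝ, M * (256 * T * (1 + (T * v) ^ 2)⁻¹) := by
        refine norm_integral_le_of_norm_le hcauchy (Filter.Eventually.of_forall fun v => ?_)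
        rw [norm_mul]
        refine mul_le_mul ((hbound v).trans ?_) (norm_integral_bump_exp_le hT v) (norm_nonneg _)
          hM0.le
        refine mul_le_of_le_one_right hM0.le ?_
        rw [Real.exp_le_one_iff]
        have := abs_nonneg v
        linarith
    _ = _ := by
        rw [integral_const_mul, integral_const_mul,
          Measure.integral_comp_mul_left (fun x : ℝ => (1 + x ^ 2)⁻¹), integral_univ_inv_one_add_sq,
          abs_of_pos (by positivity), smul_eq_mul, hM]
        field_simp

lemma integrable_sq_mul_sub {f K : ℝ → ℝ} (hf : Integrable f) (hK : Integrable K) :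
    Integrable (fun p : ℝ × ℝ => f p.2 * K (p.1 - p.2)) (volume.prod volume) := by
  simpa using hf.convolution_integrand (ContinuousLinearMap.mul ℝ ℝ) hK

lemma integral_prod_mul_sub {f K : ℝ → ℝ} (hf : Integrable f) (hK : Integrable K) :
    ∫ p : ℝ × ℝ, f p.2 * K (p.1 - p.2) ∂(volume.prod volume) = (∫ v, f v) * ∫ w, K w := by
  rw [integral_prod_symm _ (integrable_sq_mul_sub hf hK)]
  simp_rw [integral_const_mul]
  rw [← integral_mul_const]
  refine integral_congr_ae (Filter.Eventually.of_forall fun v => ?_)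
  simp only
  rw [integral_sub_right_eq_self]

/-- A Plancherel-type bound for the Fourier transform over a dyadic interval. -/
lemma integral_sq_norm_fourier_le {g : ℝ → ℂ} (hg : Integrable g)
    (hg2 : Integrable fun v => ‖g v‖ ^ 2) {T : ℝ} (hT : 0 < T) :
    ∫ t in T..(2 * T), ‖∫ v : ℝ, g v * Complex.exp (Complex.I * (v * t / 2))‖ ^ 2 ≤
      4 * Real.pi * Real.exp 4 * ∫ v, ‖g v‖ ^ 2 := by
  set gh : ℝ → ℂ := fun t => ∫ v : ℝ, g v * Complex.exp (Complex.I * (v * t / 2)) with hgh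
  set b : ℝ := 1 / T ^ 2 with hb
  have hb0 : 0 < b := by positivity
  have hne : ∀ w t : ℝ, ‖Complex.exp (Complex.I * (w * t / 2))‖ = 1 := fun v t => by
    rw [show Complex.I * ((v : ℂ) * t / 2) = ((v * t / 2 : ℝ) : ℂ) * Complex.I by push_cast; ring,
      Complex.norm_exp_ofReal_mul_I]
  have hgc : Integrable fun v => (starRingEnd ℂ) (g v) :=
    hg.congr' (Complex.continuous_conj.comp_aestronglyMeasurable hg.aestronglyMeasurable)
      (Filter.Eventually.of_forall fun v => (Complex.norm_conj _).symm)
  have hGG : Integrable (fun p : ℝ × ℝ => g p.1 * (starRingEnd ℂ) (g p.2))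
      (volume.prod volume) := hg.mul_prod hgc
  have hsq : ∀ t, ((‖gh t‖ ^ 2 : ℝ) : ℂ) = ∫ p : ℝ × ℝ, (g p.1 * (starRingEnd ℂ) (g p.2)) *
      Complex.exp (Complex.I * ((p.1 - p.2 : ℝ) * t / 2)) ∂(volume.prod volume) := by
    intro t
    push_cast
    rw [← Complex.mul_conj', hgh]
    simp only
    rw [← integral_conj, ← integral_prod_mul]
    refine integral_congr_ae (Filter.Eventually.of_forall fun p => ?_)
    simp only [map_mul, ← Complex.exp_conj, map_div₀, Complex.conj_I, Complex.conj_ofReal, map_ofNat]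
    rw [show Complex.I * (((p.1 : ℂ) - p.2) * t / 2) = Complex.I * (p.1 * t / 2) +
      -Complex.I * (p.2 * t / 2) by ring, Complex.exp_add]
    ring
  have hW : Integrable fun t : ℝ => ((Real.exp (-b * t ^ 2) : ℝ) : ℂ) :=
    (integrable_exp_neg_mul_sq hb0).ofReal
  have hprod : Integrable (Function.uncurry fun (t : ℝ) (p : ℝ × ℝ) =>
      ((Real.exp (-b * t ^ 2) : ℝ) : ℂ) * ((g p.1 * (starRingEnd ℂ) (g p.2)) *
      Complex.exp (Complex.I * ((p.1 - p.2 : ℝ) * t / 2))))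
      (volume.prod (volume.prod volume)) := by
    have := (hW.mul_prod hGG).mul_bdd (c := 1)
      (g := fun q : ℝ × (ℝ × ℝ) => Complex.exp (Complex.I * ((q.2.1 - q.2.2 : ℝ) * q.1 / 2)))
      (Continuous.aestronglyMeasurable (by fun_prop))
      (Filter.Eventually.of_forall fun q => (hne (q.2.1 - q.2.2) q.1).le)
    refine this.congr (Filter.Eventually.of_forall fun q => ?_)
    simp only [Function.uncurry]
    ring
  set K : ℝ → ℝ := fun w => √(Real.pi / b) * Real.exp (-(1 / (16 * b)) * w ^ 2) with hK
  have hKint : Integrable K := (integrable_exp_neg_mul_sq (by positivity)).const_mul _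
  have hKval : ∫ w, K w = 4 * Real.pi := by
    rw [hK, integral_const_mul, integral_gaussian, ← Real.sqrt_mul (by positivity)]
    rw [show Real.pi / b * (Real.pi / (1 / (16 * b))) = (4 * Real.pi) ^ 2 by field_simp; ring,
      Real.sqrt_sq (by positivity)]
  have hinner : ∀ p : ℝ × ℝ, ∫ t : ℝ, ((Real.exp (-b * t ^ 2) : ℝ) : ℂ) *
      ((g p.1 * (starRingEnd ℂ) (g p.2)) * Complex.exp (Complex.I * ((p.1 - p.2 : ℝ) * t / 2))) =
      (g p.1 * (starRingEnd ℂ) (g p.2)) * (K (p.1 - p.2) : ℝ) := by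
    intro p
    have h1 := fourierIntegral_gaussian (b := (b : ℂ)) (by simpa using hb0)
      (((p.1 - p.2) / 2 : ℝ) : ℂ)
    have h2 : (Real.pi / (b : ℂ)) ^ (1 / 2 : ℂ) * Complex.exp (-(((p.1 - p.2) / 2 : ℝ) : ℂ) ^ 2 /
        (4 * b)) = (K (p.1 - p.2) : ℝ) := by
      rw [hK, Real.sqrt_eq_rpow]
      simp only
      rw [Complex.ofReal_mul, Complex.ofReal_cpow (by positivity), Complex.ofReal_exp]
      push_cast
      congr 2
      field_simp
      ring
    rw [h2] at h1
    rw [← h1, ← integral_const_mul]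
    refine integral_congr_ae (Filter.Eventually.of_forall fun t => ?_)
    simp only
    rw [show Complex.I * (((p.1 - p.2) / 2 : ℝ) : ℂ) * t =
      Complex.I * ((p.1 - p.2 : ℝ) * t / 2) by push_cast; ring]
    push_cast
    ring
  have hA : ∀ t : ℝ, ∫ p : ℝ × ℝ, ((Real.exp (-b * t ^ 2) : ℝ) : ℂ) *
      ((g p.1 * (starRingEnd ℂ) (g p.2)) * Complex.exp (Complex.I * ((p.1 - p.2 : ℝ) * t / 2)))
        ∂(volume.prod volume) = ((Real.exp (-b * t ^ 2) * ‖gh t‖ ^ 2 : ℝ) : ℂ) := by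
    intro t
    rw [integral_const_mul, ← hsq]
    push_cast
    rfl
  have hintW : Integrable fun t : ℝ => Real.exp (-b * t ^ 2) * ‖gh t‖ ^ 2 := by
    have := hprod.integral_prod_left
    simp only [Function.uncurry] at this
    simp_rw [hA] at this
    refine this.re.congr (Filter.Eventually.of_forall fun t => ?_)
    exact Complex.ofReal_re _
  have hmain : ((∫ t : ℝ, Real.exp (-b * t ^ 2) * ‖gh t‖ ^ 2 : ℝ) : ℂ) =
      ∫ p : ℝ × ℝ, (g p.1 * (starRingEnd ℂ) (g p.2)) * (K (p.1 - p.2) : ℝ)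
        ∂(volume.prod volume) := by
    rw [← integral_complex_ofReal]
    simp_rw [← hA, ← hinner]
    exact integral_integral_swap hprod
  have hK0 : ∀ w, 0 ≤ K w := fun w => by positivity
  have hKs : ∀ w, K (-w) = K w := fun w => by simp [hK]
  have i1 := integrable_sq_mul_sub hg2 hKint
  have i2 : Integrable (fun p : ℝ × ℝ => ‖g p.1‖ ^ 2 * K (p.1 - p.2)) (volume.prod volume) := by
    refine i1.swap.congr (Filter.Eventually.of_forall fun p => ?_)
    simp only [Function.comp, Prod.fst_swap, Prod.snd_swap]
    rw [← hKs, neg_sub]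
  have v1 := integral_prod_mul_sub hg2 hKint
  have v2 : ∫ p : ℝ × ℝ, ‖g p.1‖ ^ 2 * K (p.1 - p.2) ∂(volume.prod volume) =
      (∫ v, ‖g v‖ ^ 2) * ∫ w, K w := by
    rw [← v1, ← integral_prod_swap]
    refine integral_congr_ae (Filter.Eventually.of_forall fun p => ?_)
    simp only [Prod.fst_swap, Prod.snd_swap]
    rw [← hKs, neg_sub]
  have hbound : ∫ t : ℝ, Real.exp (-b * t ^ 2) * ‖gh t‖ ^ 2 ≤ 4 * Real.pi * ∫ v, ‖g v‖ ^ 2 := by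
    have h0 : ∫ t : ℝ, Real.exp (-b * t ^ 2) * ‖gh t‖ ^ 2 =
        ‖((∫ t : ℝ, Real.exp (-b * t ^ 2) * ‖gh t‖ ^ 2 : ℝ) : ℂ)‖ := by
      rw [Complex.norm_real, Real.norm_of_nonneg (integral_nonneg fun t => by positivity)]
    rw [h0, hmain]
    calc _ ≤ ∫ p : ℝ × ℝ, (1 / 2) * (‖g p.2‖ ^ 2 * K (p.1 - p.2) + ‖g p.1‖ ^ 2 * K (p.1 - p.2))
          ∂(volume.prod volume) := by
          refine norm_integral_le_of_norm_le ((i1.add i2).const_mul _)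
            (Filter.Eventually.of_forall fun p => ?_)
          rw [norm_mul, norm_mul, Complex.norm_conj, Complex.norm_real,
            Real.norm_of_nonneg (hK0 _)]
          have := hK0 (p.1 - p.2)
          nlinarith [sq_nonneg (‖g p.1‖ - ‖g p.2‖), mul_nonneg this
            (sq_nonneg (‖g p.1‖ - ‖g p.2‖))]
      _ = _ := by
          rw [integral_const_mul, integral_add i1 i2, v1, v2, hKval]
          ring
  have hI : IntegrableOn (fun t => Real.exp (-b * t ^ 2) * ‖gh t‖ ^ 2) (Set.Ioc T (2 * T)) :=
    hintW.integrableOn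
  have hstep : ∫ t in T..(2 * T), ‖gh t‖ ^ 2 ≤
      Real.exp 4 * ∫ t : ℝ, Real.exp (-b * t ^ 2) * ‖gh t‖ ^ 2 := by
    rw [intervalIntegral.integral_of_le (by linarith)]
    calc ∫ t in Set.Ioc T (2 * T), ‖gh t‖ ^ 2 ≤
          ∫ t in Set.Ioc T (2 * T), Real.exp 4 * (Real.exp (-b * t ^ 2) * ‖gh t‖ ^ 2) := by
          refine integral_mono_of_nonneg (Filter.Eventually.of_forall fun t => by positivity)
            (hI.const_mul _) ?_
          filter_upwards [ae_restrict_mem measurableSet_Ioc] with t ht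
          have h1 : 1 ≤ Real.exp 4 * Real.exp (-b * t ^ 2) := by
            rw [← Real.exp_add, Real.one_le_exp_iff, hb]
            have : t ^ 2 ≤ 4 * T ^ 2 := by nlinarith [ht.1, ht.2]
            have h3 : 1 / T ^ 2 * t ^ 2 ≤ 4 := by
              rw [one_div, inv_mul_le_iff₀ (by positivity)]; linarith
            linarith
          rw [← mul_assoc]
          exact le_mul_of_one_le_left (by positivity) h1
      _ = Real.exp 4 * ∫ t in Set.Ioc T (2 * T), Real.exp (-b * t ^ 2) * ‖gh t‖ ^ 2 :=
          integral_const_mul _ _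
      _ ≤ _ := by
          refine mul_le_mul_of_nonneg_left ?_ (Real.exp_pos _).le
          exact setIntegral_le_integral hintW (Filter.Eventually.of_forall fun t => by positivity)
  calc _ ≤ _ := hstep
    _ ≤ Real.exp 4 * (4 * Real.pi * ∫ v, ‖g v‖ ^ 2) := by gcongr
    _ = _ := by ring

lemma norm_cexp_neg_mul_ofReal_sq (z : ℂ) (x : ℝ) :
    ‖Complex.exp (-(z * (x : ℂ) ^ 2))‖ = Real.exp (-(z.re * x ^ 2)) := by
  rw [Complex.norm_exp, ← Complex.ofReal_pow, Complex.neg_re, Complex.re_mul_ofReal]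

lemma integrable_cexp_neg_mul_sq' {z : ℂ} (hz : 0 < z.re) :
    Integrable fun x : ℝ => Complex.exp (-(z * (x : ℂ) ^ 2)) := by
  simpa [neg_mul] using integrable_cexp_neg_mul_sq hz

lemma norm_integral_Ioi_one_cexp_le {z : ℂ} (hz : 0 < z.re) :
    ‖∫ x in Set.Ioi (1 : ℝ), Complex.exp (-(z * (x : ℂ) ^ 2))‖ ≤ Real.exp (-z.re) / ‖z‖ := by
  have hz0 : z ≠ 0 := fun h => by rw [h] at hz; simp at hz
  have hzn : 0 < ‖z‖ := norm_pos_iff.2 hz0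
  have hpow : IntegrableOn (fun x : ℝ => x ^ (-2 : ℝ)) (Set.Ioi 1) :=
    integrableOn_Ioi_rpow_of_lt (by norm_num) one_pos
  have hpowval : ∫ x in Set.Ioi (1 : ℝ), x ^ (-2 : ℝ) = 1 := by
    rw [integral_Ioi_rpow_of_lt (by norm_num) one_pos]; norm_num
  set G : ℝ → ℂ := fun x => Complex.exp (-(z * (x : ℂ) ^ 2)) / (2 * z * (x : ℂ) ^ 2) with hG
  have hGn : ∀ x ∈ Set.Ioi (1 : ℝ), ‖G x‖ ≤ Real.exp (-z.re) / (2 * ‖z‖) * x ^ (-2 : ℝ) := by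
    intro x hx
    have hx : 1 < x := hx
    rw [hG, norm_div, norm_cexp_neg_mul_ofReal_sq, norm_mul, norm_mul, norm_pow, Complex.norm_real,
      Real.norm_of_nonneg (by linarith : 0 ≤ x), Complex.norm_ofNat, Real.rpow_neg (by linarith),
      Real.rpow_two, ← div_eq_mul_inv, div_div]
    gcongr
    exact le_mul_of_one_le_right hz.le (one_le_pow₀ hx.le)
  have hGi : IntegrableOn G (Set.Ioi 1) := by
    refine Integrable.mono' (hpow.const_mul (Real.exp (-z.re) / (2 * ‖z‖))) ?_ ?_
    · refine ContinuousOn.aestronglyMeasurable ?_ measurableSet_Ioi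
      refine ContinuousOn.div (by fun_prop) (by fun_prop) fun x hx => ?_
      have hx : (x : ℂ) ≠ 0 := by exact_mod_cast (zero_lt_one.trans hx).ne'
      exact mul_ne_zero (mul_ne_zero two_ne_zero hz0) (pow_ne_zero 2 hx)
    · filter_upwards [ae_restrict_mem measurableSet_Ioi] with x hx using hGn x hx
  have hE : IntegrableOn (fun x : ℝ => Complex.exp (-(z * (x : ℂ) ^ 2))) (Set.Ioi 1) :=
    (integrable_cexp_neg_mul_sq' hz).integrableOn
  have hderiv : ∀ x ∈ Set.Ici (1 : ℝ), HasDerivAt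
      (fun x : ℝ => -(Complex.exp (-(z * (x : ℂ) ^ 2)) / (2 * z * x)))
      (Complex.exp (-(z * (x : ℂ) ^ 2)) + G x) x := by
    intro x hx
    have hx : 1 ≤ x := hx
    have hxc : (x : ℂ) ≠ 0 := by exact_mod_cast (by linarith : x ≠ 0)
    have h1 : HasDerivAt (fun x : ℝ => (x : ℂ)) 1 x := Complex.ofRealCLM.hasDerivAt
    have h2 : HasDerivAt (fun x : ℝ => Complex.exp (-(z * (x : ℂ) ^ 2)))
        (Complex.exp (-(z * (x : ℂ) ^ 2)) * (-(z * (2 * x)))) x := by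
      refine (((h1.pow 2).const_mul z).neg).cexp.congr_deriv ?_
      simp
    have h3 := (h2.div (h1.const_mul (2 * z))
      (mul_ne_zero (mul_ne_zero two_ne_zero hz0) hxc)).neg
    refine h3.congr_deriv ?_
    rw [hG]
    field_simp
    ring
  have htend : Filter.Tendsto (fun x : ℝ => -(Complex.exp (-(z * (x : ℂ) ^ 2)) / (2 * z * x)))
      Filter.atTop (nhds 0) := by
    rw [tendsto_zero_iff_norm_tendsto_zero]
    refine squeeze_zero' (g := fun x : ℝ => 1 / (2 * ‖z‖) * x⁻¹)
      (Filter.Eventually.of_forall fun x => norm_nonneg _) ?_ ?_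
    · filter_upwards [Filter.eventually_ge_atTop 1] with x hx
      rw [norm_neg, norm_div, norm_cexp_neg_mul_ofReal_sq, norm_mul, norm_mul, Complex.norm_real,
        Complex.norm_ofNat, Real.norm_of_nonneg (by linarith : 0 ≤ x), ← div_eq_mul_inv, div_div]
      gcongr
      rw [Real.exp_le_one_iff]
      have : 0 ≤ z.re * x ^ 2 := by positivity
      linarith
    · simpa using tendsto_inv_atTop_zero.const_mul (1 / (2 * ‖z‖))
  have key := integral_Ioi_of_hasDerivAt_of_tendsto' hderiv (hE.add hGi) htend
  rw [integral_add hE hGi] at key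
  have : ∫ x in Set.Ioi (1 : ℝ), Complex.exp (-(z * (x : ℂ) ^ 2)) =
      Complex.exp (-z) / (2 * z) - ∫ x in Set.Ioi (1 : ℝ), G x := by
    rw [eq_sub_iff_add_eq, key]; simp
  rw [this]
  have n1 : ‖Complex.exp (-z) / (2 * z)‖ = Real.exp (-z.re) / (2 * ‖z‖) := by
    rw [norm_div, Complex.norm_exp, norm_mul, Complex.norm_ofNat, Complex.neg_re]
  have n2 : ‖∫ x in Set.Ioi (1 : ℝ), G x‖ ≤ Real.exp (-z.re) / (2 * ‖z‖) := by
    calc _ ≤ ∫ x in Set.Ioi (1 : ℝ), Real.exp (-z.re) / (2 * ‖z‖) * x ^ (-2 : ℝ) := by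
          refine norm_integral_le_of_norm_le (hpow.const_mul _) ?_
          filter_upwards [ae_restrict_mem measurableSet_Ioi] with x hx using hGn x hx
      _ = _ := by rw [integral_const_mul, hpowval, mul_one]
  calc _ ≤ _ := norm_sub_le _ _
    _ ≤ Real.exp (-z.re) / (2 * ‖z‖) + Real.exp (-z.re) / (2 * ‖z‖) := by rw [n1]; gcongr
    _ = _ := by field_simp; ring

/-- The Gaussian tail `∫_{x > 1} exp (-R x²)`. -/
noncomputable def gaussTail (R : ℝ) : ℝ := ∫ x in Set.Ioi (1 : ℝ), Real.exp (-(R * x ^ 2))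

lemma gaussTail_nonneg (R : ℝ) : 0 ≤ gaussTail R :=
  integral_nonneg fun _ => (Real.exp_pos _).le

lemma ofReal_gaussTail (R : ℝ) :
    (gaussTail R : ℂ) = ∫ x in Set.Ioi (1 : ℝ), Complex.exp (-((R : ℂ) * (x : ℂ) ^ 2)) := by
  rw [gaussTail, ← integral_complex_ofReal]
  push_cast
  rfl

lemma gaussTail_le_exp_div {R : ℝ} (hR : 0 < R) : gaussTail R ≤ Real.exp (-R) / R := by
  have := norm_integral_Ioi_one_cexp_le (z := (R : ℂ)) (by simpa using hR)
  rw [← ofReal_gaussTail, Complex.norm_real, Real.norm_of_nonneg (gaussTail_nonneg R),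
    Complex.norm_real, Real.norm_of_nonneg hR.le, Complex.ofReal_re] at this
  exact this

lemma gaussTail_le_inv_sq {R : ℝ} (hR : 0 < R) : gaussTail R ≤ 1 / R ^ 2 := by
  refine (gaussTail_le_exp_div hR).trans ?_
  rw [div_le_div_iff₀ hR (by positivity), Real.exp_neg, inv_mul_eq_div, one_mul,
    div_le_iff₀ (Real.exp_pos _)]
  have := Real.add_one_le_exp R
  nlinarith

lemma gaussTail_le_rpow {R ε : ℝ} (hR : 0 < R) (h0 : 0 < ε) (h1 : ε ≤ 1) :
    gaussTail R ≤ R ^ (-((1 + ε) / 2)) := by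
  rcases le_total R 1 with h | h
  · have h2 : gaussTail R ≤ R ^ (-(1 / 2) : ℝ) := by
      have hintg : Integrable fun x : ℝ => Real.exp (-(R * x ^ 2)) := by
        simpa [neg_mul] using integrable_exp_neg_mul_sq hR
      have e := integral_gaussian_Ioi R
      simp only [neg_mul] at e
      calc gaussTail R ≤ ∫ x in Set.Ioi (0 : ℝ), Real.exp (-(R * x ^ 2)) :=
            setIntegral_mono_set hintg.integrableOn
              (Filter.Eventually.of_forall fun x => (Real.exp_pos _).le)
              (Set.Ioi_subset_Ioi zero_le_one).eventuallyLE
        _ = √(Real.pi / R) / 2 := e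
        _ ≤ √(4 / R) / 2 := by
            gcongr
            exact Real.pi_le_four
        _ = _ := by
            rw [Real.sqrt_div (by norm_num), show (4 : ℝ) = 2 ^ 2 by norm_num,
              Real.sqrt_sq (by norm_num), Real.rpow_neg hR.le, ← Real.sqrt_eq_rpow]
            field_simp
    exact h2.trans (Real.rpow_le_rpow_of_exponent_ge hR h (by linarith))
  · calc gaussTail R ≤ Real.exp (-R) / R := gaussTail_le_exp_div hR
      _ ≤ 1 / R := by
          gcongr
          rw [Real.exp_le_one_iff]; linarith
      _ = R ^ (-1 : ℝ) := by rw [Real.rpow_neg_one, one_div]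
      _ ≤ _ := Real.rpow_le_rpow_of_exponent_le h (by linarith)

/-- Half of the theta function on a ray, without its constant term, in a quadratic variable. -/
noncomputable def rayTheta (α r x : ℝ) : ℂ := (rotTheta α (r ^ 2 * x ^ 2) - 1) / 2

lemma hasSum_rayTheta {α r x : ℝ} (h : |α| < Real.pi / 2) (hr : 0 < r) (hx : 0 < x) :
    HasSum (fun n : ℕ => Complex.exp (-(((Real.pi * (r * (n + 1)) ^ 2 : ℝ) : ℂ) *
      Complex.exp (Complex.I * α) * (x : ℂ) ^ 2))) (rayTheta α r x) := by
  have := (hasSum_rotTheta h (x := r ^ 2 * x ^ 2) (by positivity)).div_const 2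
  refine this.congr_fun fun n => ?_
  rw [mul_div_cancel_left₀ _ (two_ne_zero' ℂ)]
  congr 1
  push_cast
  ring

lemma continuousOn_rayTheta {α r : ℝ} (h : |α| < Real.pi / 2) (hr : 0 < r) :
    ContinuousOn (rayTheta α r) (Set.Ioi 0) := by
  unfold rayTheta
  refine ContinuousOn.div_const (ContinuousOn.sub ?_ continuousOn_const) _
  refine (continuousOn_rotTheta h).comp (by fun_prop) fun x hx => ?_
  have hx : 0 < x := hx
  simp only [Set.mem_Ioi]
  positivity

lemma integrableOn_rayTheta_mul {α r r' : ℝ} (h : |α| < Real.pi / 2) (hr : 0 < r) (hr' : 0 < r') :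
    IntegrableOn (fun x => rayTheta α r x * (starRingEnd ℂ) (rayTheta α r' x)) (Set.Ioi 1) := by
  obtain ⟨C, hC, H⟩ := exists_norm_rotTheta_sub_one_le
  have hc := cos_pos_of_abs_lt h
  have hb : ∀ r : ℝ, 0 < r → ∀ x : ℝ, 0 < x → ‖rayTheta α r x‖ ≤
      C * (Real.cos α * r ^ 2) ^ (-(3 / 5) : ℝ) * x ^ (-(6 / 5) : ℝ) := by
    intro r hr x hx
    have h1 := H α (r ^ 2 * x ^ 2) h (by positivity)
    rw [← mul_assoc, Real.mul_rpow (by positivity) (by positivity), ← Real.rpow_natCast x 2,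
      ← Real.rpow_mul hx.le] at h1
    rw [rayTheta, norm_div, Complex.norm_ofNat, mul_assoc]
    rw [show ((2 : ℕ) : ℝ) * -(3 / 5) = -(6 / 5) by norm_num, Real.rpow_natCast] at h1
    have : ‖rotTheta α (r ^ 2 * x ^ 2) - 1‖ / 2 ≤ ‖rotTheta α (r ^ 2 * x ^ 2) - 1‖ :=
      half_le_self (norm_nonneg _)
    exact this.trans h1
  have hsub : Set.Ioi (1 : ℝ) ⊆ Set.Ioi 0 := Set.Ioi_subset_Ioi zero_le_one
  refine Integrable.mono' (g := fun x : ℝ => (C * (Real.cos α * r ^ 2) ^ (-(3 / 5) : ℝ)) *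
    (C * (Real.cos α * r' ^ 2) ^ (-(3 / 5) : ℝ)) * x ^ (-(12 / 5) : ℝ)) ?_ ?_ ?_
  · exact (integrableOn_Ioi_rpow_of_lt (by norm_num) one_pos).const_mul _
  · refine ContinuousOn.aestronglyMeasurable ?_ measurableSet_Ioi
    exact ((continuousOn_rayTheta h hr).mono hsub).mul
      (Complex.continuous_conj.comp_continuousOn ((continuousOn_rayTheta h hr').mono hsub))
  · filter_upwards [ae_restrict_mem measurableSet_Ioi] with x hx
    have hx0 : 0 < x := zero_lt_one.trans hx
    rw [norm_mul, Complex.norm_conj]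
    refine (mul_le_mul (hb r hr x hx0) (hb r' hr' x hx0) (norm_nonneg _) (by positivity)).trans
      (le_of_eq ?_)
    rw [show (-(12 / 5) : ℝ) = -(6 / 5) + -(6 / 5) by norm_num, Real.rpow_add hx0]
    ring

/-- The complex frequency attached to a pair of terms in the square of a theta function. -/
noncomputable def pairFreq (α ρ ρ' : ℝ) : ℂ :=
  ((Real.pi * ρ ^ 2 : ℝ) : ℂ) * Complex.exp (Complex.I * α) +
    ((Real.pi * ρ' ^ 2 : ℝ) : ℂ) * (starRingEnd ℂ) (Complex.exp (Complex.I * α))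

lemma pairFreq_re (α ρ ρ' : ℝ) :
    (pairFreq α ρ ρ').re = Real.pi * (ρ ^ 2 + ρ' ^ 2) * Real.cos α := by
  rw [pairFreq, Complex.add_re, Complex.re_ofReal_mul, Complex.re_ofReal_mul, Complex.conj_re,
    exp_I_mul_ofReal_re]
  ring

lemma pairFreq_im (α ρ ρ' : ℝ) :
    (pairFreq α ρ ρ').im = Real.pi * (ρ ^ 2 - ρ' ^ 2) * Real.sin α := by
  rw [pairFreq, Complex.add_im, Complex.im_ofReal_mul, Complex.im_ofReal_mul, Complex.conj_im,
    mul_comm Complex.I, Complex.exp_ofReal_mul_I_im]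
  ring

lemma pairFreq_self (α ρ : ℝ) :
    pairFreq α ρ ρ = ((2 * Real.pi * Real.cos α * ρ ^ 2 : ℝ) : ℂ) := by
  apply Complex.ext
  · rw [pairFreq_re, Complex.ofReal_re]; ring
  · rw [pairFreq_im, Complex.ofReal_im]; ring

lemma hasSum_integral_rayTheta_mul {α r r' : ℝ} (h : |α| < Real.pi / 2) (hr : 0 < r)
    (hr' : 0 < r') :
    HasSum (fun p : ℕ × ℕ => ∫ x in Set.Ioi (1 : ℝ), Complex.exp
      (-(pairFreq α (r * (p.1 + 1)) (r' * (p.2 + 1)) * (x : ℂ) ^ 2)))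
      (∫ x in Set.Ioi (1 : ℝ), rayTheta α r x * (starRingEnd ℂ) (rayTheta α r' x)) := by
  have hc := cos_pos_of_abs_lt h
  have hre : ∀ p : ℕ × ℕ, 0 < (pairFreq α (r * (p.1 + 1)) (r' * (p.2 + 1))).re := fun p => by
    rw [pairFreq_re]
    have := Real.pi_pos
    positivity
  have hsq : Summable fun n : ℕ => (1 : ℝ) / ((n : ℝ) + 1) ^ 2 := by
    have := (summable_nat_add_iff 1).2 (Real.summable_one_div_nat_pow.2 (by norm_num : 1 < 2))
    simpa using this
  have hsumm : Summable fun p : ℕ × ℕ => ∫ x in Set.Ioi (1 : ℝ), ‖Complex.exp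
      (-(pairFreq α (r * (p.1 + 1)) (r' * (p.2 + 1)) * (x : ℂ) ^ 2))‖ := by
    refine Summable.of_nonneg_of_le (fun p => integral_nonneg fun x => norm_nonneg _)
      (fun p => ?_) ((hsq.mul_of_nonneg hsq (fun n => by positivity)
        (fun n => by positivity)).mul_left (1 / (4 * (Real.cos α) ^ 2 * r ^ 2 * r' ^ 2)))
    simp_rw [norm_cexp_neg_mul_ofReal_sq]
    refine (gaussTail_le_inv_sq (hre p)).trans ?_
    rw [pairFreq_re]
    rw [div_mul_div_comm, one_mul, div_mul_div_comm, one_mul]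
    have h1 : 0 < r * ((p.1 : ℝ) + 1) := by positivity
    have h2 : 0 < r' * ((p.2 : ℝ) + 1) := by positivity
    refine one_div_le_one_div_of_le (by positivity) ?_
    set a := r * ((p.1 : ℝ) + 1) with ha
    set b := r' * ((p.2 : ℝ) + 1) with hb
    have e : 4 * Real.cos α ^ 2 * r ^ 2 * r' ^ 2 * (((p.1 : ℝ) + 1) ^ 2 * ((p.2 : ℝ) + 1) ^ 2) =
        (2 * (a * b) * Real.cos α) ^ 2 := by rw [ha, hb]; ring
    rw [e]
    refine pow_le_pow_left₀ (by positivity) ?_ 2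
    refine mul_le_mul_of_nonneg_right ?_ hc.le
    have := Real.pi_gt_three
    nlinarith [sq_nonneg (a - b), mul_pos h1 h2, sq_nonneg a, sq_nonneg b]
  have H := hasSum_integral_of_summable_integral_norm
    (fun p : ℕ × ℕ => ((integrable_cexp_neg_mul_sq' (hre p)).integrableOn (s := Set.Ioi 1)))
    hsumm
  have e : ∫ x in Set.Ioi (1 : ℝ), rayTheta α r x * (starRingEnd ℂ) (rayTheta α r' x) =
      ∫ x in Set.Ioi (1 : ℝ), ∑' p : ℕ × ℕ, Complex.exp
        (-(pairFreq α (r * (p.1 + 1)) (r' * (p.2 + 1)) * (x : ℂ) ^ 2)) := by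
    refine setIntegral_congr_fun measurableSet_Ioi fun x hx => ?_
    have hx0 : 0 < x := zero_lt_one.trans hx
    have s1 := hasSum_rayTheta h hr hx0
    have s2 := (hasSum_rayTheta h hr' hx0)
    have s3 := Complex.hasSum_conj'.2 s2
    have := tsum_mul_tsum_of_summable_norm s1.summable.norm s3.summable.norm
    rw [s1.tsum_eq, s3.tsum_eq] at this
    rw [this]
    refine tsum_congr fun p => ?_
    rw [← Complex.exp_conj, ← Complex.exp_add]
    congr 1
    rw [pairFreq]
    simp only [map_neg, map_mul, map_pow, Complex.conj_ofReal]
    ring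
  rw [e]
  exact H

lemma norm_integral_cexp_pairFreq_le {α : ℝ} (h : |α| < Real.pi / 2) (hs : 1 / 2 ≤ Real.sin α)
    {h₁ k₁ h₂ k₂ : ℕ} (hh₁ : 1 ≤ h₁) (hk₁ : 1 ≤ k₁) (hh₂ : 1 ≤ h₂) (hk₂ : 1 ≤ k₂) (n m : ℕ)
    (hd : ((h₁ * k₂ * (n + 1) : ℕ) : ℤ) - ((h₂ * k₁ * (m + 1) : ℕ) : ℤ) ≠ 0) :
    ‖∫ x in Set.Ioi (1 : ℝ), Complex.exp (-(pairFreq α ((h₁ : ℝ) / k₁ * (n + 1))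
      ((h₂ : ℝ) / k₂ * (m + 1)) * (x : ℂ) ^ 2))‖ ≤
      Real.cos α ^ (-(3 / 8) : ℝ) * ((k₁ : ℝ) * k₂) ^ 3 * (((n : ℝ) + 1) ^ (-(5 / 4) : ℝ) *
        |((((h₁ * k₂ * (n + 1) : ℕ) : ℤ) - ((h₂ * k₁ * (m + 1) : ℕ) : ℤ) : ℤ) : ℝ)| ^
          (-(3 / 2) : ℝ)) := by
  have hc := cos_pos_of_abs_lt h
  have hpi := Real.pi_gt_three
  have hps : 1 ≤ Real.pi * Real.sin α := by nlinarith
  set d : ℤ := ((h₁ * k₂ * (n + 1) : ℕ) : ℤ) - ((h₂ * k₁ * (m + 1) : ℕ) : ℤ) with hdd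
  have e1 : (1 : ℝ) ≤ h₁ := by exact_mod_cast hh₁
  have e2 : (1 : ℝ) ≤ k₁ := by exact_mod_cast hk₁
  have e3 : (1 : ℝ) ≤ h₂ := by exact_mod_cast hh₂
  have e4 : (1 : ℝ) ≤ k₂ := by exact_mod_cast hk₂
  have hn : (0 : ℝ) < (n : ℝ) + 1 := by positivity
  have hm : (0 : ℝ) < (m : ℝ) + 1 := by positivity
  set Q : ℝ := (k₁ : ℝ) * k₂ with hQ
  have hQ1 : 1 ≤ Q := one_le_mul_of_one_le_of_one_le e2 e4
  have hQ0 : 0 < Q := by linarith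
  set a : ℝ := (h₁ : ℝ) * k₂ * (n + 1) with ha
  set b : ℝ := (h₂ : ℝ) * k₁ * (m + 1) with hb
  have hdab : (d : ℝ) = a - b := by rw [hdd]; push_cast; rw [ha, hb]
  have ha1 : (n : ℝ) + 1 ≤ a :=
    le_mul_of_one_le_left hn.le (one_le_mul_of_one_le_of_one_le e1 e4)
  have hb0 : 0 < b := by positivity
  have ha0 : 0 < a := by linarith
  have hdpos : 0 < |(d : ℝ)| := abs_pos.2 (by exact_mod_cast hd)
  have hρ : (h₁ : ℝ) / k₁ * (n + 1) = a / Q := by rw [ha, hQ]; field_simp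
  have hρ' : (h₂ : ℝ) / k₂ * (m + 1) = b / Q := by rw [hb, hQ]; field_simp
  rw [hρ, hρ']
  set z := pairFreq α (a / Q) (b / Q) with hz
  have hre : z.re = Real.pi * ((a / Q) ^ 2 + (b / Q) ^ 2) * Real.cos α := pairFreq_re ..
  have him : z.im = Real.pi * ((a / Q) ^ 2 - (b / Q) ^ 2) * Real.sin α := pairFreq_im ..
  have hre0 : 0 < z.re := by rw [hre]; positivity
  have hre1 : Real.cos α * (((n : ℝ) + 1) / Q) ^ 2 ≤ z.re := by
    rw [hre, mul_comm]
    refine mul_le_mul_of_nonneg_right ?_ hc.le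
    have h1 : (((n : ℝ) + 1) / Q) ^ 2 ≤ (a / Q) ^ 2 := by gcongr
    have h2 := sq_nonneg (b / Q)
    have h3 := sq_nonneg (a / Q)
    nlinarith
  have hexp : Real.exp (-z.re) ≤
      Real.cos α ^ (-(3 / 8) : ℝ) * (Q * ((n : ℝ) + 1) ^ (-(3 / 4) : ℝ)) := by
    calc Real.exp (-z.re) ≤ z.re ^ (-(3 / 8) : ℝ) :=
          exp_neg_le_rpow_neg hre0 (by norm_num) (by norm_num)
      _ ≤ (Real.cos α * (((n : ℝ) + 1) / Q) ^ 2) ^ (-(3 / 8) : ℝ) :=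
          Real.rpow_le_rpow_of_nonpos (by positivity) hre1 (by norm_num)
      _ = Real.cos α ^ (-(3 / 8) : ℝ) * (((n : ℝ) + 1) ^ (-(3 / 4) : ℝ) / Q ^ (-(3 / 4) : ℝ)) := by
          rw [Real.mul_rpow hc.le (by positivity), ← Real.rpow_natCast _ 2,
            ← Real.rpow_mul (by positivity), ← Real.div_rpow hn.le hQ0.le]
          norm_num
      _ ≤ _ := by
          refine mul_le_mul_of_nonneg_left ?_ (by positivity)
          rw [Real.rpow_neg hQ0.le, div_inv_eq_mul, mul_comm]
          refine mul_le_mul_of_nonneg_right ?_ (by positivity)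
          calc Q ^ (3 / 4 : ℝ) ≤ Q ^ (1 : ℝ) :=
                Real.rpow_le_rpow_of_exponent_le hQ1 (by norm_num)
            _ = Q := Real.rpow_one Q
  have hzn : |(d : ℝ)| ^ (3 / 2 : ℝ) * ((n : ℝ) + 1) ^ (1 / 2 : ℝ) / Q ^ 2 ≤ ‖z‖ := by
    refine le_trans ?_ (Complex.abs_im_le_norm z)
    have h1 : z.im = (Real.pi * Real.sin α) * (d * (a + b)) / Q ^ 2 := by
      rw [him, hdab]; field_simp; ring
    rw [h1, abs_div, abs_mul, abs_mul (d : ℝ), abs_of_pos (by positivity : 0 < a + b),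
      abs_of_pos (by positivity : 0 < Q ^ 2), abs_of_pos (zero_lt_one.trans_le hps)]
    refine div_le_div_of_nonneg_right ?_ (by positivity)
    have h2 : |(d : ℝ)| ^ (1 / 2 : ℝ) * ((n : ℝ) + 1) ^ (1 / 2 : ℝ) ≤ a + b := by
      have h3 : |(d : ℝ)| ≤ a + b := by rw [hdab, abs_le]; constructor <;> linarith
      calc _ ≤ (a + b) ^ (1 / 2 : ℝ) * (a + b) ^ (1 / 2 : ℝ) := by
            refine mul_le_mul (Real.rpow_le_rpow hdpos.le h3 (by norm_num))
              (Real.rpow_le_rpow hn.le (by linarith) (by norm_num)) (by positivity) (by positivity)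
        _ = a + b := by
            rw [← Real.rpow_add (by positivity)]; norm_num
    have h4 : |(d : ℝ)| ^ (3 / 2 : ℝ) = |(d : ℝ)| * |(d : ℝ)| ^ (1 / 2 : ℝ) := by
      rw [show (3 / 2 : ℝ) = 1 + 1 / 2 by norm_num, Real.rpow_add hdpos, Real.rpow_one]
    rw [h4, mul_assoc]
    have h5 : |(d : ℝ)| * (|(d : ℝ)| ^ (1 / 2 : ℝ) * ((n : ℝ) + 1) ^ (1 / 2 : ℝ)) ≤
        |(d : ℝ)| * (a + b) := mul_le_mul_of_nonneg_left h2 hdpos.le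
    refine h5.trans (le_mul_of_one_le_left (by positivity) hps)
  refine (norm_integral_Ioi_one_cexp_le hre0).trans ?_
  calc _ ≤ Real.cos α ^ (-(3 / 8) : ℝ) * (Q * ((n : ℝ) + 1) ^ (-(3 / 4) : ℝ)) /
        (|(d : ℝ)| ^ (3 / 2 : ℝ) * ((n : ℝ) + 1) ^ (1 / 2 : ℝ) / Q ^ 2) := by gcongr
    _ = _ := by
        rw [show (-(5 / 4) : ℝ) = -(3 / 4) - 1 / 2 by norm_num, Real.rpow_sub hn,
          Real.rpow_neg hdpos.le]
        field_simp

/-- The part of the double series for a product of theta functions with distinct frequencies. -/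
noncomputable def offDiag (α r r' : ℝ) (p : ℕ × ℕ) : ℂ :=
  if r * (p.1 + 1) = r' * (p.2 + 1) then 0 else
    ∫ x in Set.Ioi (1 : ℝ), Complex.exp
      (-(pairFreq α (r * (p.1 + 1)) (r' * (p.2 + 1)) * (x : ℂ) ^ 2))

/-- The part of the double series with coinciding frequencies, with a general weight. -/
noncomputable def onDiag (f : ℝ → ℝ) (r r' : ℝ) (p : ℕ × ℕ) : ℝ :=
  if r * (p.1 + 1) = r' * (p.2 + 1) then f (r * (p.1 + 1)) else 0

lemma exists_tsum_norm_offDiag_le : ∃ C > 0, ∀ (α : ℝ) (h₁ k₁ h₂ k₂ : ℕ), |α| < Real.pi / 2 →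
    1 / 2 ≤ Real.sin α → 1 ≤ h₁ → 1 ≤ k₁ → 1 ≤ h₂ → 1 ≤ k₂ →
    Summable (offDiag α ((h₁ : ℝ) / k₁) ((h₂ : ℝ) / k₂)) ∧
    ‖∑' p, offDiag α ((h₁ : ℝ) / k₁) ((h₂ : ℝ) / k₂) p‖ ≤
      C * (Real.cos α ^ (-(3 / 8) : ℝ) * ((k₁ : ℝ) * k₂) ^ 3) := by
  set g : ℕ × ℤ → ℝ := fun q => ((q.1 : ℝ) + 1) ^ (-(5 / 4) : ℝ) * |(q.2 : ℝ)| ^ (-(3 / 2) : ℝ)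
    with hg
  have s1 : Summable fun n : ℕ => ((n : ℝ) + 1) ^ (-(5 / 4) : ℝ) := by
    have := (summable_nat_add_iff 1).2 (Real.summable_nat_rpow.2 (by norm_num : (-(5 / 4) : ℝ) < -1))
    simpa using this
  have s2 : Summable fun n : ℤ => |(n : ℝ)| ^ (-(3 / 2) : ℝ) :=
    Real.summable_abs_int_rpow (by norm_num)
  have hgs : Summable g := s1.mul_of_nonneg s2 (fun n => by positivity) (fun n => by positivity)
  have hg0 : ∀ q, 0 ≤ g q := fun q => by rw [hg]; positivity
  refine ⟨∑' q, g q + 1, add_pos_of_nonneg_of_pos (tsum_nonneg hg0) one_pos, ?_⟩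
  intro α h₁ k₁ h₂ k₂ h hs hh₁ hk₁ hh₂ hk₂
  have hc := cos_pos_of_abs_lt h
  set φ : ℕ × ℕ → ℕ × ℤ := fun p =>
    (p.1, ((h₁ * k₂ * (p.1 + 1) : ℕ) : ℤ) - ((h₂ * k₁ * (p.2 + 1) : ℕ) : ℤ)) with hφ
  have hφi : Function.Injective φ := by
    rintro ⟨n, m⟩ ⟨n', m'⟩ hp
    simp only [hφ, Prod.mk.injEq] at hp
    obtain ⟨rfl, h2⟩ := hp
    have h3 : h₂ * k₁ * (m + 1) = h₂ * k₁ * (m' + 1) := by omega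
    have h4 := Nat.eq_of_mul_eq_mul_left (by positivity) h3
    simpa using h4
  have hb : ∀ p, ‖offDiag α ((h₁ : ℝ) / k₁) ((h₂ : ℝ) / k₂) p‖ ≤
      Real.cos α ^ (-(3 / 8) : ℝ) * ((k₁ : ℝ) * k₂) ^ 3 * g (φ p) := by
    rintro ⟨n, m⟩
    rw [offDiag]
    split_ifs with hp
    · rw [norm_zero]
      have := hg0 (φ (n, m))
      positivity
    · refine norm_integral_cexp_pairFreq_le h hs hh₁ hk₁ hh₂ hk₂ n m ?_
      intro h0
      apply hp
      rw [sub_eq_zero, Nat.cast_inj] at h0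
      have h1 : (h₁ : ℝ) * k₂ * (n + 1) = h₂ * k₁ * (m + 1) := by exact_mod_cast h0
      have e2 : (0 : ℝ) < k₁ := by exact_mod_cast hk₁
      have e4 : (0 : ℝ) < k₂ := by exact_mod_cast hk₂
      field_simp
      linarith
  have hsum : Summable fun p => Real.cos α ^ (-(3 / 8) : ℝ) * ((k₁ : ℝ) * k₂) ^ 3 * g (φ p) :=
    (hgs.comp_injective hφi).mul_left _
  refine ⟨Summable.of_norm_bounded hsum hb, ?_⟩
  refine (tsum_of_norm_bounded hsum.hasSum hb).trans ?_
  rw [tsum_mul_left, mul_comm]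
  refine mul_le_mul_of_nonneg_right ?_ (by positivity)
  have := tsum_comp_le_tsum_of_inj hgs hg0 hφi
  simp only [Function.comp_def] at this
  linarith

lemma hasSum_onDiag_gaussTail {α r r' : ℝ} (h : |α| < Real.pi / 2) (hr : 0 < r) (hr' : 0 < r')
    (hs : Summable (offDiag α r r')) :
    HasSum (onDiag (fun ρ => gaussTail (2 * Real.pi * Real.cos α * ρ ^ 2)) r r')
      ((∫ x in Set.Ioi (1 : ℝ), rayTheta α r x * (starRingEnd ℂ) (rayTheta α r' x)) -
        ∑' p, offDiag α r r' p).re := by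
  have H := Complex.hasSum_re ((hasSum_integral_rayTheta_mul h hr hr').sub hs.hasSum)
  refine H.congr_fun fun p => ?_
  rw [onDiag, offDiag]
  split_ifs with hp
  · rw [← hp, pairFreq_self, ← ofReal_gaussTail, sub_zero, Complex.ofReal_re]
  · simp

lemma sum_sum_ite_eq_nonneg {ι : Type*} (J : Finset ι) (c ρ : ι → ℝ) {f : ℝ → ℝ}
    (hf : ∀ j ∈ J, 0 ≤ f (ρ j)) :
    0 ≤ ∑ i ∈ J, ∑ j ∈ J, c i * c j * (if ρ i = ρ j then f (ρ i) else 0) := by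
  classical
  have e : ∑ i ∈ J, ∑ j ∈ J, c i * c j * (if ρ i = ρ j then f (ρ i) else 0) =
      ∑ x ∈ J.image ρ, f x * (∑ i ∈ J with ρ i = x, c i) ^ 2 := by
    rw [← Finset.sum_fiberwise_of_maps_to (fun i hi => Finset.mem_image_of_mem ρ hi)]
    refine Finset.sum_congr rfl fun x _ => ?_
    rw [sq, Finset.sum_mul_sum, Finset.mul_sum]
    refine Finset.sum_congr rfl fun i hi => ?_
    rw [Finset.mul_sum, Finset.sum_filter]
    refine Finset.sum_congr rfl fun j _ => ?_
    rw [(Finset.mem_filter.1 hi).2]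
    simp only [eq_comm (a := x)]
    split_ifs <;> ring
  rw [e]
  refine Finset.sum_nonneg fun x hx => ?_
  obtain ⟨j, hj, rfl⟩ := Finset.mem_image.1 hx
  exact mul_nonneg (hf j hj) (sq_nonneg _)

lemma sum_sum_onDiag_nonneg {ι : Type*} (A : Finset ι) (c r : ι → ℝ) {f : ℝ → ℝ}
    {D : ι → ι → ℝ} (hr : ∀ i ∈ A, 0 < r i) (hf : ∀ x, 0 < x → 0 ≤ f x)
    (hD : ∀ i ∈ A, ∀ j ∈ A, HasSum (onDiag f (r i) (r j)) (D i j)) :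
    0 ≤ ∑ i ∈ A, ∑ j ∈ A, c i * c j * D i j := by
  have H : HasSum (fun p => ∑ i ∈ A, ∑ j ∈ A, c i * c j * onDiag f (r i) (r j) p)
      (∑ i ∈ A, ∑ j ∈ A, c i * c j * D i j) :=
    hasSum_sum fun i hi => hasSum_sum fun j hj => (hD i hi j hj).mul_left _
  have ht : Filter.Tendsto (fun N : ℕ => Finset.range N ×ˢ Finset.range N) Filter.atTop
      Filter.atTop := by
    refine Filter.tendsto_atTop_finset_of_monotone
      (fun a b hab => Finset.product_subset_product (Finset.range_mono hab)
        (Finset.range_mono hab)) fun p => ⟨max p.1 p.2 + 1, ?_⟩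
    simp [Finset.mem_product]
  refine ge_of_tendsto' (H.comp ht) fun N => ?_
  have := sum_sum_ite_eq_nonneg (A ×ˢ Finset.range N) (fun q => c q.1)
    (fun q => r q.1 * ((q.2 : ℝ) + 1)) (f := f) (fun q hq => hf _ (by
      have := hr q.1 (Finset.mem_product.1 hq).1
      positivity))
  refine this.trans (le_of_eq ?_)
  simp only [Function.comp_def]
  simp_rw [Finset.sum_product, onDiag]
  rw [Finset.sum_comm]
  refine Finset.sum_congr rfl fun n _ => ?_
  rw [Finset.sum_comm (s := Finset.range N)]
  exact Finset.sum_congr rfl fun i _ => Finset.sum_comm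

lemma hasSum_onDiag_rpow {ε : ℝ} (hε : 0 < ε) {h₁ k₁ h₂ k₂ : ℕ} (hh₁ : 1 ≤ h₁) (hk₁ : 1 ≤ k₁)
    (hh₂ : 1 ≤ h₂) (hk₂ : 1 ≤ k₂) :
    HasSum (onDiag (fun ρ => ρ ^ (-(1 + ε))) ((h₁ : ℝ) / k₁) ((h₂ : ℝ) / k₂))
      (((Nat.lcm (h₁ * k₂) (h₂ * k₁) : ℝ) / (k₁ * k₂)) ^ (-(1 + ε)) *
        ∑' m : ℕ, ((m : ℝ) + 1) ^ (-(1 + ε))) := by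
  set a := h₁ * k₂ with ha
  set b := h₂ * k₁ with hb
  have ha0 : 0 < a := by positivity
  have hb0 : 0 < b := by positivity
  set g := Nat.gcd a b with hg
  have hg0 : 0 < g := Nat.gcd_pos_of_pos_left _ ha0
  obtain ⟨a', ha'⟩ : g ∣ a := Nat.gcd_dvd_left a b
  obtain ⟨b', hb'⟩ : g ∣ b := Nat.gcd_dvd_right a b
  have ha'0 : 0 < a' := Nat.pos_of_mul_pos_left (ha' ▸ ha0)
  have hb'0 : 0 < b' := Nat.pos_of_mul_pos_left (hb' ▸ hb0)
  have hcop : Nat.Coprime a' b' := by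
    have := Nat.coprime_div_gcd_div_gcd (m := a) (n := b) hg0
    rwa [← hg, ha', hb', Nat.mul_div_cancel_left _ hg0, Nat.mul_div_cancel_left _ hg0] at this
  have hlcm : Nat.lcm a b = a * b' := by
    rw [Nat.lcm, ← hg, Nat.div_eq_of_eq_mul_left hg0]
    rw [hb']; ring
  have e1 : (0 : ℝ) < h₁ := by exact_mod_cast hh₁
  have e2 : (0 : ℝ) < k₁ := by exact_mod_cast hk₁
  have e3 : (0 : ℝ) < h₂ := by exact_mod_cast hh₂
  have e4 : (0 : ℝ) < k₂ := by exact_mod_cast hk₂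
  have hiff : ∀ n m : ℕ, ((h₁ : ℝ) / k₁ * (n + 1) = (h₂ : ℝ) / k₂ * (m + 1)) ↔
      a' * (n + 1) = b' * (m + 1) := by
    intro n m
    have : ((h₁ : ℝ) / k₁ * (n + 1) = (h₂ : ℝ) / k₂ * (m + 1)) ↔
        a * (n + 1) = b * (m + 1) := by
      rw [ha, hb, ← Nat.cast_inj (R := ℝ)]
      push_cast
      rw [div_mul_eq_mul_div, div_mul_eq_mul_div, div_eq_div_iff e2.ne' e4.ne']
      constructor <;> intro h <;> linarith
    rw [this, ha', hb', mul_assoc, mul_assoc]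
    exact Nat.mul_right_inj hg0.ne'
  set φ : ℕ → ℕ × ℕ := fun m => (b' * (m + 1) - 1, a' * (m + 1) - 1) with hφ
  have hφ1 : ∀ m, (φ m).1 + 1 = b' * (m + 1) := fun m =>
    Nat.sub_add_cancel (Nat.mul_pos hb'0 (Nat.succ_pos m))
  have hφ2 : ∀ m, (φ m).2 + 1 = a' * (m + 1) := fun m =>
    Nat.sub_add_cancel (Nat.mul_pos ha'0 (Nat.succ_pos m))
  have hφi : Function.Injective φ := by
    intro m m' h
    have h1 := hφ1 m
    rw [h, hφ1 m'] at h1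
    have := Nat.eq_of_mul_eq_mul_left hb'0 h1
    omega
  rw [← hφi.hasSum_iff]
  · have hs : Summable fun m : ℕ => ((m : ℝ) + 1) ^ (-(1 + ε)) := by
      have := (summable_nat_add_iff 1).2
        (Real.summable_nat_rpow.2 (by linarith : (-(1 + ε) : ℝ) < -1))
      simpa using this
    refine (hs.hasSum.mul_left _).congr_fun fun m => ?_
    have h1 : ((φ m).1 : ℝ) + 1 = b' * ((m : ℝ) + 1) := by exact_mod_cast hφ1 m
    rw [Function.comp_apply, onDiag, if_pos, h1, hlcm,
      ← Real.mul_rpow (by positivity) (by positivity)]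
    · congr 1
      rw [ha]
      push_cast
      field_simp
    · rw [hiff, hφ1, hφ2]
      ring
  · rintro ⟨n, m⟩ hnm
    rw [onDiag, if_neg]
    rw [hiff]
    intro h
    apply hnm
    have hd : b' ∣ n + 1 := (hcop.symm).dvd_of_dvd_mul_left ⟨m + 1, h⟩
    obtain ⟨q, hq⟩ := hd
    have hq0 : 0 < q := Nat.pos_of_ne_zero fun h0 => by rw [h0] at hq; omega
    refine ⟨q - 1, ?_⟩
    have hm : m + 1 = a' * q := by
      rw [hq] at h
      have : b' * (a' * q) = b' * (m + 1) := by rw [← h]; ring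
      exact (Nat.eq_of_mul_eq_mul_left hb'0 this).symm
    simp only [hφ, Nat.sub_add_cancel hq0, ← hq, ← hm, Nat.add_sub_cancel]

lemma sum_range_add_one_rpow_le {ε : ℝ} (hε : 0 < ε) (N : ℕ) :
    ∑ m ∈ Finset.range (N + 1), ((m : ℝ) + 1) ^ (-(1 + ε)) ≤
      1 + (1 - ((N : ℝ) + 1) ^ (-ε)) / ε := by
  induction N with
  | zero => simp
  | succ N ih =>
    rw [Finset.sum_range_succ]
    have hx : (0 : ℝ) < (N : ℝ) + 1 := by positivity
    have hx2 : (0 : ℝ) < (N : ℝ) + 1 + 1 := by positivity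
    have h1 : ((N : ℝ) + 1 + 1) ^ (-ε) * (1 + ε / ((N : ℝ) + 1 + 1)) ≤ ((N : ℝ) + 1) ^ (-ε) := by
      have h2 : 1 + ε / ((N : ℝ) + 1 + 1) ≤ (((N : ℝ) + 1) / ((N : ℝ) + 1 + 1)) ^ (-ε) := by
        rw [Real.rpow_def_of_pos (by positivity)]
        have h3 := Real.log_le_sub_one_of_pos (div_pos hx hx2)
        have h4 : ((N : ℝ) + 1) / ((N : ℝ) + 1 + 1) - 1 = -(1 / ((N : ℝ) + 1 + 1)) := by
          field_simp; ring
        rw [h4] at h3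
        have h5 := Real.add_one_le_exp
          (Real.log (((N : ℝ) + 1) / ((N : ℝ) + 1 + 1)) * -ε)
        have h6 : ε / ((N : ℝ) + 1 + 1) = ε * (1 / ((N : ℝ) + 1 + 1)) := by ring
        rw [h6]
        nlinarith
      rw [Real.div_rpow hx.le hx2.le, le_div_iff₀ (by positivity)] at h2
      linarith
    have h7 : ((N : ℝ) + 1 + 1) ^ (-(1 + ε)) =
        ((N : ℝ) + 1 + 1) ^ (-ε) * (ε / ((N : ℝ) + 1 + 1)) / ε := by
      rw [neg_add, Real.rpow_add hx2, Real.rpow_neg_one]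
      field_simp
    push_cast
    rw [h7]
    have h8 : ((N : ℝ) + 1 + 1) ^ (-ε) * (ε / ((N : ℝ) + 1 + 1)) / ε ≤
        (((N : ℝ) + 1) ^ (-ε) - ((N : ℝ) + 1 + 1) ^ (-ε)) / ε := by
      gcongr
      linarith
    calc _ ≤ 1 + (1 - ((N : ℝ) + 1) ^ (-ε)) / ε +
          (((N : ℝ) + 1) ^ (-ε) - ((N : ℝ) + 1 + 1) ^ (-ε)) / ε := add_le_add ih h8
      _ = _ := by ring

lemma tsum_add_one_rpow_le {ε : ℝ} (hε : 0 < ε) :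
    ∑' m : ℕ, ((m : ℝ) + 1) ^ (-(1 + ε)) ≤ 1 + 1 / ε := by
  refine Real.tsum_le_of_sum_range_le (fun m => by positivity) fun n => ?_
  have h1 := sum_range_add_one_rpow_le hε n
  rw [Finset.sum_range_succ] at h1
  have h2 : (0 : ℝ) ≤ ((n : ℝ) + 1) ^ (-(1 + ε)) := by positivity
  have h3 : (1 - ((n : ℝ) + 1) ^ (-ε)) / ε ≤ 1 / ε := by
    gcongr
    have : (0 : ℝ) ≤ ((n : ℝ) + 1) ^ (-ε) := by positivity
    linarith
  linarith

/-- The quadratic form governing the mollified second moment. -/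
noncomputable def mollForm (ε : ℝ) (B : Finset ℕ) (β : ℕ → ℝ) : ℝ :=
  ∑ p ∈ B ×ˢ B, ∑ q ∈ B ×ˢ B, β p.1 * β p.2 * (β q.1 * β q.2) *
    (((p.2 : ℝ) * q.2) ^ ε / (Nat.lcm (p.1 * q.2) (q.1 * p.2) : ℝ) ^ (1 + ε))

/-- The mollified theta series. -/
noncomputable def mollTheta (α : ℝ) (B : Finset ℕ) (β : ℕ → ℝ) (x : ℝ) : ℂ :=
  ∑ p ∈ B ×ˢ B, ((β p.1 * β p.2 / p.2 : ℝ) : ℂ) * rayTheta α ((p.1 : ℝ) / p.2) x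

section

variable {α : ℝ} {B : Finset ℕ} {β : ℕ → ℝ}

lemma ofReal_norm_sq_mollTheta (x : ℝ) : ((‖mollTheta α B β x‖ ^ 2 : ℝ) : ℂ) =
    ∑ p ∈ B ×ˢ B, ∑ q ∈ B ×ˢ B, (((β p.1 * β p.2 / p.2) * (β q.1 * β q.2 / q.2) : ℝ) : ℂ) *
      (rayTheta α ((p.1 : ℝ) / p.2) x * (starRingEnd ℂ) (rayTheta α ((q.1 : ℝ) / q.2) x)) := by
  have h : ((‖mollTheta α B β x‖ ^ 2 : ℝ) : ℂ) =
      mollTheta α B β x * (starRingEnd ℂ) (mollTheta α B β x) := by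
    rw [Complex.mul_conj']; push_cast; rfl
  rw [h, mollTheta, map_sum, Finset.sum_mul_sum]
  refine Finset.sum_congr rfl fun p _ => Finset.sum_congr rfl fun q _ => ?_
  rw [map_mul, Complex.conj_ofReal]
  push_cast
  ring

lemma div_pos_of_mem (hB : ∀ n ∈ B, 1 ≤ n) {p : ℕ × ℕ} (hp : p ∈ B ×ˢ B) :
    (0 : ℝ) < (p.1 : ℝ) / p.2 := by
  have h1 := hB _ (Finset.mem_product.1 hp).1
  have h2 := hB _ (Finset.mem_product.1 hp).2
  positivity

lemma integrableOn_norm_sq_mollTheta (h : |α| < Real.pi / 2) (hB : ∀ n ∈ B, 1 ≤ n) :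
    IntegrableOn (fun x => ‖mollTheta α B β x‖ ^ 2) (Set.Ioi 1) := by
  have h1 : IntegrableOn (fun x => ((‖mollTheta α B β x‖ ^ 2 : ℝ) : ℂ)) (Set.Ioi 1) := by
    simp_rw [ofReal_norm_sq_mollTheta]
    refine integrable_finsetSum _ fun p hp => integrable_finsetSum _ fun q hq => ?_
    exact (integrableOn_rayTheta_mul h (div_pos_of_mem hB hp) (div_pos_of_mem hB hq)).const_mul _
  exact h1.re

lemma integral_norm_sq_mollTheta (h : |α| < Real.pi / 2) (hB : ∀ n ∈ B, 1 ≤ n) :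
    ∫ x in Set.Ioi (1 : ℝ), ‖mollTheta α B β x‖ ^ 2 =
      ∑ p ∈ B ×ˢ B, ∑ q ∈ B ×ˢ B, (β p.1 * β p.2 / p.2) * (β q.1 * β q.2 / q.2) *
        (∫ x in Set.Ioi (1 : ℝ), rayTheta α ((p.1 : ℝ) / p.2) x *
          (starRingEnd ℂ) (rayTheta α ((q.1 : ℝ) / q.2) x)).re := by
  have h1 : ((∫ x in Set.Ioi (1 : ℝ), ‖mollTheta α B β x‖ ^ 2 : ℝ) : ℂ) =
      ∑ p ∈ B ×ˢ B, ∑ q ∈ B ×ˢ B, (((β p.1 * β p.2 / p.2) * (β q.1 * β q.2 / q.2) : ℝ) : ℂ) *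
        (∫ x in Set.Ioi (1 : ℝ), rayTheta α ((p.1 : ℝ) / p.2) x *
          (starRingEnd ℂ) (rayTheta α ((q.1 : ℝ) / q.2) x)) := by
    rw [← integral_complex_ofReal]
    simp_rw [ofReal_norm_sq_mollTheta]
    have hi : ∀ p ∈ B ×ˢ B, ∀ q ∈ B ×ˢ B, IntegrableOn (fun x =>
        (((β p.1 * β p.2 / p.2) * (β q.1 * β q.2 / q.2) : ℝ) : ℂ) *
        (rayTheta α ((p.1 : ℝ) / p.2) x * (starRingEnd ℂ) (rayTheta α ((q.1 : ℝ) / q.2) x)))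
        (Set.Ioi 1) := fun p hp q hq =>
      (integrableOn_rayTheta_mul h (div_pos_of_mem hB hp) (div_pos_of_mem hB hq)).const_mul _
    rw [integral_finsetSum _ fun p hp => integrable_finsetSum _ fun q hq => hi p hp q hq]
    refine Finset.sum_congr rfl fun p hp => ?_
    rw [integral_finsetSum _ fun q hq => hi p hp q hq]
    exact Finset.sum_congr rfl fun q hq => integral_const_mul _ _
  have h2 := congrArg Complex.re h1
  rw [Complex.ofReal_re, Complex.re_sum] at h2
  rw [h2]
  refine Finset.sum_congr rfl fun p _ => ?_
  rw [Complex.re_sum]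
  exact Finset.sum_congr rfl fun q _ => Complex.re_ofReal_mul _ _

end

lemma exists_integral_norm_sq_mollTheta_le : ∃ C > 0, ∀ (α Y ε : ℝ) (B : Finset ℕ) (β : ℕ → ℝ),
    |α| < Real.pi / 2 → 1 / 2 ≤ Real.sin α → 0 < ε → ε ≤ 1 → (∀ n ∈ B, 1 ≤ n) →
    (∀ n ∈ B, (n : ℝ) ≤ Y) → 1 ≤ Y → (∀ n, |β n| ≤ 1) →
    ∫ x in Set.Ioi (1 : ℝ), ‖mollTheta α B β x‖ ^ 2 ≤
      C * (Y ^ 10 * Real.cos α ^ (-(3 / 8) : ℝ)) + Real.cos α ^ (-((1 + ε) / 2)) *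
        ((∑' m : ℕ, ((m : ℝ) + 1) ^ (-(1 + ε))) * mollForm ε B β) := by
  obtain ⟨C, hC, H⟩ := exists_tsum_norm_offDiag_le
  refine ⟨C, hC, ?_⟩
  intro α Y ε B β h hs hε0 hε1 hB hBY hY hβ
  have hc := cos_pos_of_abs_lt h
  have hY0 : 0 < Y := by linarith
  set Z : ℝ := ∑' m : ℕ, ((m : ℝ) + 1) ^ (-(1 + ε)) with hZ
  set c : ℕ × ℕ → ℝ := fun p => β p.1 * β p.2 / p.2 with hcdef
  set r : ℕ × ℕ → ℝ := fun p => (p.1 : ℝ) / p.2 with hrdef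
  set W : ℕ × ℕ → ℕ × ℕ → ℂ := fun p q => ∫ x in Set.Ioi (1 : ℝ), rayTheta α (r p) x *
    (starRingEnd ℂ) (rayTheta α (r q) x) with hW
  set O : ℕ × ℕ → ℕ × ℕ → ℂ := fun p q => ∑' s, offDiag α (r p) (r q) s with hO
  set E : ℕ × ℕ → ℕ × ℕ → ℝ := fun p q => Real.cos α ^ (-((1 + ε) / 2)) *
    (((Nat.lcm (p.1 * q.2) (q.1 * p.2) : ℝ) / ((p.2 : ℝ) * q.2)) ^ (-(1 + ε)) * Z) with hE
  have hr : ∀ p ∈ B ×ˢ B, 0 < r p := fun p hp => div_pos_of_mem hB hp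
  have m1 : ∀ p ∈ B ×ˢ B, 1 ≤ p.1 := fun p hp => hB _ (Finset.mem_product.1 hp).1
  have m2 : ∀ p ∈ B ×ˢ B, 1 ≤ p.2 := fun p hp => hB _ (Finset.mem_product.1 hp).2
  have m3 : ∀ p ∈ B ×ˢ B, (p.2 : ℝ) ≤ Y := fun p hp => hBY _ (Finset.mem_product.1 hp).2
  have hcle : ∀ p ∈ B ×ˢ B, |c p| ≤ 1 := by
    intro p hp
    have h1 : (1 : ℝ) ≤ p.2 := by exact_mod_cast m2 p hp
    rw [hcdef]
    simp only
    rw [abs_div, abs_mul, abs_of_pos (by linarith : (0 : ℝ) < p.2), div_le_one (by linarith)]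
    exact (mul_le_one₀ (hβ _) (abs_nonneg _) (hβ _)).trans h1
  -- the positive semidefinite comparison on the diagonal
  have hpsd : 0 ≤ ∑ p ∈ B ×ˢ B, ∑ q ∈ B ×ˢ B, c p * c q * (E p q - (W p q - O p q).re) := by
    refine sum_sum_onDiag_nonneg (B ×ˢ B) c r
      (f := fun ρ => Real.cos α ^ (-((1 + ε) / 2)) * ρ ^ (-(1 + ε)) -
        gaussTail (2 * Real.pi * Real.cos α * ρ ^ 2)) hr ?_ ?_
    · intro ρ hρ
      rw [sub_nonneg]
      have hpi := Real.pi_gt_three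
      refine (gaussTail_le_rpow (by positivity) hε0 hε1).trans ?_
      have e : Real.cos α ^ (-((1 + ε) / 2)) * ρ ^ (-(1 + ε)) =
          (Real.cos α * ρ ^ 2) ^ (-((1 + ε) / 2)) := by
        rw [Real.mul_rpow hc.le (by positivity), ← Real.rpow_natCast ρ 2, ← Real.rpow_mul hρ.le]
        congr 2
        push_cast
        ring
      rw [e]
      refine Real.rpow_le_rpow_of_nonpos (by positivity) ?_ (by linarith)
      have : 0 < Real.cos α * ρ ^ 2 := by positivity
      nlinarith
    · intro p hp q hq
      have h1 := (H α p.1 p.2 q.1 q.2 h hs (m1 p hp) (m2 p hp) (m1 q hq) (m2 q hq)).1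
      have h2 := hasSum_onDiag_gaussTail h (hr p hp) (hr q hq) h1
      have h3 : HasSum (fun s => Real.cos α ^ (-((1 + ε) / 2)) *
          onDiag (fun ρ => ρ ^ (-(1 + ε))) (r p) (r q) s) (E p q) :=
        (hasSum_onDiag_rpow hε0 (m1 p hp) (m2 p hp) (m1 q hq) (m2 q hq)).mul_left _
      refine (h3.sub h2).congr_fun fun s => ?_
      rw [onDiag, onDiag, onDiag]
      split_ifs
      · rfl
      · ring
  have hoff : ∑ p ∈ B ×ˢ B, ∑ q ∈ B ×ˢ B, c p * c q * (O p q).re ≤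
      C * (Y ^ 10 * Real.cos α ^ (-(3 / 8) : ℝ)) := by
    have hterm : ∀ p ∈ B ×ˢ B, ∀ q ∈ B ×ˢ B, c p * c q * (O p q).re ≤
        C * (Real.cos α ^ (-(3 / 8) : ℝ) * (Y * Y) ^ 3) := by
      intro p hp q hq
      have h1 := (H α p.1 p.2 q.1 q.2 h hs (m1 p hp) (m2 p hp) (m1 q hq) (m2 q hq)).2
      calc _ ≤ |c p * c q * (O p q).re| := le_abs_self _
        _ ≤ 1 * ‖O p q‖ := by
            rw [abs_mul]
            refine mul_le_mul ?_ (Complex.abs_re_le_norm _) (abs_nonneg _) zero_le_one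
            rw [abs_mul]
            exact mul_le_one₀ (hcle p hp) (abs_nonneg _) (hcle q hq)
        _ ≤ C * (Real.cos α ^ (-(3 / 8) : ℝ) * ((p.2 : ℝ) * q.2) ^ 3) := by rw [one_mul]; exact h1
        _ ≤ _ := by
            have := m3 p hp
            have := m3 q hq
            gcongr
    have hcard : ((B ×ˢ B).card : ℝ) ≤ Y * Y := by
      rw [Finset.card_product, Nat.cast_mul]
      have := card_le_of_forall_le hB hBY hY
      gcongr
    calc _ ≤ ∑ p ∈ B ×ˢ B, ∑ q ∈ B ×ˢ B, C * (Real.cos α ^ (-(3 / 8) : ℝ) * (Y * Y) ^ 3) :=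
          Finset.sum_le_sum fun p hp => Finset.sum_le_sum fun q hq => hterm p hp q hq
      _ = ((B ×ˢ B).card : ℝ) * (((B ×ˢ B).card : ℝ) *
            (C * (Real.cos α ^ (-(3 / 8) : ℝ) * (Y * Y) ^ 3))) := by
          simp only [Finset.sum_const, nsmul_eq_mul]
      _ ≤ (Y * Y) * ((Y * Y) * (C * (Real.cos α ^ (-(3 / 8) : ℝ) * (Y * Y) ^ 3))) := by gcongr
      _ = _ := by ring
  have hdiag : ∑ p ∈ B ×ˢ B, ∑ q ∈ B ×ˢ B, c p * c q * E p q =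
      Real.cos α ^ (-((1 + ε) / 2)) * (Z * mollForm ε B β) := by
    rw [mollForm, Finset.mul_sum, Finset.mul_sum]
    refine Finset.sum_congr rfl fun p hp => ?_
    rw [Finset.mul_sum, Finset.mul_sum]
    refine Finset.sum_congr rfl fun q hq => ?_
    have e1 : (0 : ℝ) < p.2 := by exact_mod_cast m2 p hp
    have e2 : (0 : ℝ) < q.2 := by exact_mod_cast m2 q hq
    have e3 : (0 : ℝ) < Nat.lcm (p.1 * q.2) (q.1 * p.2) := by
      exact_mod_cast Nat.lcm_pos (Nat.mul_pos (m1 p hp) (m2 q hq))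
        (Nat.mul_pos (m1 q hq) (m2 p hp))
    have e4 : 0 < (p.2 : ℝ) * q.2 := by positivity
    rw [hE, hcdef]
    simp only
    rw [Real.div_rpow e3.le e4.le, Real.rpow_neg e3.le, Real.rpow_neg e4.le, Real.rpow_add e4,
      Real.rpow_one]
    field_simp
  rw [integral_norm_sq_mollTheta h hB]
  have hsplit : ∑ p ∈ B ×ˢ B, ∑ q ∈ B ×ˢ B, c p * c q * (W p q).re =
      ∑ p ∈ B ×ˢ B, ∑ q ∈ B ×ˢ B, c p * c q * (O p q).re +
      ∑ p ∈ B ×ˢ B, ∑ q ∈ B ×ˢ B, c p * c q * E p q -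
      ∑ p ∈ B ×ˢ B, ∑ q ∈ B ×ˢ B, c p * c q * (E p q - (W p q - O p q).re) := by
    simp only [← Finset.sum_add_distrib, ← Finset.sum_sub_distrib]
    refine Finset.sum_congr rfl fun p _ => Finset.sum_congr rfl fun q _ => ?_
    rw [Complex.sub_re]
    ring
  change ∑ p ∈ B ×ˢ B, ∑ q ∈ B ×ˢ B, c p * c q * (W p q).re ≤ _
  rw [hsplit, hdiag]
  linarith

lemma mollKer_eq_mollTheta {α : ℝ} {B : Finset ℕ} (hB : ∀ n ∈ B, 1 ≤ n) (β : ℕ → ℝ) (v : ℝ) :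
    mollKer α B β v = (1 / 2) * Complex.exp (Complex.I * α / 4) * (Real.exp (v / 4) : ℝ) *
      (2 * mollTheta α B β (Real.exp (v / 2)) - Complex.exp (-(Complex.I * α / 2)) *
        ((Real.exp (-(v / 2)) * ∑ p ∈ B ×ˢ B, β p.1 * β p.2 / p.1 : ℝ) : ℂ)) := by
  rw [mollKer, mollTheta, ← Finset.sum_product']
  push_cast
  simp only [Finset.mul_sum, ← Finset.sum_sub_distrib]
  refine Finset.sum_congr rfl fun p hp => ?_
  have h1 : (0 : ℝ) < p.1 := by exact_mod_cast hB _ (Finset.mem_product.1 hp).1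
  have h2 : (0 : ℝ) < p.2 := by exact_mod_cast hB _ (Finset.mem_product.1 hp).2
  have e1 : Real.exp (v + 2 * (Real.log p.1 - Real.log p.2)) =
      ((p.1 : ℝ) / p.2) ^ 2 * Real.exp (v / 2) ^ 2 := by
    rw [← Real.log_div h1.ne' h2.ne', two_mul, Real.exp_add, Real.exp_add,
      Real.exp_log (by positivity), ← Real.exp_nat_mul]
    rw [show ((2 : ℕ) : ℝ) * (v / 2) = v by push_cast; ring]
    ring
  have e2 : Real.exp ((v + 2 * (Real.log p.1 - Real.log p.2)) / 4) =
      Real.exp (v / 4) * (√p.1 / √p.2) := by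
    rw [← Real.log_div h1.ne' h2.ne', add_div, Real.exp_add, ← Real.sqrt_div h1.le,
      ← Real.exp_log (Real.sqrt_pos.2 (div_pos h1 h2)), Real.log_sqrt (by positivity)]
    ring_nf
  have e3 : (((p.1 : ℝ) / p.2) ^ 2 * Real.exp (v / 2) ^ 2) ^ (-(1 / 2) : ℝ) =
      Real.exp (-(v / 2)) * (p.2 / p.1) := by
    rw [← mul_pow, Real.rpow_neg (by positivity), ← Real.sqrt_eq_rpow,
      Real.sqrt_sq (by positivity), Real.exp_neg]
    field_simp
  rw [thetaKer, thetaTail, e1, e2, e3, rayTheta]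
  have h3 : (√(p.1 : ℝ) : ℂ) ≠ 0 := by exact_mod_cast (Real.sqrt_pos.2 h1).ne'
  have h4 : (√(p.2 : ℝ) : ℂ) ≠ 0 := by exact_mod_cast (Real.sqrt_pos.2 h2).ne'
  have h5 : (p.1 : ℂ) ≠ 0 := by exact_mod_cast h1.ne'
  have h6 : (p.2 : ℂ) ≠ 0 := by exact_mod_cast h2.ne'
  have h7 : (√(p.2 : ℝ) : ℂ) ^ 2 = p.2 := by exact_mod_cast Real.sq_sqrt h2.le
  push_cast
  rw [← h7]
  field_simp

lemma norm_sq_mollKer_le {α Y : ℝ} {B : Finset ℕ} {β : ℕ → ℝ} (hB : ∀ n ∈ B, 1 ≤ n)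
    (hBY : ∀ n ∈ B, (n : ℝ) ≤ Y) (hY : 1 ≤ Y) (hβ : ∀ n, |β n| ≤ 1) (v : ℝ) :
    ‖mollKer α B β v‖ ^ 2 ≤ 4 * (Real.exp (v / 2) / 2 * ‖mollTheta α B β (Real.exp (v / 2))‖ ^ 2) +
      Y ^ 4 * Real.exp (-(v / 2)) := by
  set S : ℝ := ∑ p ∈ B ×ˢ B, β p.1 * β p.2 / p.1 with hS
  have hSle : |S| ≤ Y ^ 2 := by
    have hcard : ((B ×ˢ B).card : ℝ) ≤ Y ^ 2 := by
      rw [Finset.card_product, Nat.cast_mul, sq]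
      have := card_le_of_forall_le hB hBY hY
      gcongr
    refine le_trans ?_ hcard
    refine (Finset.abs_sum_le_sum_abs _ _).trans ?_
    rw [Finset.card_eq_sum_ones, Nat.cast_sum]
    refine Finset.sum_le_sum fun p hp => ?_
    have h1 : (1 : ℝ) ≤ p.1 := by exact_mod_cast hB _ (Finset.mem_product.1 hp).1
    rw [abs_div, abs_mul, abs_of_pos (by linarith : (0 : ℝ) < p.1), div_le_iff₀ (by linarith)]
    push_cast
    rw [one_mul]
    exact (mul_le_one₀ (hβ _) (abs_nonneg _) (hβ _)).trans h1
  rw [mollKer_eq_mollTheta hB]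
  have n1 : ∀ x : ℝ, ‖Complex.exp (Complex.I * x)‖ = 1 := fun x => by
    rw [mul_comm]; exact Complex.norm_exp_ofReal_mul_I x
  have n2 : ‖Complex.exp (Complex.I * α / 4)‖ = 1 := by
    have := n1 (α / 4); push_cast at this; rwa [mul_div_assoc]
  have n3 : ‖Complex.exp (-(Complex.I * α / 2))‖ = 1 := by
    have := n1 (-(α / 2)); push_cast at this; rwa [mul_div_assoc, ← mul_neg]
  set m := mollTheta α B β (Real.exp (v / 2)) with hm
  have n4 : ‖2 * m - Complex.exp (-(Complex.I * α / 2)) * ((Real.exp (-(v / 2)) * S : ℝ) : ℂ)‖ ≤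
      2 * ‖m‖ + Real.exp (-(v / 2)) * Y ^ 2 := by
    refine (norm_sub_le _ _).trans ?_
    rw [norm_mul, norm_mul, n3, Complex.norm_real, Real.norm_eq_abs, abs_mul,
      abs_of_pos (Real.exp_pos _), Complex.norm_ofNat, one_mul]
    gcongr
  rw [norm_mul, norm_mul, norm_mul, n2, Complex.norm_real, Real.norm_of_nonneg (Real.exp_pos _).le]
  have n5 : ‖(1 / 2 : ℂ)‖ = 1 / 2 := by simp
  rw [n5, mul_pow]
  set e := Real.exp (v / 4) with he
  have he2 : Real.exp (v / 2) = e ^ 2 := by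
    rw [he, ← Real.exp_nat_mul]; congr 1; push_cast; ring
  have he0 : 0 < e := Real.exp_pos _
  have hei : Real.exp (-(v / 2)) = (e ^ 2)⁻¹ := by rw [Real.exp_neg, he2]
  rw [he2, hei]
  rw [hei] at n4
  have n6 := pow_le_pow_left₀ (norm_nonneg _) n4 2
  have n7 : (2 * ‖m‖ + (e ^ 2)⁻¹ * Y ^ 2) ^ 2 ≤ 2 * (2 * ‖m‖) ^ 2 + 2 * ((e ^ 2)⁻¹ * Y ^ 2) ^ 2 := by
    nlinarith [sq_nonneg (2 * ‖m‖ - (e ^ 2)⁻¹ * Y ^ 2)]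
  calc _ ≤ (1 / 2 * 1 * e) ^ 2 * (2 * (2 * ‖m‖) ^ 2 + 2 * ((e ^ 2)⁻¹ * Y ^ 2) ^ 2) :=
        mul_le_mul_of_nonneg_left (n6.trans n7) (sq_nonneg _)
    _ = 4 * (e ^ 2 / 2 * ‖m‖ ^ 2) + 1 / 2 * (Y ^ 4 * (e ^ 2)⁻¹) := by field_simp; ring
    _ ≤ _ := by
        have : 0 ≤ Y ^ 4 * (e ^ 2)⁻¹ := by positivity
        linarith

lemma image_exp_half_Ioi : (fun v : ℝ => Real.exp (v / 2)) '' Set.Ioi 0 = Set.Ioi 1 := by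
  ext x
  constructor
  · rintro ⟨v, hv, rfl⟩
    have hv : 0 < v := hv
    exact Real.one_lt_exp_iff.2 (by linarith)
  · intro hx
    have hx : 1 < x := hx
    refine ⟨2 * Real.log x, mul_pos two_pos (Real.log_pos hx), ?_⟩
    simp only
    rw [mul_div_cancel_left₀ _ two_ne_zero, Real.exp_log (by linarith)]

lemma exists_integral_norm_sq_mollKer_le : ∃ C > 0, ∀ (α Y ε : ℝ) (B : Finset ℕ) (β : ℕ → ℝ),
    |α| < Real.pi / 2 → 1 / 2 ≤ Real.sin α → 0 < ε → ε ≤ 1 → (∀ n ∈ B, 1 ≤ n) →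
    (∀ n ∈ B, (n : ℝ) ≤ Y) → 1 ≤ Y → (∀ n, |β n| ≤ 1) →
    Integrable (fun v => ‖mollKer α B β v‖ ^ 2) ∧
    ∫ v, ‖mollKer α B β v‖ ^ 2 ≤
      C * (Y ^ 10 * Real.cos α ^ (-(3 / 8) : ℝ)) + 8 * (Real.cos α ^ (-((1 + ε) / 2)) *
        ((∑' m : ℕ, ((m : ℝ) + 1) ^ (-(1 + ε))) * mollForm ε B β)) := by
  obtain ⟨C, hC, H⟩ := exists_integral_norm_sq_mollTheta_le
  obtain ⟨C', hC', H'⟩ := exists_norm_mollKer_le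
  refine ⟨8 * C + 4, by positivity, ?_⟩
  intro α Y ε B β h hs hε0 hε1 hB hBY hY hβ
  have hc := cos_pos_of_abs_lt h
  have hY0 : 0 < Y := by linarith
  have hintg : Integrable (fun v => ‖mollKer α B β v‖ ^ 2) := by
    refine Integrable.mono' (integrable_exp_neg_abs_div_four.const_mul
      ((C' * Y ^ 3 * Real.cos α ^ (-(3 / 5) : ℝ)) ^ 2))
      ((continuous_mollKer h B β).norm.pow 2).aestronglyMeasurable
      (Filter.Eventually.of_forall fun v => ?_)
    rw [Real.norm_of_nonneg (sq_nonneg _)]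
    have h1 := pow_le_pow_left₀ (norm_nonneg _) (H' α v Y B β h hB hBY hY hβ) 2
    refine h1.trans ?_
    rw [mul_pow]
    refine mul_le_mul_of_nonneg_left ?_ (sq_nonneg _)
    refine pow_le_of_le_one (Real.exp_pos _).le ?_ two_ne_zero
    rw [Real.exp_le_one_iff]
    have := abs_nonneg v
    linarith
  refine ⟨hintg, ?_⟩
  have heven : ∫ v, ‖mollKer α B β v‖ ^ 2 = 2 * ∫ v in Set.Ioi (0 : ℝ), ‖mollKer α B β v‖ ^ 2 := by
    rw [← integral_comp_abs (f := fun v => ‖mollKer α B β v‖ ^ 2)]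
    refine integral_congr_ae (Filter.Eventually.of_forall fun v => ?_)
    simp only
    rcases abs_choice v with hv | hv
    · rw [hv]
    · rw [hv, mollKer_neg h, Complex.norm_conj]
  have hder : ∀ v ∈ Set.Ioi (0 : ℝ), HasDerivWithinAt (fun v : ℝ => Real.exp (v / 2))
      (Real.exp (v / 2) / 2) (Set.Ioi 0) v := fun v _ => by
    have := ((hasDerivAt_id v).div_const 2).exp
    refine (this.congr_deriv ?_).hasDerivWithinAt
    simp only [id]
    ring
  have hinj : Set.InjOn (fun v : ℝ => Real.exp (v / 2)) (Set.Ioi 0) := by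
    intro a _ b _ hab
    have := Real.exp_injective hab
    linarith
  have hI := integrableOn_norm_sq_mollTheta (β := β) h hB
  rw [← image_exp_half_Ioi, integrableOn_image_iff_integrableOn_abs_deriv_smul measurableSet_Ioi
    hder hinj] at hI
  have hcv := integral_image_eq_integral_abs_deriv_smul measurableSet_Ioi hder hinj
    (fun x => ‖mollTheta α B β x‖ ^ 2)
  rw [image_exp_half_Ioi] at hcv
  simp only [smul_eq_mul, abs_of_pos (half_pos (Real.exp_pos _))] at hI hcv
  have hexp : IntegrableOn (fun v : ℝ => Real.exp (-(v / 2))) (Set.Ioi 0) := by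
    have := integrableOn_exp_mul_Ioi (a := -(1 / 2)) (by norm_num) 0
    refine this.congr_fun (fun v _ => ?_) measurableSet_Ioi
    simp only
    congr 1
    ring
  have hexpv : ∫ v in Set.Ioi (0 : ℝ), Real.exp (-(v / 2)) = 2 := by
    have := integral_exp_mul_Ioi (a := -(1 / 2)) (by norm_num) 0
    rw [show (fun v : ℝ => Real.exp (-(v / 2))) = fun v => Real.exp (-(1 / 2) * v) by
      funext v; congr 1; ring, this]
    norm_num
  have hmain : ∫ v in Set.Ioi (0 : ℝ), ‖mollKer α B β v‖ ^ 2 ≤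
      4 * (∫ x in Set.Ioi (1 : ℝ), ‖mollTheta α B β x‖ ^ 2) +
        Y ^ 4 * ∫ v in Set.Ioi (0 : ℝ), Real.exp (-(v / 2)) := by
    rw [hcv, ← integral_const_mul, ← integral_const_mul,
      ← integral_add (hI.const_mul 4) (hexp.const_mul _)]
    exact setIntegral_mono hintg.integrableOn ((hI.const_mul 4).add (hexp.const_mul _))
      fun v => norm_sq_mollKer_le hB hBY hY hβ v
  have hY4 : Y ^ 4 ≤ Y ^ 10 * Real.cos α ^ (-(3 / 8) : ℝ) := by
    calc Y ^ 4 ≤ Y ^ 10 := pow_le_pow_right₀ hY (by norm_num)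
      _ ≤ _ := le_mul_of_one_le_right (by positivity)
        (Real.one_le_rpow_of_pos_of_le_one_of_nonpos hc (Real.cos_le_one α) (by norm_num))
  have := H α Y ε B β h hs hε0 hε1 hB hBY hY hβ
  rw [heven]
  rw [hexpv] at hmain
  linarith

/-- The multiplicative weight `∏_{p ∣ n} b p`. -/
noncomputable def primeWeight (b : ℕ → ℝ) (n : ℕ) : ℝ := ∏ p ∈ n.primeFactors, b p

/-- A summand of the mollified quadratic form. -/
noncomputable def mollTerm (ε : ℝ) (β : ℕ → ℝ) (h k h' k' : ℕ) : ℝ :=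
  β h * β k * (β h' * β k') *
    (((k : ℝ) * k') ^ ε / (Nat.lcm (h * k') (h' * k) : ℝ) ^ (1 + ε))

/-- The local factor at a prime of the mollified quadratic form. -/
noncomputable def mollLocal (ε b p : ℝ) : ℝ :=
  1 + (2 * (b * (1 + p ^ ε)) + (b * (1 + p ^ ε)) ^ 2) / p ^ (1 + ε) +
    (2 * (b ^ 2 * p ^ ε) + 2 * (b * (1 + p ^ ε)) * (b ^ 2 * p ^ ε) + (b ^ 2 * p ^ ε) ^ 2) /
      (p ^ (1 + ε)) ^ 2

lemma mollForm_eq_sum (ε : ℝ) (B : Finset ℕ) (β : ℕ → ℝ) : mollForm ε B β =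
    ∑ h ∈ B, ∑ k ∈ B, ∑ h' ∈ B, ∑ k' ∈ B, mollTerm ε β h k h' k' := by
  rw [mollForm, Finset.sum_product]
  simp_rw [Finset.sum_product]
  rfl

lemma primeWeight_mul {b : ℕ → ℝ} {p n : ℕ} (hp : p.Prime) (hn : n ≠ 0) (hpn : ¬ p ∣ n) :
    primeWeight b (p * n) = b p * primeWeight b n := by
  rw [primeWeight, Nat.primeFactors_mul hp.ne_zero hn, hp.primeFactors, primeWeight,
    Finset.prod_union, Finset.prod_singleton]
  rw [Finset.disjoint_singleton_left]
  exact fun h => hpn (Nat.dvd_of_mem_primeFactors h)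

lemma sum_divisors_prime_mul {p D : ℕ} (hp : p.Prime) (hD : D ≠ 0) (hpD : ¬ p ∣ D) (f : ℕ → ℝ) :
    ∑ n ∈ (p * D).divisors, f n = ∑ n ∈ D.divisors, (f n + f (p * n)) := by
  have hcop : Nat.Coprime p D := (Nat.Prime.coprime_iff_not_dvd hp).2 hpD
  have h : (p * D).divisors = D.divisors ∪ D.divisors.image (p * ·) := by
    ext n
    simp only [Finset.mem_union, Finset.mem_image, Nat.mem_divisors]
    constructor
    · rintro ⟨h1, -⟩
      by_cases hpn : p ∣ n
      · obtain ⟨m, rfl⟩ := hpn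
        exact Or.inr ⟨m, ⟨Nat.dvd_of_mul_dvd_mul_left hp.pos h1, hD⟩, rfl⟩
      · exact Or.inl ⟨((Nat.Prime.coprime_iff_not_dvd hp).2 hpn).symm.dvd_of_dvd_mul_left h1, hD⟩
    · rintro (⟨h1, -⟩ | ⟨m, ⟨h1, -⟩, rfl⟩)
      · exact ⟨h1.mul_left p, mul_ne_zero hp.ne_zero hD⟩
      · exact ⟨mul_dvd_mul_left p h1, mul_ne_zero hp.ne_zero hD⟩
  rw [h, Finset.sum_union, Finset.sum_image, Finset.sum_add_distrib]
  · intro a _ b _ hab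
    exact Nat.eq_of_mul_eq_mul_left hp.pos hab
  · rw [Finset.disjoint_left]
    intro n hn hn'
    obtain ⟨m, -, rfl⟩ := Finset.mem_image.1 hn'
    exact hpD ((dvd_mul_right p m).trans (Nat.dvd_of_mem_divisors hn))

lemma lcm_pow_mul_of_le {p m m' x y : ℕ} (hp : p.Prime) (hm : ¬ p ∣ m) (hxy : x ≤ y) :
    Nat.lcm (p ^ x * m) (p ^ y * m') = p ^ y * Nat.lcm m m' := by
  obtain ⟨z, rfl⟩ := Nat.exists_eq_add_of_le hxy
  rw [pow_add, mul_assoc, Nat.lcm_mul_left, mul_assoc]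
  congr 1
  have hc : Nat.Coprime (p ^ z) m := Nat.Coprime.pow_left _ ((Nat.Prime.coprime_iff_not_dvd hp).2 hm)
  rw [Nat.lcm, hc.gcd_mul_left_cancel_right, Nat.lcm, ← Nat.mul_div_assoc]
  · congr 1; ring
  · exact (Nat.gcd_dvd_left m m').mul_right m'

lemma lcm_pow_mul {p m m' : ℕ} (x y : ℕ) (hp : p.Prime) (hm : ¬ p ∣ m) (hm' : ¬ p ∣ m') :
    Nat.lcm (p ^ x * m) (p ^ y * m') = p ^ (max x y) * Nat.lcm m m' := by
  rcases le_total x y with h | h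
  · rw [max_eq_right h, lcm_pow_mul_of_le hp hm h]
  · rw [max_eq_left h, Nat.lcm_comm, lcm_pow_mul_of_le hp hm' h, Nat.lcm_comm]

lemma mollTerm_pow_mul {ε : ℝ} {b : ℕ → ℝ} {p : ℕ} (hp : p.Prime) {a₁ a₂ a₃ a₄ : ℕ} (ha₁ : a₁ ≤ 1)
    (ha₂ : a₂ ≤ 1) (ha₃ : a₃ ≤ 1) (ha₄ : a₄ ≤ 1) {h k h' k' : ℕ}
    (h1 : ¬ p ∣ h) (h2 : ¬ p ∣ k) (h3 : ¬ p ∣ h') (h4 : ¬ p ∣ k') :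
    mollTerm ε (primeWeight b) (p ^ a₁ * h) (p ^ a₂ * k) (p ^ a₃ * h') (p ^ a₄ * k') =
      b p ^ (a₁ + a₂ + a₃ + a₄) * (((p : ℝ) ^ ε) ^ (a₂ + a₄) /
        ((p : ℝ) ^ (1 + ε)) ^ (max (a₁ + a₄) (a₃ + a₂))) *
        mollTerm ε (primeWeight b) h k h' k' := by
  have hw : ∀ {a n : ℕ}, a ≤ 1 → ¬ p ∣ n → primeWeight b (p ^ a * n) =
      b p ^ a * primeWeight b n := by
    intro a n ha hn
    interval_cases a
    · simp
    · rw [pow_one, pow_one, primeWeight_mul hp (by rintro rfl; exact hn (dvd_zero p)) hn]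
  have hp0 : (0 : ℝ) ≤ p := Nat.cast_nonneg p
  have hpw : ∀ (n : ℕ) (x : ℝ), ((p : ℝ) ^ n) ^ x = ((p : ℝ) ^ x) ^ n := fun n x => by
    rw [← Real.rpow_natCast, ← Real.rpow_natCast, ← Real.rpow_mul hp0, ← Real.rpow_mul hp0,
      mul_comm]
  rw [mollTerm, mollTerm, hw ha₁ h1, hw ha₂ h2, hw ha₃ h3, hw ha₄ h4,
    show p ^ a₁ * h * (p ^ a₄ * k') = p ^ (a₁ + a₄) * (h * k') by ring,
    show p ^ a₃ * h' * (p ^ a₂ * k) = p ^ (a₃ + a₂) * (h' * k) by ring,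
    lcm_pow_mul _ _ hp (hp.not_dvd_mul h1 h4) (hp.not_dvd_mul h3 h2)]
  push_cast
  rw [show (p : ℝ) ^ a₂ * k * ((p : ℝ) ^ a₄ * k') = (p : ℝ) ^ (a₂ + a₄) * (k * k') by ring,
    Real.mul_rpow (x := (p : ℝ) ^ (a₂ + a₄)) (by positivity) (by positivity),
    Real.mul_rpow (x := (p : ℝ) ^ (max (a₁ + a₄) (a₃ + a₂))) (by positivity) (by positivity),
    hpw, hpw, mul_div_mul_comm]
  ring

lemma mollForm_divisors_prime_mul {ε : ℝ} {b : ℕ → ℝ} {p D : ℕ} (hp : p.Prime) (hD : D ≠ 0)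
    (hpD : ¬ p ∣ D) : mollForm ε (p * D).divisors (primeWeight b) =
      mollLocal ε (b p) p * mollForm ε D.divisors (primeWeight b) := by
  rw [mollForm_eq_sum, mollForm_eq_sum]
  simp only [sum_divisors_prime_mul hp hD hpD, ← Finset.sum_add_distrib, Finset.mul_sum]
  refine Finset.sum_congr rfl fun h hh => Finset.sum_congr rfl fun k hk =>
    Finset.sum_congr rfl fun h' hh' => Finset.sum_congr rfl fun k' hk' => ?_
  have hnd : ∀ {n}, n ∈ D.divisors → ¬ p ∣ n := fun hn hpn =>
    hpD (hpn.trans (Nat.dvd_of_mem_divisors hn))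
  have key := fun (a₁ a₂ a₃ a₄ : ℕ) (ha₁ : a₁ ≤ 1) (ha₂ : a₂ ≤ 1) (ha₃ : a₃ ≤ 1) (ha₄ : a₄ ≤ 1) =>
    mollTerm_pow_mul (ε := ε) (b := b) hp ha₁ ha₂ ha₃ ha₄ (hnd hh) (hnd hk) (hnd hh') (hnd hk')
  have k0001 := key 0 0 0 1 (by simp) (by simp) (by simp) (by simp)
  have k0010 := key 0 0 1 0 (by simp) (by simp) (by simp) (by simp)
  have k0011 := key 0 0 1 1 (by simp) (by simp) (by simp) (by simp)
  have k0100 := key 0 1 0 0 (by simp) (by simp) (by simp) (by simp)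
  have k0101 := key 0 1 0 1 (by simp) (by simp) (by simp) (by simp)
  have k0110 := key 0 1 1 0 (by simp) (by simp) (by simp) (by simp)
  have k0111 := key 0 1 1 1 (by simp) (by simp) (by simp) (by simp)
  have k1000 := key 1 0 0 0 (by simp) (by simp) (by simp) (by simp)
  have k1001 := key 1 0 0 1 (by simp) (by simp) (by simp) (by simp)
  have k1010 := key 1 0 1 0 (by simp) (by simp) (by simp) (by simp)
  have k1011 := key 1 0 1 1 (by simp) (by simp) (by simp) (by simp)
  have k1100 := key 1 1 0 0 (by simp) (by simp) (by simp) (by simp)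
  have k1101 := key 1 1 0 1 (by simp) (by simp) (by simp) (by simp)
  have k1110 := key 1 1 1 0 (by simp) (by simp) (by simp) (by simp)
  have k1111 := key 1 1 1 1 (by simp) (by simp) (by simp) (by simp)
  norm_num at k0001 k0010 k0011 k0100 k0101 k0110 k0111 k1000 k1001 k1010 k1011 k1100 k1101
  norm_num at k1110
  norm_num at k1111
  rw [k0001, k0010, k0011, k0100, k0101, k0110, k0111, k1000, k1001, k1010, k1011, k1100, k1101,
    k1110, k1111, mollLocal]
  ring

lemma mollForm_divisors_prod {ε : ℝ} {b : ℕ → ℝ} (P : Finset ℕ) (hP : ∀ p ∈ P, p.Prime) :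
    mollForm ε (∏ p ∈ P, p).divisors (primeWeight b) = ∏ p ∈ P, mollLocal ε (b p) p := by
  induction P using Finset.induction_on with
  | empty =>
    rw [mollForm_eq_sum]
    simp [mollTerm, primeWeight]
  | insert p P hpP ih =>
    have hpp := hP p (Finset.mem_insert_self p P)
    have hP' : ∀ q ∈ P, q.Prime := fun q hq => hP q (Finset.mem_insert_of_mem hq)
    rw [Finset.prod_insert hpP, Finset.prod_insert hpP, mollForm_divisors_prime_mul hpp, ih hP']
    · exact Finset.prod_ne_zero_iff.2 fun q hq => (hP' q hq).ne_zero
    · intro hd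
      obtain ⟨q, hq, hpq⟩ := (hpp.prime.dvd_finsetProd_iff _).1 hd
      exact hpP ((Nat.prime_dvd_prime_iff_eq hpp (hP' q hq)).1 hpq ▸ hq)

lemma primeWeight_mul_rpow {b : ℕ → ℝ} {η : ℝ} {n : ℕ} (hn : Squarefree n) :
    primeWeight (fun p => |b p| * (p : ℝ) ^ η) n = |primeWeight b n| * (n : ℝ) ^ η := by
  rw [primeWeight, Finset.prod_mul_distrib, primeWeight, Finset.abs_prod]
  congr 1
  rw [Real.finsetProd_rpow _ _ fun p _ => Nat.cast_nonneg p]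
  congr 1
  rw [← Nat.cast_prod, Nat.prod_primeFactors_of_squarefree hn]

lemma squarefree_prod_of_primes {P : Finset ℕ} (hP : ∀ p ∈ P, p.Prime) :
    Squarefree (∏ p ∈ P, p) := by
  refine Finset.squarefree_prod_of_pairwise_isCoprime ?_ fun p hp => (hP p hp).prime.squarefree
  intro p hp q hq hpq
  exact Nat.coprime_iff_isRelPrime.1 ((Nat.coprime_primes (hP p hp) (hP q hq)).2 hpq)

lemma mollForm_filter_le {ε η Y : ℝ} {b : ℕ → ℝ} {B : Finset ℕ} (hB : ∀ n ∈ B, 1 ≤ n)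
    (hsq : ∀ n ∈ B, Squarefree n) (hY : 0 < Y) (hη : 0 ≤ η) :
    mollForm ε (B.filter fun n : ℕ => (n : ℝ) ≤ Y) (primeWeight b) ≤
      mollForm ε B (primeWeight b) +
        Y ^ (-η) * mollForm ε B (primeWeight fun p => |b p| * (p : ℝ) ^ η) := by
  set B' : Finset ℕ := B.filter fun n : ℕ => (n : ℝ) ≤ Y with hB'
  have hsum : ∀ (A : Finset ℕ) (β : ℕ → ℝ), mollForm ε A β =
      ∑ x ∈ (A ×ˢ A) ×ˢ (A ×ˢ A), mollTerm ε β x.1.1 x.1.2 x.2.1 x.2.2 := by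
    intro A β
    rw [Finset.sum_product]
    rfl
  set J := (B ×ˢ B) ×ˢ (B ×ˢ B) with hJ
  set J' := (B' ×ˢ B') ×ˢ (B' ×ˢ B') with hJ'
  have hsub : J' ⊆ J := by
    have h1 : B' ⊆ B := Finset.filter_subset _ _
    exact Finset.product_subset_product (Finset.product_subset_product h1 h1)
      (Finset.product_subset_product h1 h1)
  rw [hsum, hsum, hsum, ← Finset.sum_sdiff hsub, Finset.mul_sum]
  set t : (ℕ × ℕ) × (ℕ × ℕ) → ℝ :=
    fun x => mollTerm ε (primeWeight b) x.1.1 x.1.2 x.2.1 x.2.2 with ht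
  set u : (ℕ × ℕ) × (ℕ × ℕ) → ℝ := fun x =>
    mollTerm ε (primeWeight fun p => |b p| * (p : ℝ) ^ η) x.1.1 x.1.2 x.2.1 x.2.2 with hu
  have hut : ∀ x ∈ J, u x =
      |t x| * ((x.1.1 : ℝ) * x.1.2 * x.2.1 * x.2.2) ^ η := by
    intro x hx
    obtain ⟨hx1, hx2⟩ := Finset.mem_product.1 hx
    obtain ⟨h1, h2⟩ := Finset.mem_product.1 hx1
    obtain ⟨h3, h4⟩ := Finset.mem_product.1 hx2
    rw [hu, ht]
    simp only [mollTerm]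
    have hR : 0 ≤ ((x.1.2 : ℝ) * x.2.2) ^ ε /
      (Nat.lcm (x.1.1 * x.2.2) (x.2.1 * x.1.2) : ℝ) ^ (1 + ε) := by positivity
    rw [primeWeight_mul_rpow (hsq _ h1), primeWeight_mul_rpow (hsq _ h2),
      primeWeight_mul_rpow (hsq _ h3), primeWeight_mul_rpow (hsq _ h4), abs_mul, abs_of_nonneg hR,
      Real.mul_rpow (z := η) (by positivity) (by positivity),
      Real.mul_rpow (z := η) (by positivity) (by positivity),
      Real.mul_rpow (z := η) (by positivity) (by positivity)]
    simp only [abs_mul]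
    ring
  have hu0 : ∀ x ∈ J, 0 ≤ Y ^ (-η) * u x := fun x hx => by
    rw [hut x hx]; positivity
  have hbig : ∀ x ∈ J \ J', -t x ≤ Y ^ (-η) * u x := by
    intro x hx
    obtain ⟨hxJ, hxJ'⟩ := Finset.mem_sdiff.1 hx
    rw [hut x hxJ]
    obtain ⟨hx1, hx2⟩ := Finset.mem_product.1 hxJ
    obtain ⟨h1, h2⟩ := Finset.mem_product.1 hx1
    obtain ⟨h3, h4⟩ := Finset.mem_product.1 hx2
    have g1 : (1 : ℝ) ≤ x.1.1 := by exact_mod_cast hB _ h1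
    have g2 : (1 : ℝ) ≤ x.1.2 := by exact_mod_cast hB _ h2
    have g3 : (1 : ℝ) ≤ x.2.1 := by exact_mod_cast hB _ h3
    have g4 : (1 : ℝ) ≤ x.2.2 := by exact_mod_cast hB _ h4
    have hYle : Y ≤ (x.1.1 : ℝ) * x.1.2 * x.2.1 * x.2.2 := by
      by_contra hlt
      push Not at hlt
      apply hxJ'
      have g12 := one_le_mul_of_one_le_of_one_le g1 g2
      have g123 := one_le_mul_of_one_le_of_one_le g12 g3
      have l4 : (x.2.2 : ℝ) ≤ Y := (le_mul_of_one_le_left (by linarith) g123).trans hlt.le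
      have l123 := (le_mul_of_one_le_right (by linarith : (0 : ℝ) ≤
        (x.1.1 : ℝ) * x.1.2 * x.2.1) g4).trans hlt.le
      have l3 : (x.2.1 : ℝ) ≤ Y := (le_mul_of_one_le_left (by linarith) g12).trans l123
      have l12 := (le_mul_of_one_le_right (by linarith : (0 : ℝ) ≤
        (x.1.1 : ℝ) * x.1.2) g3).trans l123
      have l2 : (x.1.2 : ℝ) ≤ Y := (le_mul_of_one_le_left (by linarith) g1).trans l12
      have l1 : (x.1.1 : ℝ) ≤ Y := (le_mul_of_one_le_right (by linarith) g2).trans l12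
      simp only [hJ', hB', Finset.mem_product, Finset.mem_filter]
      exact ⟨⟨⟨h1, l1⟩, ⟨h2, l2⟩⟩, ⟨⟨h3, l3⟩, ⟨h4, l4⟩⟩⟩
    have h5 : 1 ≤ Y ^ (-η) * ((x.1.1 : ℝ) * x.1.2 * x.2.1 * x.2.2) ^ η := by
      rw [Real.rpow_neg hY.le, inv_mul_eq_div, one_le_div (by positivity)]
      exact Real.rpow_le_rpow hY.le hYle hη
    calc -t x ≤ |t x| := neg_le_abs _
      _ ≤ |t x| * (Y ^ (-η) * ((x.1.1 : ℝ) * x.1.2 * x.2.1 * x.2.2) ^ η) :=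
          le_mul_of_one_le_right (abs_nonneg _) h5
      _ = _ := by ring
  have hA : -∑ x ∈ J \ J', t x ≤ ∑ x ∈ J, Y ^ (-η) * u x := by
    rw [← Finset.sum_neg_distrib]
    exact (Finset.sum_le_sum hbig).trans
      (Finset.sum_le_sum_of_subset_of_nonneg Finset.sdiff_subset fun x hx _ => hu0 x hx)
  linarith

lemma hasSum_indicator_smoothNumbers {σ : ℝ} (hσ : 0 < σ) (N : ℕ) :
    HasSum ((Nat.smoothNumbers N).indicator fun n : ℕ => (n : ℝ) ^ (-σ))
      (∏ p ∈ N.primesBelow, (1 - (p : ℝ) ^ (-σ))⁻¹) := by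
  have H := (EulerProduct.summable_and_hasSum_smoothNumbers_prod_primesBelow_geometric
    (f := ({ toFun := fun n : ℕ => (n : ℝ) ^ (-σ)
             map_one' := by simp
             map_mul' := fun a b => by
              push_cast
              exact Real.mul_rpow (by positivity) (by positivity) } : ℕ →* ℝ))
    (fun {p} hp => by
      change ‖(p : ℝ) ^ (-σ)‖ < 1
      rw [Real.norm_of_nonneg (by positivity)]
      exact Real.rpow_lt_one_of_one_lt_of_neg (by exact_mod_cast hp.one_lt) (by linarith)) N).2
  exact hasSum_subtype_iff_indicator.1 H

lemma log_le_prod_primesBelow {N : ℕ} (hN : 1 ≤ N) :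
    Real.log N ≤ ∏ p ∈ N.primesBelow, (1 - (p : ℝ)⁻¹)⁻¹ := by
  have H := hasSum_indicator_smoothNumbers one_pos N
  simp only [Real.rpow_neg_one] at H
  have h1 := sum_le_hasSum (Finset.Icc 1 (N - 1)) (fun n _ => Set.indicator_nonneg
    (fun m _ => by positivity) n) H
  refine le_trans ?_ h1
  have h2 : ∑ n ∈ Finset.Icc 1 (N - 1),
      (Nat.smoothNumbers N).indicator (fun n : ℕ => (n : ℝ)⁻¹) n =
      ((harmonic (N - 1) : ℚ) : ℝ) := by
    rw [harmonic_eq_sum_Icc]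
    push_cast
    refine Finset.sum_congr rfl fun n hn => ?_
    rw [Finset.mem_Icc] at hn
    exact Set.indicator_of_mem (Nat.mem_smoothNumbers_of_lt (by lia) (by lia)) _
  rw [h2]
  have h3 := log_add_one_le_harmonic (N - 1)
  rwa [Nat.sub_add_cancel hN] at h3

lemma prod_primesBelow_rpow_le {N : ℕ} {η : ℝ} (hη : 0 < η) :
    ∏ p ∈ N.primesBelow, (1 - (p : ℝ) ^ (-(1 + η)))⁻¹ ≤ 1 + 1 / η := by
  have H := hasSum_indicator_smoothNumbers (by linarith : 0 < 1 + η) N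
  have hs : Summable fun n : ℕ => (n : ℝ) ^ (-(1 + η)) :=
    Real.summable_nat_rpow.2 (by linarith)
  rw [← H.tsum_eq]
  refine (H.summable.tsum_le_tsum (fun n => Set.indicator_le_self' (fun _ _ => by positivity) n)
    hs).trans ?_
  rw [hs.tsum_eq_zero_add, Nat.cast_zero, Real.zero_rpow (by linarith), zero_add]
  exact_mod_cast tsum_add_one_rpow_le hη

lemma one_sub_inv_rpow_le {p ε : ℝ} (hp : 0 < p) : 1 - (p ^ ε)⁻¹ ≤ ε * Real.log p := by
  have := Real.one_sub_inv_le_log_of_pos (Real.rpow_pos_of_pos hp ε)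
  rwa [Real.log_rpow hp] at this

lemma mollLocal_neg_half {ε p : ℝ} (hp : 0 < p) : mollLocal ε (-1 / 2) p =
    1 + (((p ^ ε - 1) / 2) ^ 2 - 1) / (p * p ^ ε) +
      (p ^ ε / 4 - 3 * (p ^ ε) ^ 2 / 16) / (p * p ^ ε) ^ 2 := by
  rw [mollLocal, Real.rpow_add hp, Real.rpow_one]
  ring

lemma mollLocal_neg_half_nonneg {ε p : ℝ} (hp : 2 ≤ p) (hε : 0 ≤ ε) :
    0 ≤ mollLocal ε (-1 / 2) p := by
  rw [mollLocal_neg_half (by linarith)]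
  have he : 1 ≤ p ^ ε := Real.one_le_rpow (by linarith) hε
  set e := p ^ ε
  have hq : 2 ≤ p * e := by nlinarith
  have h1 : -(1 / 2) ≤ (((e - 1) / 2) ^ 2 - 1) / (p * e) := by
    rw [le_div_iff₀ (by linarith)]
    nlinarith [sq_nonneg ((e - 1) / 2)]
  have h2 : -(1 / 2) ≤ (e / 4 - 3 * e ^ 2 / 16) / (p * e) ^ 2 := by
    rw [le_div_iff₀ (by positivity)]
    have : 4 ≤ p ^ 2 := by nlinarith
    have : 4 * e ^ 2 ≤ (p * e) ^ 2 := by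
      rw [mul_pow]; exact mul_le_mul_of_nonneg_right this (sq_nonneg e)
    nlinarith
  linarith

lemma mollLocal_neg_half_le {ε p : ℝ} (hp : 2 ≤ p) (hε : 0 ≤ ε) (he3 : p ^ ε ≤ 3) :
    mollLocal ε (-1 / 2) p ≤
      (1 - p⁻¹) * Real.exp (4 * (ε * Real.log p) * p⁻¹ + 2 * (p ^ 2)⁻¹) := by
  have hlog := one_sub_inv_rpow_le (ε := ε) (by linarith : 0 < p)
  rw [mollLocal_neg_half (by linarith)]
  have he : 1 ≤ p ^ ε := Real.one_le_rpow (by linarith) hε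
  set e := p ^ ε
  have hp0 : 0 < p := by linarith
  have hpi : p⁻¹ ≤ 1 / 2 := by
    rw [inv_le_comm₀ hp0 (by norm_num)]; linarith
  have hpi0 : 0 < p⁻¹ := by positivity
  have hei : 0 ≤ 1 - e⁻¹ := by
    rw [sub_nonneg]; exact inv_le_one_of_one_le₀ he
  have h1 : (((e - 1) / 2) ^ 2 - 1) / (p * e) =
      -p⁻¹ + (1 - e⁻¹) * (1 + (e - 1) / 4) * p⁻¹ := by
    field_simp
    ring
  have h2 : (e / 4 - 3 * e ^ 2 / 16) / (p * e) ^ 2 ≤ (p ^ 2)⁻¹ := by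
    rw [div_le_iff₀ (by positivity)]
    have : (p ^ 2)⁻¹ * (p * e) ^ 2 = e ^ 2 := by field_simp
    rw [this]
    nlinarith
  have h3 : (1 - e⁻¹) * (1 + (e - 1) / 4) * p⁻¹ ≤ 2 * (ε * Real.log p) * p⁻¹ := by
    refine mul_le_mul_of_nonneg_right ?_ hpi0.le
    have : (1 - e⁻¹) * (1 + (e - 1) / 4) ≤ (1 - e⁻¹) * 2 :=
      mul_le_mul_of_nonneg_left (by linarith) hei
    linarith
  set g := 2 * (ε * Real.log p) * p⁻¹ + (p ^ 2)⁻¹ with hg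
  have hg0 : 0 ≤ g := by
    have := Real.log_nonneg (by linarith : 1 ≤ p)
    positivity
  have h4 : 4 * (ε * Real.log p) * p⁻¹ + 2 * (p ^ 2)⁻¹ = 2 * g := by rw [hg]; ring
  rw [h4, h1]
  have h5 : 1 - p⁻¹ + g ≤ (1 - p⁻¹) * (2 * g + 1) := by
    have : (1 / 2) * g ≤ (1 - p⁻¹) * g := mul_le_mul_of_nonneg_right (by linarith) hg0
    linarith
  have h6 := mul_le_mul_of_nonneg_left (Real.add_one_le_exp (2 * g))
    (by linarith : 0 ≤ 1 - p⁻¹)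
  linarith

lemma sum_primesBelow_inv_le (N : ℕ) :
    ∑ p ∈ N.primesBelow, ((p : ℝ))⁻¹ ≤ 1 + Real.log N := by
  have h1 := harmonic_le_one_add_log N
  refine le_trans ?_ h1
  rw [harmonic_eq_sum_Icc]
  push_cast
  refine Finset.sum_le_sum_of_subset_of_nonneg ?_ fun _ _ _ => by positivity
  intro p hp
  rw [Finset.mem_Icc]
  exact ⟨(Nat.prime_of_mem_primesBelow hp).one_le, (Nat.lt_of_mem_primesBelow hp).le⟩

lemma sum_primesBelow_sq_inv_le (N : ℕ) :
    ∑ p ∈ N.primesBelow, ((p : ℝ) ^ 2)⁻¹ ≤ 2 := by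
  have hs : Summable fun n : ℕ => ((n : ℝ) ^ 2)⁻¹ := Real.summable_nat_pow_inv.2 (by norm_num)
  have h1 := hs.sum_le_tsum N.primesBelow (fun _ _ => by positivity)
  refine h1.trans ?_
  rw [hs.tsum_eq_zero_add]
  have h2 := tsum_add_one_rpow_le one_pos
  have h3 : ∀ m : ℕ, ((m : ℝ) + 1) ^ (-(1 + 1) : ℝ) = (((m + 1 : ℕ) : ℝ) ^ 2)⁻¹ := fun m => by
    rw [Real.rpow_neg (by positivity)]
    norm_num
  simp_rw [h3] at h2
  norm_num at h2 ⊢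
  exact h2

lemma rpow_le_three_of_mem_primesBelow {N p : ℕ} {ε : ℝ}
    (hp : p ∈ N.primesBelow) (hε : 0 ≤ ε) (h : ε * Real.log N ≤ 1) : (p : ℝ) ^ ε ≤ 3 := by
  have hp0 : (0 : ℝ) < p := by exact_mod_cast (Nat.prime_of_mem_primesBelow hp).pos
  have hpN : (p : ℝ) ≤ N := by exact_mod_cast (Nat.lt_of_mem_primesBelow hp).le
  rw [Real.rpow_def_of_pos hp0]
  have h1 : Real.log p * ε ≤ 1 := by
    have := mul_le_mul_of_nonneg_left (Real.log_le_log hp0 hpN) hε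
    linarith
  exact (Real.exp_le_exp.2 h1).trans (by linarith [Real.exp_one_lt_d9])

lemma prod_mollLocal_neg_half_le {N : ℕ} {ε : ℝ} (hN1 : 1 ≤ N) (hN : 1 ≤ Real.log N) (hε : 0 ≤ ε)
    (h : ε * Real.log N ^ 2 ≤ 1) :
    ∏ p ∈ N.primesBelow, mollLocal ε (-1 / 2) p ≤ Real.exp 12 / Real.log N := by
  have hεl : ε * Real.log N ≤ 1 := by nlinarith
  have h2 : ∀ p ∈ N.primesBelow, (2 : ℝ) ≤ p := fun p hp => by
    exact_mod_cast (Nat.prime_of_mem_primesBelow hp).two_le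
  calc ∏ p ∈ N.primesBelow, mollLocal ε (-1 / 2) p
      ≤ ∏ p ∈ N.primesBelow, ((1 - (p : ℝ)⁻¹) *
          Real.exp (4 * (ε * Real.log p) * (p : ℝ)⁻¹ + 2 * ((p : ℝ) ^ 2)⁻¹)) :=
        Finset.prod_le_prod (fun p hp => mollLocal_neg_half_nonneg (h2 p hp) hε) fun p hp =>
          mollLocal_neg_half_le (h2 p hp) hε (rpow_le_three_of_mem_primesBelow hp hε hεl)
    _ = (∏ p ∈ N.primesBelow, (1 - (p : ℝ)⁻¹)⁻¹)⁻¹ * Real.exp (∑ p ∈ N.primesBelow,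
          (4 * (ε * Real.log p) * (p : ℝ)⁻¹ + 2 * ((p : ℝ) ^ 2)⁻¹)) := by
        rw [Finset.prod_mul_distrib, Real.exp_sum, Finset.prod_inv_distrib, inv_inv]
    _ ≤ (Real.log N)⁻¹ * Real.exp 12 := by
        refine mul_le_mul (inv_anti₀ (by linarith) (log_le_prod_primesBelow hN1))
          (Real.exp_le_exp.2 ?_) (Real.exp_pos _).le (by positivity)
        rw [Finset.sum_add_distrib, ← Finset.mul_sum]
        have h3 : ∑ p ∈ N.primesBelow, 4 * (ε * Real.log p) * (p : ℝ)⁻¹ ≤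
            4 * (ε * Real.log N) * ∑ p ∈ N.primesBelow, (p : ℝ)⁻¹ := by
          rw [Finset.mul_sum]
          refine Finset.sum_le_sum fun p hp => ?_
          have hpN : (p : ℝ) ≤ N := by exact_mod_cast (Nat.lt_of_mem_primesBelow hp).le
          have := Real.log_le_log (by linarith [h2 p hp] : (0 : ℝ) < p) hpN
          gcongr
        have h4 : 4 * (ε * Real.log N) * ∑ p ∈ N.primesBelow, (p : ℝ)⁻¹ ≤
            4 * (ε * Real.log N) * (1 + Real.log N) :=
          mul_le_mul_of_nonneg_left (sum_primesBelow_inv_le N) (by positivity)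
        have h5 := sum_primesBelow_sq_inv_le N
        nlinarith
    _ = Real.exp 12 / Real.log N := by rw [mul_comm, div_eq_mul_inv]

lemma mollLocal_le_of_le {ε c p : ℝ} (hp : 2 ≤ p) (hε : 0 ≤ ε) (he3 : p ^ ε ≤ 3) (hc : 0 ≤ c)
    (hc' : c ≤ 3 / 2) : mollLocal ε c p ≤ 1 + 200 * p⁻¹ := by
  have hp0 : 0 < p := by linarith
  rw [mollLocal, Real.rpow_add hp0, Real.rpow_one]
  have he : 1 ≤ p ^ ε := Real.one_le_rpow (by linarith) hε
  set e := p ^ ε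
  have hq : p ≤ p * e := le_mul_of_one_le_right hp0.le he
  have hq2 : p ≤ (p * e) ^ 2 := by nlinarith
  have hu : c * (1 + e) ≤ 6 := by nlinarith
  have hu0 : 0 ≤ c * (1 + e) := by positivity
  have hv : c ^ 2 * e ≤ 27 / 4 := by
    have : c ^ 2 ≤ 9 / 4 := by nlinarith
    nlinarith
  have hv0 : 0 ≤ c ^ 2 * e := by positivity
  have h1 : (2 * (c * (1 + e)) + (c * (1 + e)) ^ 2) / (p * e) ≤ 48 * p⁻¹ := by
    rw [← div_eq_mul_inv]
    exact div_le_div₀ (by norm_num) (by nlinarith) hp0 hq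
  have h2 : (2 * (c ^ 2 * e) + 2 * (c * (1 + e)) * (c ^ 2 * e) + (c ^ 2 * e) ^ 2) / (p * e) ^ 2 ≤
      152 * p⁻¹ := by
    rw [← div_eq_mul_inv]
    refine div_le_div₀ (by norm_num) ?_ hp0 hq2
    have h3 := mul_le_mul hu hv hv0 (by norm_num)
    have h4 := mul_le_mul hv hv hv0 (by norm_num)
    nlinarith
  linarith

lemma mollLocal_nonneg {ε c p : ℝ} (hp : 0 ≤ p) (hc : 0 ≤ c) : 0 ≤ mollLocal ε c p := by
  rw [mollLocal]
  positivity

lemma prod_mollLocal_le {N : ℕ} {ε : ℝ} (hN : 1 ≤ Real.log N) (hε : 0 ≤ ε)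
    (h : ε * Real.log N ≤ 1) :
    ∏ p ∈ N.primesBelow, mollLocal ε (|(-1 / 2 : ℝ)| * (p : ℝ) ^ (1 / Real.log N)) p ≤
      (1 + Real.log N) ^ 600 := by
  set η := 1 / Real.log N with hη
  have hη0 : 0 < η := by positivity
  have hηl : η * Real.log N ≤ 1 := by rw [hη, one_div_mul_cancel (by linarith)]
  have h2 : ∀ p ∈ N.primesBelow, (2 : ℝ) ≤ p := fun p hp => by
    exact_mod_cast (Nat.prime_of_mem_primesBelow hp).two_le
  have key : ∏ p ∈ N.primesBelow, mollLocal ε (|(-1 / 2 : ℝ)| * (p : ℝ) ^ η) p ≤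
      (∏ p ∈ N.primesBelow, (1 - (p : ℝ) ^ (-(1 + η)))⁻¹) ^ 600 := by
    rw [← Finset.prod_pow]
    refine Finset.prod_le_prod (fun p hp => mollLocal_nonneg (by positivity) (by positivity))
      fun p hp => ?_
    have hp2 := h2 p hp
    have hp0 : (0 : ℝ) < p := by linarith
    have hpη := rpow_le_three_of_mem_primesBelow hp hη0.le hηl
    have h3 := mollLocal_le_of_le hp2 hε (rpow_le_three_of_mem_primesBelow hp hε h)
      (c := |(-1 / 2 : ℝ)| * (p : ℝ) ^ η) (by positivity)
      (by rw [abs_of_nonpos (by norm_num)]; linarith)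
    set x := (p : ℝ) ^ (-(1 + η)) with hx
    have hx1 : x < 1 := Real.rpow_lt_one_of_one_lt_of_neg (by linarith) (by linarith)
    have h4 : (p : ℝ)⁻¹ ≤ 3 * x := by
      have : (p : ℝ)⁻¹ = x * (p : ℝ) ^ η := by
        rw [hx, ← Real.rpow_add hp0, ← Real.rpow_neg_one]
        congr 1
        ring
      rw [this, mul_comm]
      exact mul_le_mul_of_nonneg_right hpη (by positivity)
    have h5 : Real.exp x ≤ (1 - x)⁻¹ := by
      rw [le_inv_comm₀ (Real.exp_pos _) (by linarith), ← Real.exp_neg]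
      linarith [Real.add_one_le_exp (-x)]
    have h6 : 1 + 600 * x ≤ Real.exp x ^ 600 := by
      rw [← Real.exp_nat_mul]
      have := Real.add_one_le_exp (600 * x)
      push_cast
      linarith
    exact (h3.trans (by linarith)).trans (h6.trans
      (pow_le_pow_left₀ (Real.exp_pos _).le h5 600))
  refine key.trans (pow_le_pow_left₀ (Finset.prod_nonneg fun p hp => inv_nonneg.2 ?_) ?_ 600)
  · rw [sub_nonneg]
    exact Real.rpow_le_one_of_one_le_of_nonpos (by linarith [h2 p hp]) (by linarith)
  · have := prod_primesBelow_rpow_le (N := N) hη0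
    rwa [hη, one_div_one_div] at this

/-- The support of the mollifier. -/
noncomputable def mollSupport (N : ℕ) (Y : ℝ) : Finset ℕ :=
  ((∏ p ∈ N.primesBelow, p).divisors).filter fun n : ℕ => (n : ℝ) ≤ Y

/-- The coefficients of the mollifier. -/
noncomputable def mollCoeff : ℕ → ℝ := primeWeight fun _ => -1 / 2

lemma mollForm_mollSupport_le {N : ℕ} {ε Y : ℝ} (hN1 : 1 ≤ N) (hN : 1 ≤ Real.log N) (hε : 0 ≤ ε)
    (h : ε * Real.log N ^ 2 ≤ 1) (hY : 0 < Y) :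
    mollForm ε (mollSupport N Y) mollCoeff ≤ Real.exp 12 / Real.log N +
      Y ^ (-(1 / Real.log N)) * (1 + Real.log N) ^ 600 := by
  have hP : ∀ p ∈ N.primesBelow, p.Prime := fun p hp => Nat.prime_of_mem_primesBelow hp
  have hsq := squarefree_prod_of_primes hP
  have h1 := mollForm_filter_le (ε := ε) (η := 1 / Real.log N) (b := fun _ => -1 / 2)
    (B := (∏ p ∈ N.primesBelow, p).divisors)
    (fun n hn => Nat.pos_of_mem_divisors hn)
    (fun n hn => hsq.squarefree_of_dvd (Nat.dvd_of_mem_divisors hn)) hY (by positivity)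
  refine h1.trans ?_
  rw [mollForm_divisors_prod _ hP, mollForm_divisors_prod _ hP]
  have hεl : ε * Real.log N ≤ 1 := by nlinarith
  exact add_le_add (prod_mollLocal_neg_half_le hN1 hN hε h)
    (mul_le_mul_of_nonneg_left (prod_mollLocal_le hN hε hεl) (by positivity))

lemma one_le_of_mem_mollSupport {N : ℕ} {Y : ℝ} : ∀ n ∈ mollSupport N Y, 1 ≤ n :=
  fun _ hn => Nat.pos_of_mem_divisors (Finset.mem_filter.1 hn).1

lemma le_of_mem_mollSupport {N : ℕ} {Y : ℝ} : ∀ n ∈ mollSupport N Y, (n : ℝ) ≤ Y :=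
  fun _ hn => (Finset.mem_filter.1 hn).2

lemma one_mem_mollSupport {N : ℕ} {Y : ℝ} (hY : 1 ≤ Y) : 1 ∈ mollSupport N Y := by
  refine Finset.mem_filter.2 ⟨Nat.one_mem_divisors.2 ?_, by simpa using hY⟩
  exact Finset.prod_ne_zero_iff.2 fun p hp => (Nat.prime_of_mem_primesBelow hp).ne_zero

lemma mollCoeff_one : mollCoeff 1 = 1 := by simp [mollCoeff, primeWeight]

lemma abs_mollCoeff_le (n : ℕ) : |mollCoeff n| ≤ 1 := by
  rw [mollCoeff, primeWeight, Finset.abs_prod]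
  exact Finset.prod_le_one (fun _ _ => abs_nonneg _) fun _ _ => by norm_num [abs_le]

lemma Gammaℝ_critical (t : ℝ) : Complex.Gammaℝ (1 / 2 + Complex.I * t) =
    ((Real.pi ^ (-(1 / 4) : ℝ) * ‖Complex.Gamma (1 / 4 + Complex.I * t / 2)‖ : ℝ) : ℂ) *
      eTheta t := by
  have h1 : Complex.Gamma (1 / 4 + Complex.I * t / 2) ≠ 0 := by
    refine Complex.Gamma_ne_zero_of_re_pos ?_
    simp
  have hn : ((‖Complex.Gamma (1 / 4 + Complex.I * t / 2)‖ : ℝ) : ℂ) ≠ 0 := by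
    exact_mod_cast norm_ne_zero_iff.2 h1
  have hpi : (Real.pi : ℂ) ≠ 0 := by exact_mod_cast Real.pi_ne_zero
  rw [Complex.Gammaℝ_def, eTheta, Complex.ofReal_mul, Complex.ofReal_cpow Real.pi_pos.le,
    show -(1 / 2 + Complex.I * t) / 2 = ((-(1 / 4) : ℝ) : ℂ) + -(Complex.I * t) / 2 by
      push_cast; ring,
    show (1 / 2 + Complex.I * t) / 2 = 1 / 4 + Complex.I * t / 2 by ring, Complex.cpow_add _ _ hpi]
  generalize Complex.Gamma (1 / 4 + Complex.I * t / 2) = G at hn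
  field_simp

lemma one_half_add_ne_zero (t : ℝ) : (1 / 2 + Complex.I * t : ℂ) ≠ 0 := by
  intro h
  have := congrArg Complex.re h
  norm_num at this

lemma one_half_add_ne_one (t : ℝ) : (1 / 2 + Complex.I * t : ℂ) ≠ 1 := by
  intro h
  have := congrArg Complex.re h
  norm_num at this

lemma completedZeta_critical_eq_mul (t : ℝ) : completedRiemannZeta (1 / 2 + Complex.I * t) =
    Complex.Gammaℝ (1 / 2 + Complex.I * t) * riemannZeta (1 / 2 + Complex.I * t) := by
  rw [riemannZeta_def_of_ne_zero (one_half_add_ne_zero t), mul_div_cancel₀]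
  exact Complex.Gammaℝ_ne_zero_of_re_pos (by simp)

lemma conj_completedZeta_critical (t : ℝ) :
    (starRingEnd ℂ) (completedRiemannZeta (1 / 2 + Complex.I * t)) =
      completedRiemannZeta (1 / 2 + Complex.I * t) := by
  have h2 : (starRingEnd ℂ) (2 : ℂ) = 2 := Complex.conj_ofNat 2
  have hc : (starRingEnd ℂ) (1 / 2 + Complex.I * t) = 1 / 2 + Complex.I * (-t : ℝ) := by
    simp [h2]
  have hG : (starRingEnd ℂ) (Complex.Gammaℝ (1 / 2 + Complex.I * t)) =
      Complex.Gammaℝ (1 / 2 + Complex.I * (-t : ℝ)) := by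
    rw [Complex.Gammaℝ_def, Complex.Gammaℝ_def, map_mul, ← Complex.Gamma_conj, ← hc]
    congr 1
    · rw [show -(starRingEnd ℂ) (1 / 2 + Complex.I * t) / 2 =
        (starRingEnd ℂ) (-(1 / 2 + Complex.I * t) / 2) by simp [h2], Complex.cpow_conj,
        Complex.conj_ofReal]
      rw [Complex.arg_ofReal_of_nonneg Real.pi_pos.le]
      exact Real.pi_ne_zero.symm
    · simp [h2]
  conv_lhs => rw [completedZeta_critical_eq_mul]
  rw [map_mul, hG, ← riemannZeta_conj, hc,
    ← completedZeta_critical_eq_mul, ← completedRiemannZeta_one_sub (1 / 2 + Complex.I * t)]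
  congr 1
  push_cast
  ring

lemma tiltedXi_re (α t : ℝ) : (((tiltedXi α t).re : ℝ) : ℂ) = tiltedXi α t := by
  refine Complex.conj_eq_iff_re.1 ?_
  rw [tiltedXi, map_mul, conj_completedZeta_critical, Complex.conj_ofReal]

lemma tiltedXi_eq (α t : ℝ) : tiltedXi α t =
    ((Real.pi ^ (-(1 / 4) : ℝ) * ‖Complex.Gamma (1 / 4 + Complex.I * t / 2)‖ *
      Real.exp (α * t / 2) : ℝ) : ℂ) * (eTheta t * riemannZeta (1 / 2 + Complex.I * t)) := by
  rw [tiltedXi, completedZeta_critical_eq_mul, Gammaℝ_critical]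
  push_cast
  ring

lemma hardyZ_pos_of_tiltedXi_pos {α t : ℝ} (h : 0 < (tiltedXi α t).re) : 0 < HardyZ t := by
  rw [tiltedXi_eq, Complex.re_ofReal_mul] at h
  exact pos_of_mul_pos_right h (by positivity)

lemma norm_eTheta (t : ℝ) : ‖eTheta t‖ = 1 := by
  have h1 : ‖Complex.Gamma (1 / 4 + Complex.I * t / 2)‖ ≠ 0 := by
    refine norm_ne_zero_iff.2 (Complex.Gamma_ne_zero_of_re_pos ?_)
    simp
  rw [eTheta, norm_mul, norm_div, Complex.norm_real, norm_norm, div_self h1, mul_one,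
    Complex.norm_cpow_eq_rpow_re_of_pos Real.pi_pos]
  simp

lemma continuous_tiltedXi (α : ℝ) : Continuous (tiltedXi α) := by
  unfold tiltedXi
  refine Continuous.mul (continuous_iff_continuousAt.2 fun t => ?_) (by fun_prop)
  exact ContinuousAt.comp (g := completedRiemannZeta)
    (differentiableAt_completedZeta (one_half_add_ne_zero t) (one_half_add_ne_one t)).continuousAt
    (by fun_prop)

lemma norm_tiltedXi_ge {T t : ℝ} (hT : 2 ≤ T) (ht : T ≤ t) (ht' : t ≤ 2 * T) :
    1 / 6 * T ^ (-(1 / 4) : ℝ) * ‖riemannZeta (1 / 2 + Complex.I * t)‖ ≤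
      ‖tiltedXi (Real.pi / 2 - 1 / T) t‖ := by
  have hT0 : 0 < T := by linarith
  rw [tiltedXi_eq, norm_mul, norm_mul, norm_eTheta, one_mul, Complex.norm_real,
    Real.norm_of_nonneg (by positivity)]
  refine mul_le_mul_of_nonneg_right ?_ (norm_nonneg _)
  have h1 := gamma_quarter_lower (v := t / 2) (by linarith)
  have h2 : Real.exp (-(Real.pi * t / 4)) * T ^ (-(1 / 4) : ℝ) ≤
      ‖Complex.Gamma (1 / 4 + Complex.I * t / 2)‖ := by
    refine le_of_pow_le_pow_left₀ (n := 4) (by norm_num) (norm_nonneg _) ?_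
    have h3 : (T ^ (-(1 / 4) : ℝ)) ^ 4 = T⁻¹ := by
      rw [← Real.rpow_natCast, ← Real.rpow_mul hT0.le]
      norm_num
      exact Real.rpow_neg_one T
    rw [mul_pow, h3, ← Real.exp_nat_mul]
    have h4 : Complex.I * ((t / 2 : ℝ) : ℂ) = Complex.I * t / 2 := by push_cast; ring
    rw [h4] at h1
    refine le_trans ?_ h1
    rw [show ((4 : ℕ) : ℝ) * -(Real.pi * t / 4) = -(2 * Real.pi * (t / 2)) by push_cast; ring,
      div_eq_mul_inv]
    exact mul_le_mul_of_nonneg_left (inv_anti₀ (by linarith) (by linarith)) (Real.exp_pos _).le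
  have h5 : 1 / 2 ≤ Real.pi ^ (-(1 / 4) : ℝ) := by
    rw [Real.rpow_neg Real.pi_pos.le, one_div]
    refine inv_anti₀ (by positivity) (le_of_pow_le_pow_left₀ (n := 4) (by norm_num) (by norm_num) ?_)
    rw [← Real.rpow_natCast, ← Real.rpow_mul Real.pi_pos.le]
    norm_num
    linarith [Real.pi_lt_four]
  have h6 : Real.exp (-1) * Real.exp (Real.pi * t / 4) ≤
      Real.exp ((Real.pi / 2 - 1 / T) * t / 2) := by
    rw [← Real.exp_add]
    refine Real.exp_le_exp.2 ?_
    have : 1 / T * t ≤ 2 := by rw [one_div_mul_eq_div, div_le_iff₀ hT0]; exact ht'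
    nlinarith
  have h7 : 1 / 3 ≤ Real.exp (-1) := by
    rw [Real.exp_neg, one_div]
    exact inv_anti₀ (Real.exp_pos _) (by linarith [Real.exp_one_lt_d9])
  have h8 : Real.exp (-(Real.pi * t / 4)) * Real.exp (Real.pi * t / 4) = 1 := by
    rw [← Real.exp_add]; simp
  calc 1 / 6 * T ^ (-(1 / 4) : ℝ)
      = 1 / 2 * (1 / 3) * T ^ (-(1 / 4) : ℝ) := by ring
    _ ≤ Real.pi ^ (-(1 / 4) : ℝ) * Real.exp (-1) * T ^ (-(1 / 4) : ℝ) := by gcongr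
    _ = Real.pi ^ (-(1 / 4) : ℝ) * (Real.exp (-(Real.pi * t / 4)) * T ^ (-(1 / 4) : ℝ)) *
        (Real.exp (-1) * Real.exp (Real.pi * t / 4)) := by
        linear_combination (-(Real.pi ^ (-(1 / 4) : ℝ) * Real.exp (-1) * T ^ (-(1 / 4) : ℝ))) * h8
    _ ≤ _ := by gcongr

lemma sq_le_volume_pos_mul {h : ℝ → ℝ} (hc : Continuous h) {T D M : ℝ} (hT : 0 ≤ T) (hD : 0 < D)
    (hM : 0 < M) (h1 : 2 * D ≤ (∫ t in T..(2 * T), |h t|) + ∫ t in T..(2 * T), h t)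
    (h2 : ∫ t in T..(2 * T), h t ^ 2 ≤ M) :
    D ^ 2 ≤ (volume {t | t ∈ Set.Ioc T (2 * T) ∧ 0 < h t}).toReal * M := by
  set S := {t | 0 < h t} with hS
  have hSm : MeasurableSet S := (isOpen_lt continuous_const hc).measurableSet
  have hle : T ≤ 2 * T := by linarith
  have hset : {t | t ∈ Set.Ioc T (2 * T) ∧ 0 < h t} = S ∩ Set.Ioc T (2 * T) := by
    ext t; exact and_comm
  have hind : ∫ t in T..(2 * T), S.indicator (fun _ => (1 : ℝ)) t =
      (volume {t | t ∈ Set.Ioc T (2 * T) ∧ 0 < h t}).toReal := by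
    rw [intervalIntegral.integral_of_le hle, integral_indicator hSm,
      Measure.restrict_restrict hSm, hset]
    simp [Measure.real]
  have hindI : IntervalIntegrable (S.indicator fun _ => (1 : ℝ)) volume T (2 * T) := by
    rw [intervalIntegrable_iff_integrableOn_Ioc_of_le hle]
    exact (integrable_const (1 : ℝ)).indicator hSm
  have hpt : ∀ t, |h t| + h t ≤ D / M * h t ^ 2 + M / D * S.indicator (fun _ => (1 : ℝ)) t := by
    intro t
    by_cases ht : 0 < h t
    · rw [Set.indicator_of_mem (show t ∈ S from ht), abs_of_pos ht]
      have h3 : D / M * h t ^ 2 + M / D * 1 - (h t + h t) = (D * h t - M) ^ 2 / (M * D) := by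
        field_simp
        ring
      have : 0 ≤ (D * h t - M) ^ 2 / (M * D) := by positivity
      linarith
    · rw [abs_of_nonpos (not_lt.1 ht), neg_add_cancel]
      have : 0 ≤ S.indicator (fun _ => (1 : ℝ)) t := Set.indicator_nonneg (fun _ _ => zero_le_one) t
      positivity
  have hsq : IntervalIntegrable (fun t => D / M * h t ^ 2) volume T (2 * T) :=
    ((hc.pow 2).intervalIntegrable T (2 * T)).const_mul (D / M)
  have h4 : ∫ t in T..(2 * T), (|h t| + h t) ≤ ∫ t in T..(2 * T),
      (D / M * h t ^ 2 + M / D * S.indicator (fun _ => (1 : ℝ)) t) :=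
    intervalIntegral.integral_mono_on hle
    (((hc.abs.add hc).intervalIntegrable T (2 * T)))
    (hsq.add (hindI.const_mul (M / D)))
    fun t _ => hpt t
  rw [intervalIntegral.integral_add (hc.abs.intervalIntegrable _ _) (hc.intervalIntegrable _ _),
    intervalIntegral.integral_add hsq (hindI.const_mul (M / D)), intervalIntegral.integral_const_mul,
    intervalIntegral.integral_const_mul, hind] at h4
  have h5 : D / M * ∫ t in T..(2 * T), h t ^ 2 ≤ D := by
    calc _ ≤ D / M * M := mul_le_mul_of_nonneg_left h2 (by positivity)
      _ = D := by field_simp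
  set V := (volume {t | t ∈ Set.Ioc T (2 * T) ∧ 0 < h t}).toReal
  have h6 : D ≤ M / D * V := by linarith
  rw [div_mul_eq_mul_div, le_div_iff₀ hD] at h6
  linarith

lemma abs_tilt_lt {T : ℝ} (hT : 2 ≤ T) : |Real.pi / 2 - 1 / T| < Real.pi / 2 := by
  have h1 : 1 / T ≤ 1 / 2 := one_div_le_one_div_of_le (by norm_num) hT
  have h2 : 0 < 1 / T := by positivity
  rw [abs_lt]
  constructor <;> linarith [Real.pi_gt_three]

lemma half_le_sin_tilt {T : ℝ} (hT : 2 ≤ T) : 1 / 2 ≤ Real.sin (Real.pi / 2 - 1 / T) := by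
  have h1 : 1 / T ≤ 1 / 2 := one_div_le_one_div_of_le (by norm_num) hT
  have h2 : 0 < 1 / T := by positivity
  rw [Real.sin_pi_div_two_sub]
  have := Real.one_sub_sq_div_two_le_cos (x := 1 / T)
  nlinarith

lemma cos_tilt_rpow_neg_le {T x : ℝ} (hT : 2 ≤ T) (hx : 0 ≤ x) :
    Real.cos (Real.pi / 2 - 1 / T) ^ (-x) ≤ (2 * T) ^ x := by
  have h1 : 1 / T ≤ 1 / 2 := one_div_le_one_div_of_le (by norm_num) hT
  have hT0 : 0 < T := by linarith
  have h2 : 0 < 1 / T := by positivity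
  have h3 := Real.mul_le_sin h2.le (by linarith [Real.pi_gt_three])
  have h4 : 1 / 2 ≤ 2 / Real.pi := by
    rw [div_le_div_iff₀ (by norm_num) Real.pi_pos]
    linarith [Real.pi_lt_four]
  rw [Real.cos_pi_div_two_sub]
  have h5 : (2 * T)⁻¹ ≤ Real.sin (1 / T) := by
    refine le_trans (le_of_eq ?_) ((mul_le_mul_of_nonneg_right h4 h2.le).trans h3)
    field_simp
  calc Real.sin (1 / T) ^ (-x) ≤ ((2 * T)⁻¹) ^ (-x) :=
        Real.rpow_le_rpow_of_nonpos (by positivity) h5 (by linarith)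
    _ = (2 * T) ^ x := by rw [Real.inv_rpow (by positivity), Real.rpow_neg (by positivity), inv_inv]

lemma exists_forall_one_add_pow_le_exp (n : ℕ) :
    ∃ x₀ : ℝ, ∀ x ≥ x₀, (1 + x) ^ n ≤ Real.exp (x / 100) := by
  have h1 : Filter.Tendsto (fun x : ℝ => (1 + x) / 100) Filter.atTop Filter.atTop :=
    (Filter.tendsto_atTop_add_const_left _ 1 Filter.tendsto_id).atTop_div_const (by norm_num)
  have h2 := (Real.tendsto_pow_mul_exp_neg_atTop_nhds_zero n).comp h1
  have h3 : (0 : ℝ) < 1 / (100 ^ n * Real.exp (1 / 100)) := by positivity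
  obtain ⟨x₀, H⟩ := Filter.eventually_atTop.1 (h2.eventually (ge_mem_nhds h3))
  refine ⟨x₀, fun x hx => ?_⟩
  have h4 := H x hx
  simp only [Function.comp_apply] at h4
  rw [le_div_iff₀ (by positivity), div_pow] at h4
  have h5 : Real.exp (-((1 + x) / 100)) * Real.exp (1 / 100) * Real.exp (x / 100) = 1 := by
    rw [← Real.exp_add, ← Real.exp_add, Real.exp_eq_one_iff]
    ring
  have h6 : (1 + x) ^ n / 100 ^ n * Real.exp (-((1 + x) / 100)) *
      (100 ^ n * Real.exp (1 / 100)) * Real.exp (x / 100) = (1 + x) ^ n := by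
    have : ((100 : ℝ) ^ n) ≠ 0 := by positivity
    calc _ = (1 + x) ^ n * (100 ^ n / 100 ^ n) *
        (Real.exp (-((1 + x) / 100)) * Real.exp (1 / 100) * Real.exp (x / 100)) := by ring
      _ = _ := by rw [h5, div_self this]; ring
  have := mul_le_mul_of_nonneg_right h4 (Real.exp_pos (x / 100)).le
  rwa [h6, one_mul] at this

lemma exists_forall_exp_neg_mul_pow_le (n : ℕ) :
    ∃ x₀ : ℝ, ∀ l ≥ x₀, 0 < l → Real.exp (-(l / 100)) * (1 + l) ^ n ≤ 1 / l := by
  obtain ⟨x₀, H⟩ := exists_forall_one_add_pow_le_exp (n + 1)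
  refine ⟨x₀, fun l hl hl0 => ?_⟩
  rw [le_div_iff₀ hl0]
  have h4 := H l hl
  have h5 : (1 + l) ^ n * l ≤ (1 + l) ^ (n + 1) := by
    rw [pow_succ _ n]
    exact mul_le_mul_of_nonneg_left (by linarith) (by positivity)
  rw [mul_assoc]
  calc _ ≤ Real.exp (-(l / 100)) * Real.exp (l / 100) :=
        mul_le_mul_of_nonneg_left (h5.trans h4) (Real.exp_pos _).le
    _ = 1 := by rw [← Real.exp_add]; simp

lemma log_floor_exp_le (r : ℝ) (hr : 0 ≤ r) : Real.log ⌊Real.exp r⌋₊ ≤ r := by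
  have h1 : (1 : ℝ) ≤ ⌊Real.exp r⌋₊ := by
    exact_mod_cast Nat.le_floor (by simpa using Real.one_le_exp hr)
  rw [Real.log_le_iff_le_exp (by linarith)]
  exact Nat.floor_le (Real.exp_pos r).le

lemma half_le_log_floor_exp {r : ℝ} (hr : 2 ≤ r) : r / 2 ≤ Real.log ⌊Real.exp r⌋₊ := by
  have h1 := Nat.lt_floor_add_one (Real.exp r)
  have h2 : Real.exp r = Real.exp (r / 2) * Real.exp (r / 2) := by
    rw [← Real.exp_add]; congr 1; ring
  have h3 : 2 ≤ Real.exp (r / 2) := by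
    linarith [Real.add_one_le_exp (r / 2)]
  have h4 : Real.exp (r / 2) ≤ ⌊Real.exp r⌋₊ := by nlinarith
  rw [Real.le_log_iff_exp_le (by linarith)]
  exact h4

lemma exists_mollForm_le : ∃ R ≥ (2 : ℝ), ∀ r ≥ R,
    mollForm (1 / r ^ 2) (mollSupport ⌊Real.exp r⌋₊ (Real.exp (r ^ 2 / 100))) mollCoeff ≤
      2 * (Real.exp 12 + 1) / r := by
  obtain ⟨x₀, H⟩ := exists_forall_exp_neg_mul_pow_le 600
  refine ⟨max 2 (2 * x₀), le_max_left _ _, fun r hr => ?_⟩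
  have hr2 : 2 ≤ r := (le_max_left _ _).trans hr
  have hrx : 2 * x₀ ≤ r := (le_max_right _ _).trans hr
  have hr0 : 0 < r := by linarith
  have hl1 := log_floor_exp_le r (by linarith)
  have hl2 := half_le_log_floor_exp hr2
  have hN1 : 1 ≤ ⌊Real.exp r⌋₊ := Nat.le_floor (by simpa using Real.one_le_exp hr0.le)
  set N := ⌊Real.exp r⌋₊
  set l := Real.log N
  have hl0 : 0 < l := by linarith
  have hll : l ^ 2 ≤ r ^ 2 := pow_le_pow_left₀ hl0.le hl1 2
  have h2 : Real.exp (r ^ 2 / 100) ^ (-(1 / l)) ≤ Real.exp (-(l / 100)) := by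
    rw [← Real.exp_mul]
    refine Real.exp_le_exp.2 ?_
    have : l ≤ r ^ 2 * (1 / l) := by
      rw [mul_one_div, le_div_iff₀ hl0]
      linarith
    linarith
  have hl1' : 1 ≤ l := by linarith
  have hlx : x₀ ≤ l := by linarith
  have hlp : 0 ≤ 1 + l := by linarith
  have h5 : Real.exp 12 / l + 1 / l ≤ 2 * (Real.exp 12 + 1) / r := by
    rw [← add_div, div_le_div_iff₀ hl0 hr0]
    have := mul_le_mul_of_nonneg_left (by linarith : r ≤ 2 * l)
      (by positivity : 0 ≤ Real.exp 12 + 1)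
    linarith
  have h1 := mollForm_mollSupport_le (ε := 1 / r ^ 2) (Y := Real.exp (r ^ 2 / 100)) hN1
    hl1' (by positivity)
    (by rw [one_div_mul_eq_div]; exact div_le_one_of_le₀ hll (by positivity)) (Real.exp_pos _)
  exact h1.trans ((add_le_add_right ((mul_le_mul_of_nonneg_right h2
    (pow_nonneg hlp 600)).trans (H l hlx hl0)) _).trans h5)

lemma exists_integral_norm_sq_mollKer_tilt_le : ∃ K > (0 : ℝ), ∃ R ≥ (2 : ℝ), ∀ r ≥ R, ∀ T : ℝ,
    T = Real.exp (r ^ 2) →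
    Integrable (fun v => ‖mollKer (Real.pi / 2 - 1 / T)
      (mollSupport ⌊Real.exp r⌋₊ (Real.exp (r ^ 2 / 100))) mollCoeff v‖ ^ 2) ∧
    ∫ v, ‖mollKer (Real.pi / 2 - 1 / T)
      (mollSupport ⌊Real.exp r⌋₊ (Real.exp (r ^ 2 / 100))) mollCoeff v‖ ^ 2 ≤
        K * (T ^ (1 / 2 : ℝ) * r) := by
  obtain ⟨C, hC, H⟩ := exists_integral_norm_sq_mollKer_le
  obtain ⟨R, hR, HR⟩ := exists_mollForm_le
  refine ⟨2 * C + 32 * Real.exp 2 * (Real.exp 12 + 1), by positivity, R, hR,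
    fun r hr T hTr => ?_⟩
  have hr2 : 2 ≤ r := by linarith
  have hrr : 4 ≤ r ^ 2 := by nlinarith
  have hT : 2 ≤ T := by
    rw [hTr]; linarith [Real.add_one_le_exp (r ^ 2)]
  have hT0 : 0 < T := by linarith
  have hY1 : 1 ≤ Real.exp (r ^ 2 / 100) := Real.one_le_exp (by positivity)
  have hε1 : 1 / r ^ 2 ≤ 1 := div_le_one_of_le₀ (by linarith) (by positivity)
  obtain ⟨h1, h2⟩ := H (Real.pi / 2 - 1 / T) (Real.exp (r ^ 2 / 100)) (1 / r ^ 2)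
    (mollSupport ⌊Real.exp r⌋₊ (Real.exp (r ^ 2 / 100))) mollCoeff (abs_tilt_lt hT)
    (half_le_sin_tilt hT) (by positivity) hε1 one_le_of_mem_mollSupport le_of_mem_mollSupport hY1
    abs_mollCoeff_le
  refine ⟨h1, h2.trans ?_⟩
  have hTlog : Real.log (2 * T) ≤ 1 + r ^ 2 := by
    rw [Real.log_mul (by norm_num) hT0.ne', hTr, Real.log_exp]
    linarith [Real.log_two_lt_d9]
  have hpow : ∀ x : ℝ, 0 ≤ x → (2 * T) ^ x ≤ Real.exp ((1 + r ^ 2) * x) := fun x hx => by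
    rw [Real.rpow_def_of_pos (by positivity)]
    exact Real.exp_le_exp.2 (mul_le_mul_of_nonneg_right hTlog hx)
  have hsqrt : T ^ (1 / 2 : ℝ) = Real.exp (r ^ 2 / 2) := by
    rw [hTr, ← Real.exp_mul]
    congr 1
    ring
  have hterm1 : Real.exp (r ^ 2 / 100) ^ 10 *
      Real.cos (Real.pi / 2 - 1 / T) ^ (-(3 / 8) : ℝ) ≤ 2 * (T ^ (1 / 2 : ℝ) * r) := by
    have h3 := (cos_tilt_rpow_neg_le (x := 3 / 8) hT (by norm_num)).trans (hpow _ (by norm_num))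
    have h4 := mul_le_mul_of_nonneg_left h3 (by positivity : 0 ≤ Real.exp (r ^ 2 / 100) ^ 10)
    refine h4.trans ?_
    rw [← Real.exp_nat_mul, ← Real.exp_add, hsqrt]
    have h5 : Real.exp (((10 : ℕ) : ℝ) * (r ^ 2 / 100) + (1 + r ^ 2) * (3 / 8)) ≤
        Real.exp (1 + r ^ 2 / 2) := by
      refine Real.exp_le_exp.2 ?_
      push_cast
      linarith
    rw [Real.exp_add 1] at h5
    have h6 := Real.exp_one_lt_d9
    have h7 := Real.exp_pos (r ^ 2 / 2)
    have h8 : Real.exp 1 ≤ 2 * r := by linarith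
    have h9 := mul_le_mul_of_nonneg_right h8 h7.le
    linarith
  have hterm2 : Real.cos (Real.pi / 2 - 1 / T) ^ (-((1 + 1 / r ^ 2) / 2)) ≤
      Real.exp 2 * T ^ (1 / 2 : ℝ) := by
    refine ((cos_tilt_rpow_neg_le hT (by positivity)).trans (hpow _ (by positivity))).trans ?_
    rw [hsqrt, ← Real.exp_add]
    refine Real.exp_le_exp.2 ?_
    have : r ^ 2 * (1 / r ^ 2) = 1 := by field_simp
    linarith
  have hterm3 : ∑' m : ℕ, ((m : ℝ) + 1) ^ (-(1 + 1 / r ^ 2)) ≤ 2 * r ^ 2 := by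
    refine (tsum_add_one_rpow_le (by positivity)).trans ?_
    rw [one_div_one_div]
    linarith
  have ht0 : 0 ≤ ∑' m : ℕ, ((m : ℝ) + 1) ^ (-(1 + 1 / r ^ 2)) :=
    tsum_nonneg fun m => by positivity
  have hcos : 0 < Real.cos (Real.pi / 2 - 1 / T) := cos_pos_of_abs_lt (abs_tilt_lt hT)
  have hM := HR r hr
  have hMF : (∑' m : ℕ, ((m : ℝ) + 1) ^ (-(1 + 1 / r ^ 2))) *
      mollForm (1 / r ^ 2) (mollSupport ⌊Real.exp r⌋₊ (Real.exp (r ^ 2 / 100))) mollCoeff ≤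
        2 * r ^ 2 * (2 * (Real.exp 12 + 1) / r) :=
    (mul_le_mul_of_nonneg_left hM ht0).trans
      (mul_le_mul_of_nonneg_right hterm3 (by positivity))
  have h3 := (mul_le_mul_of_nonneg_left hMF (Real.rpow_nonneg hcos.le
    (-((1 + 1 / r ^ 2) / 2)))).trans
      (mul_le_mul_of_nonneg_right hterm2 (by positivity))
  have h4 : Real.exp 2 * T ^ (1 / 2 : ℝ) * (2 * r ^ 2 * (2 * (Real.exp 12 + 1) / r)) =
      4 * Real.exp 2 * (Real.exp 12 + 1) * (T ^ (1 / 2 : ℝ) * r) := by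
    field_simp
    ring
  rw [h4] at h3
  have h5 := mul_le_mul_of_nonneg_left hterm1 hC.le
  linarith

lemma volume_pos_le_jmeasplus {α T : ℝ} {W : ℝ → ℝ} (hW : ∀ t, 0 ≤ W t) :
    (volume {t | t ∈ Set.Ioc T (2 * T) ∧ 0 < (tiltedXi α t).re * W t}).toReal ≤ Jmeasplus T := by
  refine ENNReal.toReal_mono ?_ (measure_mono ?_)
  · refine ((measure_mono (fun t ht => ht.1)).trans_lt
      (measure_Ioc_lt_top (μ := volume) (a := T) (b := 2 * T))).ne
  · exact fun t ht => ⟨ht.1, hardyZ_pos_of_tiltedXi_pos (pos_of_mul_pos_left ht.2 (hW t))⟩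

lemma integral_abs_ge {B : Finset ℕ} {β : ℕ → ℝ} {Y T : ℝ} (hB : ∀ n ∈ B, 1 ≤ n)
    (hβ : ∀ n, |β n| ≤ 1) (hY : (B.card : ℝ) ≤ Y) (h1 : 1 ∈ B) (hβ1 : β 1 = 1) (hT : 2 ≤ T) :
    1 / 6 * T ^ (-(1 / 4) : ℝ) * (8 / 15 * T - 1000 * Y ^ 2 * √T) ≤
      ∫ t in T..(2 * T), |(tiltedXi (Real.pi / 2 - 1 / T) t).re *
        (bump T t * ‖dirPoly B β t‖ ^ 2)| := by
  have hT0 : 0 < T := by linarith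
  have h2 := first_moment hB hβ hY h1 hβ1 hT
  rw [intervalIntegral.integral_ofReal, integral_bump hT0] at h2
  have h3 := norm_sub_norm_le ((8 / 15 * T : ℝ) : ℂ) (∫ t in T..(2 * T), (bump T t : ℂ) *
    (riemannZeta (1 / 2 + Complex.I * t) * dirPoly B β t ^ 2))
  rw [norm_sub_rev, Complex.norm_real, Real.norm_of_nonneg (by positivity)] at h3
  have h4 : 8 / 15 * T - 1000 * Y ^ 2 * √T ≤ ‖∫ t in T..(2 * T), (bump T t : ℂ) *
    (riemannZeta (1 / 2 + Complex.I * t) * dirPoly B β t ^ 2)‖ := by linarith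
  have h5 := h4.trans (intervalIntegral.norm_integral_le_integral_norm (by linarith))
  have hφ : Continuous (dirPoly B β) := continuous_dirPoly hB
  have hζ := continuous_zeta_critical
  have hw := continuous_bump T
  have hx := continuous_tiltedXi (Real.pi / 2 - 1 / T)
  have hwc : Continuous fun t => (bump T t : ℂ) := Complex.continuous_ofReal.comp hw
  have h6 := mul_le_mul_of_nonneg_left h5 (by positivity : 0 ≤ 1 / 6 * T ^ (-(1 / 4) : ℝ))
  refine h6.trans ?_
  rw [← intervalIntegral.integral_const_mul]
  refine intervalIntegral.integral_mono_on (by linarith)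
    ((hwc.mul (hζ.mul (hφ.pow 2))).norm.const_mul _ |>.intervalIntegrable _ _)
    (((Complex.continuous_re.comp hx).mul (hw.mul (hφ.norm.pow 2))).abs.intervalIntegrable _ _)
    fun t ht => ?_
  have h7 := norm_tiltedXi_ge hT ht.1 ht.2
  have h8 : |(tiltedXi (Real.pi / 2 - 1 / T) t).re| = ‖tiltedXi (Real.pi / 2 - 1 / T) t‖ := by
    rw [← tiltedXi_re, Complex.norm_real, Complex.ofReal_re, Real.norm_eq_abs]
  have hb := bump_nonneg T t
  rw [abs_mul, h8, abs_of_nonneg (by positivity), norm_mul, norm_mul, norm_pow, Complex.norm_real,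
    Real.norm_of_nonneg hb]
  refine le_trans (le_of_eq ?_) (mul_le_mul_of_nonneg_right h7 (by positivity))
  ring

lemma abs_integral_eq {α T : ℝ} (B : Finset ℕ) (β : ℕ → ℝ) :
    |∫ t in T..(2 * T), (tiltedXi α t).re * (bump T t * ‖dirPoly B β t‖ ^ 2)| =
      ‖∫ t in T..(2 * T), (bump T t : ℂ) *
        (tiltedXi α t * ((‖dirPoly B β t‖ ^ 2 : ℝ) : ℂ))‖ := by
  rw [← Real.norm_eq_abs, ← Complex.norm_real, ← intervalIntegral.integral_ofReal]
  congr 1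
  refine intervalIntegral.integral_congr fun t _ => ?_
  simp only [Complex.ofReal_mul]
  rw [tiltedXi_re]
  ring

lemma integral_sq_le {α T Y : ℝ} {B : Finset ℕ} {β : ℕ → ℝ} (hα : |α| < Real.pi / 2)
    (hT : 0 < T) (hB : ∀ n ∈ B, 1 ≤ n) (hY : ∀ n ∈ B, (n : ℝ) ≤ Y) (hY1 : 1 ≤ Y)
    (hβ : ∀ n, |β n| ≤ 1) (hintg : Integrable fun v => ‖mollKer α B β v‖ ^ 2) :
    ∫ t in T..(2 * T), ((tiltedXi α t).re * (bump T t * ‖dirPoly B β t‖ ^ 2)) ^ 2 ≤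
      4 * Real.pi * Real.exp 4 * ∫ v, ‖mollKer α B β v‖ ^ 2 := by
  obtain ⟨C, hC, H⟩ := exists_norm_mollKer_le
  have hk : Integrable (mollKer α B β) := by
    refine (integrable_exp_neg_abs_div_four.const_mul
      (C * Y ^ 3 * Real.cos α ^ (-(3 / 5) : ℝ))).mono'
        (continuous_mollKer hα B β).aestronglyMeasurable (Filter.Eventually.of_forall fun v => ?_)
    exact H α v Y B β hα hB hY hY1 hβ
  refine le_trans ?_ (integral_sq_norm_fourier_le hk hintg hT)
  have hφ : Continuous (dirPoly B β) := continuous_dirPoly hB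
  have hx := continuous_tiltedXi α
  have hw := continuous_bump T
  simp_rw [← tiltedXi_mul_eq_integral hα hB]
  refine intervalIntegral.integral_mono_on (by linarith)
    ((((Complex.continuous_re.comp hx).mul (hw.mul (hφ.norm.pow 2))).pow 2).intervalIntegrable _ _)
    (((hx.mul (Complex.continuous_ofReal.comp (hφ.norm.pow 2))).norm.pow 2).intervalIntegrable _ _)
    fun t ht => ?_
  rw [← sq_abs]
  refine pow_le_pow_left₀ (abs_nonneg _) ?_ 2
  have hb := bump_nonneg T t
  have hb1 := bump_le_one hT ht
  rw [norm_mul, Complex.norm_real, abs_mul, Real.norm_of_nonneg (by positivity),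
    abs_of_nonneg (by positivity : 0 ≤ bump T t * ‖dirPoly B β t‖ ^ 2)]
  refine mul_le_mul (Complex.abs_re_le_norm _) ?_ (by positivity) (norm_nonneg _)
  exact mul_le_of_le_one_left (by positivity) hb1

theorem Jmeasplus_lower_bound :
    ∃ c > (0 : ℝ), ∃ T₀ : ℝ, ∀ T ≥ T₀,
      c * T * (Real.log T) ^ (-(1 : ℝ) / 2) ≤ Jmeasplus T := by
  obtain ⟨K, hK, R, hR, HK⟩ := exists_integral_norm_sq_mollKer_tilt_le
  obtain ⟨C, hC, HC⟩ := exists_norm_integral_tiltedXi_le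
  set K' := 4 * Real.pi * Real.exp 4 * K with hK'
  have hK'0 : 0 < K' := by positivity
  set R' := max R (400 * (84 + C)) with hR'
  refine ⟨1 / (2025 * K'), by positivity, Real.exp (R' ^ 2), fun T hT => ?_⟩
  have hR'0 : 2 ≤ R' := hR.trans (le_max_left _ _)
  have hT0 : 0 < T := (Real.exp_pos _).trans_le hT
  have hlog : R' ^ 2 ≤ Real.log T := (Real.le_log_iff_exp_le hT0).2 hT
  obtain ⟨r, hr, hTr⟩ : ∃ r, R' ≤ r ∧ T = Real.exp (r ^ 2) :=
    ⟨√(Real.log T), Real.le_sqrt_of_sq_le hlog, by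
      rw [Real.sq_sqrt ((sq_nonneg _).trans hlog), Real.exp_log hT0]⟩
  have hrR : R ≤ r := (le_max_left _ _).trans hr
  have hrC : 400 * (84 + C) ≤ r := (le_max_right _ _).trans hr
  have hr2 : 2 ≤ r := hR.trans hrR
  have hr0 : 0 < r := by linarith
  have hT2 : 2 ≤ T := by
    have : 4 ≤ r ^ 2 := by nlinarith
    rw [hTr]; linarith [Real.add_one_le_exp (r ^ 2)]
  have hlogr : (Real.log T) ^ (-(1 : ℝ) / 2) = r⁻¹ := by
    rw [hTr, Real.log_exp, ← Real.rpow_natCast, ← Real.rpow_mul hr0.le, ← Real.rpow_neg_one]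
    norm_num
  obtain ⟨hintg, hle⟩ := HK r hrR T hTr
  have hpow : ∀ x : ℝ, T ^ x = Real.exp (r ^ 2 * x) := fun x => by rw [hTr, ← Real.exp_mul]
  set Y := Real.exp (r ^ 2 / 100) with hY
  have hY1 : 1 ≤ Y := Real.one_le_exp (by positivity)
  set B := mollSupport ⌊Real.exp r⌋₊ Y with hB
  have hB1 : ∀ n ∈ B, 1 ≤ n := one_le_of_mem_mollSupport
  have hBY : ∀ n ∈ B, (n : ℝ) ≤ Y := le_of_mem_mollSupport
  have hα := abs_tilt_lt hT2
  set M := K' * (T ^ (1 / 2 : ℝ) * r) with hM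
  have hsq := integral_sq_le hα hT0 hB1 hBY hY1 abs_mollCoeff_le hintg
  have hsqM : 4 * Real.pi * Real.exp 4 * ∫ v, ‖mollKer (Real.pi / 2 - 1 / T) B mollCoeff v‖ ^ 2 ≤
      M := by
    refine (mul_le_mul_of_nonneg_left hle (by positivity)).trans (le_of_eq ?_)
    rw [hM, hK']
    ring
  have habs := integral_abs_ge hB1 abs_mollCoeff_le (card_le_of_forall_le hB1 hBY hY1)
    (one_mem_mollSupport hY1) mollCoeff_one hT2
  have hsmall := HC (Real.pi / 2 - 1 / T) T Y B mollCoeff hα hT0 hB1 hBY hY1 abs_mollCoeff_le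
  rw [← abs_integral_eq] at hsmall
  set h : ℝ → ℝ := fun t => (tiltedXi (Real.pi / 2 - 1 / T) t).re *
    (bump T t * ‖dirPoly B mollCoeff t‖ ^ 2) with hh
  have hcont : Continuous h := by
    have hφ : Continuous (dirPoly B mollCoeff) := continuous_dirPoly hB1
    exact (Complex.continuous_re.comp (continuous_tiltedXi _)).mul
      ((continuous_bump T).mul (hφ.norm.pow 2))
  set U := Real.exp (r ^ 2 * (63 / 100)) with hU
  set D := T ^ (3 / 4 : ℝ) / 45 with hD
  have hTU : 45 * (84 + C) * U ≤ T ^ (3 / 4 : ℝ) := by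
    have e : T ^ (3 / 4 : ℝ) = Real.exp (r ^ 2 * (12 / 100)) * U := by
      rw [hpow, hU, ← Real.exp_add]
      congr 1
      ring
    rw [e]
    refine mul_le_mul_of_nonneg_right ?_ (Real.exp_pos _).le
    have := Real.add_one_le_exp (r ^ 2 * (12 / 100))
    have h3 : 2 * r ≤ r ^ 2 := by nlinarith
    linarith
  have hsm : C * Y ^ 3 * Real.cos (Real.pi / 2 - 1 / T) ^ (-(3 / 5) : ℝ) ≤ 2 * C * U := by
    have h3 := cos_tilt_rpow_neg_le (x := 3 / 5) hT2 (by norm_num)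
    have h4 : (2 * T) ^ (3 / 5 : ℝ) ≤ 2 * Real.exp (r ^ 2 * (3 / 5)) := by
      rw [Real.mul_rpow (by norm_num) hT0.le, ← hpow]
      refine mul_le_mul_of_nonneg_right ?_ (by positivity)
      calc (2 : ℝ) ^ (3 / 5 : ℝ) ≤ 2 ^ (1 : ℝ) :=
            Real.rpow_le_rpow_of_exponent_le (by norm_num) (by norm_num)
        _ = 2 := Real.rpow_one 2
    have h5 : U = Y ^ 3 * Real.exp (r ^ 2 * (3 / 5)) := by
      rw [hU, hY, ← Real.exp_nat_mul, ← Real.exp_add]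
      congr 1
      push_cast
      ring
    calc _ ≤ C * Y ^ 3 * (2 * Real.exp (r ^ 2 * (3 / 5))) :=
          mul_le_mul_of_nonneg_left (h3.trans h4) (by positivity)
      _ = 2 * C * U := by rw [h5]; ring
  have hmain : 4 / 45 * T ^ (3 / 4 : ℝ) - 168 * U ≤
      1 / 6 * T ^ (-(1 / 4) : ℝ) * (8 / 15 * T - 1000 * Y ^ 2 * √T) := by
    have h3 : T ^ (-(1 / 4) : ℝ) * T = T ^ (3 / 4 : ℝ) := by
      rw [← Real.rpow_add_one hT0.ne']
      norm_num
    have h4 : T ^ (-(1 / 4) : ℝ) * (Y ^ 2 * √T) ≤ U := by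
      rw [Real.sqrt_eq_rpow, hpow, hpow, hU, hY, ← Real.exp_nat_mul, ← Real.exp_add,
        ← Real.exp_add]
      refine Real.exp_le_exp.2 ?_
      push_cast
      linarith [sq_nonneg r]
    have hU0 : 0 < U := Real.exp_pos _
    linear_combination (4 / 45) * h3.ge + (1000 / 6) * h4 + (4 / 3) * hU0.le
  have h2D : 2 * D ≤ (∫ t in T..(2 * T), |h t|) + ∫ t in T..(2 * T), h t := by
    have h3 := neg_abs_le (∫ t in T..(2 * T), h t)
    have h4 := hmain.trans habs
    have h5 := hsmall.trans hsm
    rw [hD]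
    linarith
  have hfin := sq_le_volume_pos_mul hcont hT0.le (by positivity) (by positivity) h2D
    (hsq.trans hsqM)
  have hJ := volume_pos_le_jmeasplus (α := Real.pi / 2 - 1 / T) (T := T)
    (W := fun t => bump T t * ‖dirPoly B mollCoeff t‖ ^ 2)
    (fun t => mul_nonneg (bump_nonneg T t) (by positivity))
  have hD2 : D ^ 2 = T * T ^ (1 / 2 : ℝ) / 2025 := by
    have : (T ^ (3 / 4 : ℝ)) ^ 2 = T * T ^ (1 / 2 : ℝ) := by
      rw [← Real.rpow_natCast, ← Real.rpow_mul hT0.le, ← Real.rpow_one_add' hT0.le (by norm_num)]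
      norm_num
    rw [hD, div_pow, this]
    norm_num
  rw [hlogr]
  refine le_trans ?_ hJ
  rw [hD2] at hfin
  have hM0 : 0 < M := by positivity
  refine le_trans (le_of_eq ?_) ((div_le_iff₀ hM0).2 hfin)
  rw [hM]
  field_simp
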